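/- Let F be a field other than the two-element field. For every n ≥ 1, the stabilization map O_{n,n}(F) → O_{n+1,n+1}(F), extending an isometry by the identity on an added hyperbolic plane, induces an isomorphism H_d(O_{n,n}(F); ℤ) → H_d(O_{n+1,n+1}(F); ℤ) for all d ≤ n − 1, and a surjection for d = n. -/

import Mathlib

/-! # Group homology via the inhomogeneous bar complex (trivial coefficients) -/

namespace GroupHomologyBar

variable (G : Type) [Group G] (A : Type) [AddCommGroup A]

/-- Inhomogeneous `n`-chains of `G` with coefficients in `A`. -/
abbrev chains (n : ℕ) : Type := (Fin n → G) →₀ A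

/-- The differential of the inhomogeneous bar complex with trivial `G`-action on the
coefficients, sending `[g₁|…|g_{n+1}] ⊗ a` to
`[g₂|…|g_{n+1}] ⊗ a + ∑ⱼ (-1)^{j+1} [g₁|…|gⱼg_{j+1}|…|g_{n+1}] ⊗ a`
(the last summand of the sum being `(-1)^{n+1} [g₁|…|g_n] ⊗ a`). -/
noncomputable def d (n : ℕ) : chains G A (n + 1) →ₗ[ℤ] chains G A n :=
  Finsupp.lsum ℤ fun g =>
    (Finsupp.lsingle (Fin.tail g) : A →ₗ[ℤ] chains G A n)
      + ∑ j : Fin (n + 1),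
          ((-1 : ℤ) ^ ((j : ℕ) + 1)) • Finsupp.lsingle (Fin.contractNth j (· * ·) g)

/-- The `n`-cycles. -/
noncomputable def cycles : (n : ℕ) → Submodule ℤ (chains G A n)
  | 0 => ⊤
  | (n + 1) => LinearMap.ker (d G A n)

/-- The `n`-boundaries, viewed as a submodule of the `n`-cycles. -/
noncomputable def boundaries (n : ℕ) : Submodule ℤ (cycles G A n) :=
  Submodule.comap (cycles G A n).subtype (LinearMap.range (d G A n))

/-- The group homology `H_n(G; A)` of `G` with trivial coefficients in `A`. -/
abbrev Homology (n : ℕ) : Type := cycles G A n ⧸ boundaries G A n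

variable {G}
variable {G' : Type} [Group G']

/-- The map on chains induced by a group homomorphism. -/
noncomputable def chainsMap (φ : G →* G') (n : ℕ) : chains G A n →ₗ[ℤ] chains G' A n :=
  Finsupp.lmapDomain A ℤ fun v => φ ∘ v

lemma chainsMap_single (φ : G →* G') {n : ℕ} (v : Fin n → G) (a : A) :
    chainsMap A φ n (Finsupp.single v a) = Finsupp.single (φ ∘ v) a := by
  simp [chainsMap, Finsupp.mapDomain_single]

lemma d_single {n : ℕ} (g : Fin (n + 1) → G) (a : A) :
    d G A n (Finsupp.single g a)
      = Finsupp.single (Fin.tail g) a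
        + ∑ j : Fin (n + 1),
            ((-1 : ℤ) ^ ((j : ℕ) + 1)) • Finsupp.single (Fin.contractNth j (· * ·) g) a := by
  simp [d, Finsupp.lsum_single]

lemma d_chainsMap (φ : G →* G') (n : ℕ) :
    (d G' A n).comp (chainsMap A φ (n + 1)) = (chainsMap A φ n).comp (d G A n) := by
  apply Finsupp.lhom_ext
  intro g a
  have hc : ∀ j : Fin (n + 1),
      φ ∘ Fin.contractNth j (· * ·) g = Fin.contractNth j (· * ·) (φ ∘ g) := by
    intro j
    funext k
    simp only [Function.comp_apply, Fin.contractNth]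
    split_ifs <;> simp
  simp only [LinearMap.comp_apply, chainsMap_single, d_single, map_add, map_sum, map_smul,
    chainsMap_single, Fin.comp_tail, hc]

lemma chainsMap_mem_cycles (φ : G →* G') (n : ℕ) :
    ∀ x ∈ cycles G A n, chainsMap A φ n x ∈ cycles G' A n := by
  intro x hx
  cases n with
  | zero => trivial
  | succ n =>
    simp only [cycles, LinearMap.mem_ker] at hx ⊢
    have := congrArg (fun L : chains G A (n + 1) →ₗ[ℤ] chains G' A n => L x) (d_chainsMap A φ n)
    simp only [LinearMap.comp_apply] at this
    rw [this, hx, map_zero]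

/-- The map on cycles induced by a group homomorphism. -/
noncomputable def cyclesMap (φ : G →* G') (n : ℕ) : cycles G A n →ₗ[ℤ] cycles G' A n :=
  (chainsMap A φ n).restrict (chainsMap_mem_cycles A φ n)

/-- The map `H_n(G; A) → H_n(G'; A)` on group homology induced by a group
homomorphism `φ : G →* G'`. -/
noncomputable def inducedMap (φ : G →* G') (n : ℕ) :
    Homology G A n →ₗ[ℤ] Homology G' A n :=
  Submodule.mapQ _ _ (cyclesMap A φ n) (by
    rintro ⟨x, hx⟩ hmem
    simp only [boundaries, Submodule.mem_comap, Submodule.subtype_apply,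
      LinearMap.mem_range] at hmem ⊢
    obtain ⟨y, hy⟩ := hmem
    refine ⟨chainsMap A φ (n + 1) y, ?_⟩
    have := congrArg (fun L : chains G A (n + 1) →ₗ[ℤ] chains G' A n => L y) (d_chainsMap A φ n)
    simp only [LinearMap.comp_apply] at this
    rw [this, hy]
    rfl)

end GroupHomologyBar

section Isometries

variable (F : Type) [Field F] {W : Type} [AddCommGroup W] [Module F W]

/-- The group of linear automorphisms of a vector space `V` preserving a
function `Q : V → F` (e.g. a quadratic form). -/
def quadIsoms {V : Type} [AddCommGroup V] [Module F V] (Q : V → F) :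
    Subgroup (V ≃ₗ[F] V) where
  carrier := {g | ∀ v, Q (g v) = Q v}
  one_mem' := fun _ => rfl
  mul_mem' := fun {a b} ha hb v => by
    rw [show (a * b) v = a (b v) from rfl, ha, hb]
  inv_mem' := fun {a} ha v => by
    rw [show (a⁻¹ : V ≃ₗ[F] V) v = a.symm v from rfl, ← ha (a.symm v), a.apply_symm_apply]

/-- The group of linear automorphisms of a vector space `V` preserving a
pairing `ω : V → V → F` (e.g. a bilinear or sesquilinear form). -/
def bilinIsoms {V : Type} [AddCommGroup V] [Module F V] (ω : V → V → F) :
    Subgroup (V ≃ₗ[F] V) where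
  carrier := {g | ∀ v w, ω (g v) (g w) = ω v w}
  one_mem' := fun _ _ => rfl
  mul_mem' := fun {a b} ha hb v w => by
    rw [show (a * b) v = a (b v) from rfl, show (a * b) w = a (b w) from rfl, ha, hb]
  inv_mem' := fun {a} ha v w => by
    rw [show (a⁻¹ : V ≃ₗ[F] V) v = a.symm v from rfl,
      show (a⁻¹ : V ≃ₗ[F] V) w = a.symm w from rfl,
      ← ha (a.symm v) (a.symm w), a.apply_symm_apply, a.apply_symm_apply]

/-- The "orthogonal sum" form `x ↦ ∑ i, q (x i)` on `W^n`. -/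
def sumForm (q : W → F) (n : ℕ) (x : Fin n → W) : F := ∑ i, q (x i)

/-- The "orthogonal sum" pairing `(x, y) ↦ ∑ i, β (x i) (y i)` on `W^n`. -/
def pairForm (β : W → W → F) (n : ℕ) (x y : Fin n → W) : F := ∑ i, β (x i) (y i)

/-- The linear equivalence `W^{n+1} ≃ W^n × W` splitting off the last coordinate. -/
def lastSplit (n : ℕ) : (Fin (n + 1) → W) ≃ₗ[F] (Fin n → W) × W where
  toLinearMap := (LinearMap.funLeft F W Fin.castSucc).prod (LinearMap.proj (Fin.last n))
  invFun p := Fin.snoc p.1 p.2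
  left_inv x := Fin.snoc_init_self x
  right_inv p := by
    refine Prod.ext (funext fun i => ?_) ?_
    · exact @Fin.snoc_castSucc n (fun _ => W) p.2 p.1 i
    · exact @Fin.snoc_last n (fun _ => W) p.2 p.1

lemma lastSplit_symm_apply (n : ℕ) (p : Fin n → W) (w : W) :
    (lastSplit F n).symm (p, w) = Fin.snoc p w := rfl

/-- Extension of an automorphism of `W^n` to `W^{n+1}` by the identity on the
added last coordinate. -/
def stabAut (n : ℕ) (g : (Fin n → W) ≃ₗ[F] (Fin n → W)) :
    (Fin (n + 1) → W) ≃ₗ[F] (Fin (n + 1) → W) :=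
  (lastSplit F n).trans ((g.prodCongr (LinearEquiv.refl F W)).trans (lastSplit F n).symm)

lemma stabAut_symm_apply (n : ℕ) (g : (Fin n → W) ≃ₗ[F] (Fin n → W))
    (p : Fin n → W) (w : W) :
    stabAut F n g ((lastSplit F n).symm (p, w)) = (lastSplit F n).symm (g p, w) := by
  simp [stabAut, LinearEquiv.trans_apply, LinearEquiv.apply_symm_apply, LinearEquiv.prodCongr_apply]

lemma sumForm_snoc (q : W → F) (n : ℕ) (p : Fin n → W) (w : W) :
    sumForm F q (n + 1) ((lastSplit F n).symm (p, w)) = sumForm F q n p + q w := by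
  simp [sumForm, lastSplit_symm_apply, Fin.sum_univ_castSucc, Fin.snoc_castSucc, Fin.snoc_last]

lemma pairForm_snoc (β : W → W → F) (n : ℕ) (p p' : Fin n → W) (w w' : W) :
    pairForm F β (n + 1) ((lastSplit F n).symm (p, w)) ((lastSplit F n).symm (p', w'))
      = pairForm F β n p p' + β w w' := by
  simp [pairForm, lastSplit_symm_apply, Fin.sum_univ_castSucc, Fin.snoc_castSucc, Fin.snoc_last]

/-- The stabilization homomorphism on the isometry group of the form `sumForm q n`,
extending an isometry by the identity on the added summand. -/
def quadStab (q : W → F) (n : ℕ) :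
    quadIsoms F (sumForm F q n) →* quadIsoms F (sumForm F q (n + 1)) where
  toFun g := ⟨stabAut F n g.1, by
    intro v
    obtain ⟨⟨p, w⟩, rfl⟩ : ∃ x, (lastSplit F n).symm x = v :=
      ⟨lastSplit F n v, (lastSplit F n).symm_apply_apply v⟩
    rw [stabAut_symm_apply, sumForm_snoc, sumForm_snoc, g.2 p]⟩
  map_one' := by
    refine Subtype.ext (LinearEquiv.ext fun v => ?_)
    show stabAut F n 1 v = v
    obtain ⟨⟨p, w⟩, rfl⟩ : ∃ x, (lastSplit F n).symm x = v :=
      ⟨lastSplit F n v, (lastSplit F n).symm_apply_apply v⟩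
    rw [stabAut_symm_apply]
    rfl
  map_mul' g h := by
    refine Subtype.ext (LinearEquiv.ext fun v => ?_)
    show stabAut F n (g.1 * h.1) v = stabAut F n g.1 (stabAut F n h.1 v)
    obtain ⟨⟨p, w⟩, rfl⟩ : ∃ x, (lastSplit F n).symm x = v :=
      ⟨lastSplit F n v, (lastSplit F n).symm_apply_apply v⟩
    rw [stabAut_symm_apply, stabAut_symm_apply, stabAut_symm_apply]
    rfl

/-- The stabilization homomorphism on the isometry group of the pairing `pairForm β n`,
extending an isometry by the identity on the added summand. -/
def bilinStab (β : W → W → F) (n : ℕ) :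
    bilinIsoms F (pairForm F β n) →* bilinIsoms F (pairForm F β (n + 1)) where
  toFun g := ⟨stabAut F n g.1, by
    intro v v'
    obtain ⟨⟨p, w⟩, rfl⟩ : ∃ x, (lastSplit F n).symm x = v :=
      ⟨lastSplit F n v, (lastSplit F n).symm_apply_apply v⟩
    obtain ⟨⟨p', w'⟩, rfl⟩ : ∃ x, (lastSplit F n).symm x = v' :=
      ⟨lastSplit F n v', (lastSplit F n).symm_apply_apply v'⟩
    rw [stabAut_symm_apply, stabAut_symm_apply, pairForm_snoc, pairForm_snoc, g.2 p p']⟩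
  map_one' := by
    refine Subtype.ext (LinearEquiv.ext fun v => ?_)
    show stabAut F n 1 v = v
    obtain ⟨⟨p, w⟩, rfl⟩ : ∃ x, (lastSplit F n).symm x = v :=
      ⟨lastSplit F n v, (lastSplit F n).symm_apply_apply v⟩
    rw [stabAut_symm_apply]
    rfl
  map_mul' g h := by
    refine Subtype.ext (LinearEquiv.ext fun v => ?_)
    show stabAut F n (g.1 * h.1) v = stabAut F n g.1 (stabAut F n h.1 v)
    obtain ⟨⟨p, w⟩, rfl⟩ : ∃ x, (lastSplit F n).symm x = v :=
      ⟨lastSplit F n v, (lastSplit F n).symm_apply_apply v⟩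
    rw [stabAut_symm_apply, stabAut_symm_apply, stabAut_symm_apply]
    rfl

end Isometries

/-- The hyperbolic quadratic form on the hyperbolic plane `F² = F × F`. -/
def hypPlaneQuad (F : Type) [Field F] (s : F × F) : F := s.1 * s.2

namespace HS
open Finsupp

/-! ## Chains on lists -/

abbrev LC (α : Type) := List α →₀ ℤ

/-- linear extension of a function on basis elements -/
noncomputable abbrev lx {α M : Type} [AddCommGroup M] (f : α → M) : (α →₀ ℤ) →ₗ[ℤ] M :=
  Finsupp.linearCombination ℤ f

/-- basis element -/
noncomputable abbrev sg {α : Type} (a : α) : α →₀ ℤ := Finsupp.single a 1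

lemma lx_sg {α M : Type} [AddCommGroup M] (f : α → M) (a : α) : lx f (sg a) = f a := by
  simp

lemma lhom_ext' {α M : Type} [AddCommGroup M] {f g : (α →₀ ℤ) →ₗ[ℤ] M}
    (h : ∀ a, f (sg a) = g (sg a)) : f = g := by
  apply Finsupp.lhom_ext
  intro a b
  have : (Finsupp.single a b : α →₀ ℤ) = b • sg a := by simp
  rw [this, map_smul, map_smul, h]

lemma lhom_congr {α M : Type} [AddCommGroup M] {f g : (α →₀ ℤ) →ₗ[ℤ] M}
    (h : ∀ a, f (sg a) = g (sg a)) (x : α →₀ ℤ) : f x = g x := by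
  rw [lhom_ext' h]

/-- linear map induced by a map of bases -/
noncomputable abbrev mp {α β : Type} (f : α → β) : (α →₀ ℤ) →ₗ[ℤ] (β →₀ ℤ) :=
  lx (fun a => sg (f a))

/-- submodule of chains supported in a set -/
abbrev sp {α : Type} (s : Set α) : Submodule ℤ (α →₀ ℤ) := Finsupp.supported ℤ ℤ s

lemma sg_mem_sp {α : Type} {s : Set α} {a : α} (h : a ∈ s) : sg a ∈ sp s :=
  Finsupp.single_mem_supported ℤ 1 h

lemma sp_le {α M : Type} [AddCommGroup M] {s : Set α} (f : (α →₀ ℤ) →ₗ[ℤ] M)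
    (p : Submodule ℤ M) (h : ∀ a ∈ s, f (sg a) ∈ p) : ∀ x ∈ sp s, f x ∈ p := by
  intro x hx
  rw [sp, Finsupp.supported_eq_span_single] at hx
  have : Submodule.span ℤ ((fun i => Finsupp.single i (1:ℤ)) '' s) ≤ p.comap f := by
    rw [Submodule.span_le]
    rintro _ ⟨a, ha, rfl⟩
    exact h a ha
  exact this hx

lemma sp_congr {α M : Type} [AddCommGroup M] {s : Set α} {f g : (α →₀ ℤ) →ₗ[ℤ] M}
    (h : ∀ a ∈ s, f (sg a) = g (sg a)) : ∀ x ∈ sp s, f x = g x := by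
  intro x hx
  have := sp_le (f - g) ⊥ (s := s) (by intro a ha; simp [h a ha]) x hx
  simpa [sub_eq_zero] using this

lemma sp_mono {α : Type} {s t : Set α} (h : s ⊆ t) {x} (hx : x ∈ sp s) : x ∈ sp t :=
  Finsupp.supported_mono h hx

/-- cons as linear map -/
noncomputable abbrev cn {α : Type} (a : α) : LC α →ₗ[ℤ] LC α := mp (List.cons a)

noncomputable def bdL {α : Type} : List α → LC α
  | [] => 0
  | a :: l => sg l - cn a (bdL l)

noncomputable abbrev bd {α : Type} : LC α →ₗ[ℤ] LC α := lx bdL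

lemma bd_cn {α : Type} (a : α) (x : LC α) : bd (cn a x) = x - cn a (bd x) := by
  refine lhom_congr (f := bd ∘ₗ cn a) (g := LinearMap.id - cn a ∘ₗ bd) ?_ x
  intro l
  simp [bdL]

lemma bd_bd {α : Type} (x : LC α) : bd (bd x) = 0 := by
  refine lhom_congr (f := bd ∘ₗ bd) (g := 0) ?_ x
  intro l
  induction l with
  | nil => simp [bdL]
  | cons a l ih =>
    simp only [LinearMap.comp_apply, lx_sg, LinearMap.zero_apply] at ih ⊢
    rw [bdL, map_sub, bd_cn, ih]
    simp

/-- set of lists in `X` of length `k` -/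
def lev {α : Type} (X : Set (List α)) (k : ℕ) : Set (List α) := {l | l ∈ X ∧ l.length = k}

/-- closed under faces: all sublists -/
def FC {α : Type} (X : Set (List α)) : Prop := ∀ l ∈ X, ∀ l' , List.Sublist l' l → l' ∈ X

lemma bdL_mem {α : Type} (l : List α) : ∀ (k : ℕ), l.length = k + 1 →
    bdL l ∈ sp {l' | List.Sublist l' l ∧ l'.length = k} := by
  induction l with
  | nil => intro k hk; simp at hk
  | cons a l ih =>
    intro k hk
    rw [bdL]
    have hl : l.length = k := by simpa using hk
    refine Submodule.sub_mem _ (sg_mem_sp (s := {l' | List.Sublist l' (a :: l) ∧ l'.length = k})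
      (And.intro (List.sublist_cons_self a l) hl)) ?_
    cases k with
    | zero =>
      have : l = [] := List.length_eq_zero_iff.mp hl
      subst this
      simp [bdL]
    | succ k =>
      refine sp_le (cn a) _ ?_ _ (ih k hl)
      rintro l' ⟨h1, h2⟩
      rw [lx_sg]
      exact sg_mem_sp (And.intro (h1.cons_cons a) (by simp [h2]))

lemma bd_mem {α : Type} {X : Set (List α)} (hX : FC X) {k : ℕ} {x : LC α}
    (hx : x ∈ sp (lev X (k+1))) : bd x ∈ sp (lev X k) := by
  refine sp_le bd _ ?_ x hx
  rintro l ⟨h1, h2⟩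
  rw [lx_sg]
  exact sp_mono (t := lev X k) (fun l' h => And.intro (hX l h1 l' h.1) h.2) (bdL_mem l k h2)

lemma bd_zero {α : Type} {X : Set (List α)} {x : LC α}
    (hx : x ∈ sp (lev X 0)) : bd x = 0 := by
  refine sp_congr (f := bd) (g := 0) ?_ x hx
  rintro l ⟨h1, h2⟩
  have : l = [] := List.length_eq_zero_iff.mp h2
  subst this
  simp [bdL]

/-- Exactness of the augmented tuple complex of `X` at length `k`. -/
def Ex {α : Type} (X : Set (List α)) (k : ℕ) : Prop :=
  ∀ x ∈ sp (lev X k), bd x = 0 → ∃ y ∈ sp (lev X (k+1)), bd y = x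

lemma Ex_cone {α : Type} {X : Set (List α)} (a : α) (h : ∀ l ∈ X, a :: l ∈ X) (k : ℕ) : Ex X k := by
  intro x hx hb
  refine ⟨cn a x, ?_, ?_⟩
  · refine sp_le (cn a) _ ?_ x hx
    rintro l ⟨h1, h2⟩
    rw [lx_sg]
    exact sg_mem_sp (s := lev X (k+1)) ⟨h l h1, by simp [h2]⟩
  · rw [bd_cn, hb]; simp

/-! ### Prism operator -/

noncomputable def prL {α : Type} (φ : α → α) : List α → LC α
  | [] => 0
  | a :: l => sg (a :: φ a :: l.map φ) - cn a (prL φ l)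

noncomputable abbrev pr {α : Type} (φ : α → α) : LC α →ₗ[ℤ] LC α := lx (prL φ)

lemma pr_cn {α : Type} (φ : α → α) (a : α) (x : LC α) :
    pr φ (cn a x) = cn a (cn (φ a) (mp (List.map φ) x)) - cn a (pr φ x) := by
  refine lhom_congr (f := pr φ ∘ₗ cn a) (g := cn a ∘ₗ cn (φ a) ∘ₗ mp (List.map φ) - cn a ∘ₗ pr φ) ?_ x
  intro l
  simp [prL]

lemma bdL_map {α β : Type} (φ : α → β) (l : List α) : bdL (l.map φ) = mp (List.map φ) (bdL l) := by
  induction l with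
  | nil => simp [bdL]
  | cons a l ih =>
    simp only [List.map_cons, bdL, map_sub, ih, lx_sg]
    congr 1
    refine lhom_congr (f := cn (φ a) ∘ₗ mp (List.map φ)) (g := mp (List.map φ) ∘ₗ cn a) ?_ (bdL l)
    intro l; simp

lemma bd_map {α β : Type} (φ : α → β) (x : LC α) : bd (mp (List.map φ) x) = mp (List.map φ) (bd x) := by
  refine lhom_congr (f := bd ∘ₗ mp (List.map φ)) (g := mp (List.map φ) ∘ₗ bd) ?_ x
  intro l
  simp [bdL_map]

lemma prism {α : Type} (φ : α → α) (x : LC α) :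
    bd (pr φ x) + pr φ (bd x) = mp (List.map φ) x - x := by
  refine lhom_congr (f := bd ∘ₗ pr φ + pr φ ∘ₗ bd) (g := mp (List.map φ) - LinearMap.id) ?_ x
  intro l
  induction l with
  | nil => simp [bdL, prL]
  | cons a l ih =>
    simp only [LinearMap.add_apply, LinearMap.comp_apply, lx_sg, LinearMap.sub_apply,
      LinearMap.id_apply] at ih ⊢
    rw [prL, bdL, map_sub, map_sub, bd_cn, pr_cn, lx_sg, lx_sg]
    have h1 : bdL (a :: φ a :: l.map φ) = sg (φ a :: l.map φ) - cn a (sg (l.map φ))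
        + cn a (cn (φ a) (mp (List.map φ) (bdL l))) := by
      rw [bdL, bdL, map_sub, bdL_map]; abel
    have h2 : cn a (bd (prL φ l)) = cn a (sg (l.map φ)) - cn a (sg l) - cn a (pr φ (bdL l)) := by
      rw [← map_sub, ← map_sub, ← ih]; congr 1; abel
    rw [h1, h2, List.map_cons]
    simp only [lx_sg]
    abel

end HS

namespace HS
open Finsupp

/-! ## Bigraded chains -/

abbrev PC (α β : Type) := (List α × List β) →₀ ℤ

noncomputable abbrev in1 {α β : Type} (τ : β) : (α →₀ ℤ) →ₗ[ℤ] (α × β →₀ ℤ) := mp (fun l => (l, τ))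
noncomputable abbrev in2 {α β : Type} (σ : α) : (β →₀ ℤ) →ₗ[ℤ] (α × β →₀ ℤ) := mp (fun l => (σ, l))

noncomputable abbrev bd1 {α β : Type} : PC α β →ₗ[ℤ] PC α β := lx (fun p => in1 p.2 (bdL p.1))
noncomputable abbrev bd2 {α β : Type} : PC α β →ₗ[ℤ] PC α β := lx (fun p => in2 p.1 (bdL p.2))

lemma bd1_in1 {α β : Type} (τ : List β) (x : LC α) : bd1 (in1 τ x) = in1 τ (bd x) := by
  refine lhom_congr (f := bd1 ∘ₗ in1 τ) (g := in1 τ ∘ₗ bd) ?_ x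
  intro l; simp
lemma bd2_in2 {α β : Type} (σ : List α) (x : LC β) : bd2 (in2 σ x) = in2 σ (bd x) := by
  refine lhom_congr (f := bd2 ∘ₗ in2 σ) (g := in2 σ ∘ₗ bd) ?_ x
  intro l; simp

/-- tensor -/
noncomputable def tn {α β : Type} (x : α →₀ ℤ) : (β →₀ ℤ) →ₗ[ℤ] (α × β →₀ ℤ) := lx (fun b => in1 b x)

lemma tn_sg1 {α β : Type} (a : α) (y : β →₀ ℤ) : tn (sg a) y = in2 a y := by
  refine lhom_congr (f := tn (sg a)) (g := in2 a) ?_ y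
  intro b; simp [tn]
lemma tn_sg2 {α β : Type} (x : α →₀ ℤ) (b : β) : tn x (sg b) = in1 b x := by
  simp [tn]

lemma bd1_in2 {α β : Type} (σ : List α) (y : LC β) : bd1 (in2 σ y) = tn (bdL σ) y := by
  refine lhom_congr (f := bd1 ∘ₗ in2 σ) (g := tn (bdL σ)) ?_ y
  intro l; simp [tn]

noncomputable def tnl {α β : Type} (y : β →₀ ℤ) : (α →₀ ℤ) →ₗ[ℤ] (α × β →₀ ℤ) := lx (fun a => in2 a y)

lemma tnl_eq {α β : Type} (x : α →₀ ℤ) (y : β →₀ ℤ) : tnl y x = tn x y := by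
  induction x using Finsupp.induction_linear with
  | zero =>
    rw [map_zero]
    refine (lhom_congr (f := tn 0) (g := 0) ?_ y).symm
    intro b; simp [tn]
  | add f g hf hg =>
    rw [map_add, hf, hg]
    refine (lhom_congr (f := tn (f+g)) (g := tn f + tn g) ?_ y).symm
    intro b; simp only [LinearMap.add_apply, tn_sg2, map_add]
  | single a c =>
    have : (Finsupp.single a c : α →₀ ℤ) = c • sg a := by simp
    rw [this, map_smul]
    have h2 : tn (c • sg a) y = c • tn (sg a) y := by
      refine lhom_congr (f := tn (c • sg a)) (g := c • tn (sg a)) ?_ y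
      intro b; simp only [LinearMap.smul_apply, tn_sg2, map_smul]
    rw [h2, tn_sg1, tnl, lx_sg]

lemma bd2_in1 {α β : Type} (τ : List β) (y : LC α) : bd2 (in1 τ y) = tn y (bdL τ) := by
  rw [← tnl_eq]
  refine lhom_congr (f := bd2 ∘ₗ in1 τ) (g := tnl (bdL τ)) ?_ y
  intro l; simp [tnl]

lemma bd_comm {α β : Type} (x : PC α β) : bd1 (bd2 x) = bd2 (bd1 x) := by
  refine lhom_congr (f := bd1 ∘ₗ bd2) (g := bd2 ∘ₗ bd1) ?_ x
  rintro ⟨σ, τ⟩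
  simp only [LinearMap.comp_apply]
  rw [lx_sg, lx_sg, bd1_in2, bd2_in1]

lemma bd1_bd1 {α β : Type} (x : PC α β) : bd1 (bd1 x) = 0 := by
  refine lhom_congr (f := bd1 ∘ₗ bd1) (g := 0) ?_ x
  rintro ⟨σ, τ⟩
  simp only [LinearMap.comp_apply]
  rw [lx_sg, bd1_in1, ← lx_sg bdL, bd_bd, map_zero]; rfl

lemma bd2_bd2 {α β : Type} (x : PC α β) : bd2 (bd2 x) = 0 := by
  refine lhom_congr (f := bd2 ∘ₗ bd2) (g := 0) ?_ x
  rintro ⟨σ, τ⟩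
  simp only [LinearMap.comp_apply]
  rw [lx_sg, bd2_in2, ← lx_sg bdL, bd_bd, map_zero]; rfl

/-! slices -/
open Classical in
noncomputable def sl {α β : Type} (σ : α) : (α × β →₀ ℤ) →ₗ[ℤ] (β →₀ ℤ) :=
  lx (fun p => if p.1 = σ then sg p.2 else 0)

lemma sl_in2 {α β : Type} (σ : α) (y : β →₀ ℤ) : sl σ (in2 σ y) = y := by
  refine lhom_congr (f := sl σ ∘ₗ in2 σ) (g := LinearMap.id) ?_ y
  intro l; simp [sl]
lemma sl_in2' {α β : Type} {σ σ' : α} (h : σ' ≠ σ) (y : β →₀ ℤ) : sl σ (in2 σ' y) = 0 := by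
  refine lhom_congr (f := sl σ ∘ₗ in2 σ') (g := 0) ?_ y
  intro l; simp [sl, h]

lemma sl_bd2 {α β : Type} (σ : List α) (x : PC α β) : sl σ (bd2 x) = bd (sl σ x) := by
  refine lhom_congr (f := sl σ ∘ₗ bd2) (g := bd ∘ₗ sl σ) ?_ x
  rintro ⟨σ', τ⟩
  simp only [LinearMap.comp_apply]
  rw [lx_sg]
  by_cases h : σ' = σ
  · subst h; rw [sl_in2]; simp [sl]
  · rw [sl_in2' h]; simp [sl, h]

lemma sl_sum {α β : Type} (s : Finset α) (x : α × β →₀ ℤ) (hx : x ∈ sp {p : α × β | p.1 ∈ s}) :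
    x = ∑ σ ∈ s, in2 σ (sl σ x) := by
  have := sp_congr (f := LinearMap.id) (g := ∑ σ ∈ s, in2 σ ∘ₗ sl σ) ?_ x hx
  · simpa using this
  rintro ⟨a, b⟩ ha
  rw [LinearMap.sum_apply, Finset.sum_eq_single a]
  · simp [sl]
  · intro c _ hc
    simp [sl, hc.symm]
  · intro h; exact absurd ha h

lemma slice_exact {α β : Type} (P : Set (List α)) (X : List α → Set (List β)) (k : ℕ)
    (h : ∀ σ ∈ P, Ex (X σ) k) (x : PC α β)
    (hx : x ∈ sp {p : List α × List β | p.1 ∈ P ∧ p.2 ∈ X p.1 ∧ p.2.length = k}) (h0 : bd2 x = 0) :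
    ∃ y ∈ sp {p : List α × List β | p.1 ∈ P ∧ p.2 ∈ X p.1 ∧ p.2.length = k + 1}, bd2 y = x := by
  classical
  set s : Finset (List α) := x.support.image Prod.fst with hs
  have hsP : ∀ σ ∈ s, σ ∈ P := by
    intro σ hσ
    obtain ⟨p, hp, rfl⟩ := Finset.mem_image.mp hσ
    exact (hx hp).1
  have hsl : ∀ σ, sl σ x ∈ sp (lev (X σ) k) := by
    intro σ
    refine sp_le (sl σ) _ ?_ x hx
    rintro ⟨a, b⟩ ⟨_, h2, h3⟩
    rw [sl, lx_sg]
    split_ifs with hh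
    · subst hh; exact sg_mem_sp (s := lev (X a) k) ⟨h2, h3⟩
    · exact Submodule.zero_mem _
  have : ∀ σ, ∃ y, σ ∈ s → y ∈ sp (lev (X σ) (k+1)) ∧ bd y = sl σ x := by
    intro σ
    by_cases hσ : σ ∈ s
    · obtain ⟨y, h1, h2⟩ := h σ (hsP σ hσ) (sl σ x) (hsl σ) (by rw [← sl_bd2, h0, map_zero])
      exact ⟨y, fun _ => ⟨h1, h2⟩⟩
    · exact ⟨0, fun hh => absurd hh hσ⟩
  choose y hy using this
  refine ⟨∑ σ ∈ s, in2 σ (y σ), ?_, ?_⟩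
  · refine Submodule.sum_mem _ fun σ hσ => ?_
    refine sp_le (in2 σ) _ ?_ _ (hy σ hσ).1
    rintro l ⟨h1, h2⟩
    rw [lx_sg]
    exact sg_mem_sp (s := {p : List α × List β | p.1 ∈ P ∧ p.2 ∈ X p.1 ∧ p.2.length = k + 1})
      ⟨hsP σ hσ, h1, h2⟩
  · rw [map_sum]
    conv_rhs => rw [sl_sum s x (fun p hp => Finset.mem_image_of_mem _ hp)]
    refine Finset.sum_congr rfl fun σ hσ => ?_
    rw [bd2_in2, (hy σ hσ).2]

/-! concatenation -/
noncomputable abbrev cat {α : Type} : PC α α →ₗ[ℤ] LC α := mp (fun p => p.1 ++ p.2)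

lemma cat_cn {α : Type} (a : α) (τ : List α) (x : LC α) :
    cat (in1 τ (cn a x)) = cn a (cat (in1 τ x)) := by
  refine lhom_congr (f := cat ∘ₗ in1 τ ∘ₗ cn a) (g := cn a ∘ₗ cat ∘ₗ in1 τ) ?_ x
  intro l; simp

lemma cat_in2_cons {α : Type} (a : α) (σ : List α) (x : LC α) :
    cat (in2 (a :: σ) x) = cn a (cat (in2 σ x)) := by
  refine lhom_congr (f := cat ∘ₗ in2 (a :: σ)) (g := cn a ∘ₗ cat ∘ₗ in2 σ) ?_ x
  intro l; simp

lemma bdL_append {α : Type} (σ τ : List α) :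
    bdL (σ ++ τ) = cat (in1 τ (bdL σ)) + (-1 : ℤ) ^ σ.length • cat (in2 σ (bdL τ)) := by
  induction σ with
  | nil =>
    simp only [List.nil_append, bdL, map_zero, zero_add, List.length_nil, pow_zero, one_smul]
    refine (lhom_congr (f := cat ∘ₗ in2 []) (g := LinearMap.id) ?_ (bdL τ)).symm
    intro l; simp
  | cons a σ ih =>
    rw [List.cons_append, bdL, ih, bdL, map_sub, map_sub, cat_cn a, cat_in2_cons, map_add, map_smul,
      List.length_cons, pow_succ]
    simp only [lx_sg, mul_neg, mul_one, neg_smul]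
    abel

lemma bd_cat {α : Type} (s : ℕ) (x : PC α α) (hx : x ∈ sp {p : List α × List α | p.1.length = s}) :
    bd (cat x) = cat (bd1 x) + (-1 : ℤ) ^ s • cat (bd2 x) := by
  refine sp_congr (f := bd ∘ₗ cat) (g := cat ∘ₗ bd1 + (-1 : ℤ) ^ s • (cat ∘ₗ bd2)) ?_ x hx
  rintro ⟨σ, τ⟩ hσ
  have hσ' : σ.length = s := hσ
  simp only [LinearMap.comp_apply, LinearMap.add_apply, LinearMap.smul_apply]
  rw [lx_sg, lx_sg, lx_sg, lx_sg, bdL_append, hσ']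

lemma neg_one_pow_smul_self {M : Type} [AddCommGroup M] (s : ℕ) (x : M) :
    (-1 : ℤ) ^ s • (-1 : ℤ) ^ s • x = x := by
  rw [smul_smul, ← pow_add, Even.neg_one_pow ⟨s, rfl⟩, one_smul]

def PP {α : Type} (S T : Set (List α)) (s t : ℕ) : Set (List α × List α) :=
  {p | (p.1 ∈ S ∧ p.1.length = s) ∧ (p.2 ∈ T ∧ p.1 ++ p.2 ∈ S) ∧ p.2.length = t}

lemma DC {α : Type} {S T : Set (List α)} (hS : FC S) (hnil : [] ∈ T) (M : ℕ)
    (hex : ∀ σ ∈ S, 1 ≤ σ.length → ∀ t, t + σ.length < M → Ex {τ | τ ∈ T ∧ σ ++ τ ∈ S} t)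
    {k : ℕ} (hk : k < M) (x : LC α) (hx : x ∈ sp (lev S k)) (h0 : bd x = 0) :
    ∃ z ∈ sp (lev T k), bd z = 0 ∧ ∃ y ∈ sp (lev S (k+1)), x = z + bd y := by
  have key : ∀ s t : ℕ, s + t = k → ∀ u ∈ sp (PP S T s t), bd1 u = 0 → bd2 u = 0 →
      ∃ z ∈ sp (lev T k), bd z = 0 ∧ ∃ y ∈ sp (lev S (k+1)), cat u = z + bd y := by
    intro s
    induction s with
    | zero =>
      intro t ht u hu h1 h2
      refine ⟨cat u, ?_, ?_, 0, Submodule.zero_mem _, by simp⟩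
      · refine sp_le cat _ ?_ u hu
        rintro ⟨σ, τ⟩ ⟨⟨_, a2⟩, ⟨b1, _⟩, c⟩
        have : σ = [] := List.length_eq_zero_iff.mp a2
        subst this
        rw [lx_sg]
        exact sg_mem_sp (s := lev T k) ⟨b1, by simp at c ⊢; omega⟩
      · rw [bd_cat 0 u (sp_mono (fun p hp => hp.1.2) hu), h1, h2]; simp
    | succ s ih =>
      intro t ht u hu h1 h2
      obtain ⟨v, hv, hvu⟩ := slice_exact {σ | σ ∈ S ∧ σ.length = s + 1} (fun σ => {τ | τ ∈ T ∧ σ ++ τ ∈ S}) t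
        (by rintro σ ⟨hσ, hl⟩; exact hex σ hσ (by omega) t (by omega)) u hu h2
      have hv1 : bd1 v ∈ sp (PP S T s (t+1)) := by
        refine sp_le bd1 _ ?_ v hv
        rintro ⟨σ, τ⟩ ⟨⟨a1, a2⟩, ⟨b1, b2⟩, c⟩
        rw [lx_sg]
        refine sp_le (in1 τ) _ ?_ _ (bdL_mem σ s a2)
        rintro l ⟨l1, l2⟩
        rw [lx_sg]
        exact sg_mem_sp (s := PP S T s (t+1)) ⟨⟨hS _ a1 _ l1, l2⟩, ⟨b1, hS _ b2 _ (l1.append (List.Sublist.refl τ))⟩, c⟩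
      obtain ⟨z, hz, hz0, y, hy, hzy⟩ := ih (t+1) (by omega) (bd1 v) hv1 (bd1_bd1 v)
        (by rw [← bd_comm, hvu, h1])
      have hb := bd_cat (s+1) v (sp_mono (fun p hp => hp.1.2) hv)
      rw [hvu, hzy] at hb
      have hcv : cat v ∈ sp (lev S (k+1)) := by
        refine sp_le cat _ ?_ v hv
        rintro ⟨σ, τ⟩ ⟨⟨a1, a2⟩, ⟨b1, b2⟩, c⟩
        rw [lx_sg]
        refine sg_mem_sp (s := lev S (k+1)) ⟨b2, ?_⟩
        simp only at a2 c
        simp only [List.length_append]; omega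
      refine ⟨-((-1:ℤ)^(s+1) • z), Submodule.neg_mem _ (Submodule.smul_mem _ _ hz), by
        rw [map_neg, map_smul, hz0]; simp, (-1:ℤ)^(s+1) • (cat v - y), Submodule.smul_mem _ _ (Submodule.sub_mem _ hcv hy), ?_⟩
      rw [map_smul, map_sub, hb, ← smul_neg, ← smul_add]
      have : -z + (z + bd y + (-1:ℤ)^(s+1) • cat u - bd y) = (-1:ℤ)^(s+1) • cat u := by abel
      rw [this, neg_one_pow_smul_self]
  have := key k 0 rfl (in1 [] x) ?_ ?_ ?_
  · have hc : cat (in1 [] x) = x := by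
      refine lhom_congr (f := cat ∘ₗ in1 []) (g := LinearMap.id) ?_ x
      intro l; simp
    rwa [hc] at this
  · refine sp_le (in1 []) _ ?_ x hx
    rintro l ⟨l1, l2⟩
    rw [lx_sg]
    exact sg_mem_sp (s := PP S T k 0) ⟨⟨l1, l2⟩, ⟨hnil, by simpa using l1⟩, rfl⟩
  · rw [bd1_in1, h0, map_zero]
  · rw [bd2_in1, bdL, map_zero]

/-- consequence: if cycles of T bound in S, S is exact -/
lemma DC_Ex {α : Type} {S T : Set (List α)} (hS : FC S) (hnil : [] ∈ T) (M : ℕ)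
    (hex : ∀ σ ∈ S, 1 ≤ σ.length → ∀ t, t + σ.length < M → Ex {τ | τ ∈ T ∧ σ ++ τ ∈ S} t)
    {k : ℕ} (hk : k < M)
    (hT0 : ∀ z ∈ sp (lev T k), bd z = 0 → ∃ y ∈ sp (lev S (k+1)), bd y = z) : Ex S k := by
  intro x hx h0
  obtain ⟨z, hz, hz0, y, hy, hxy⟩ := DC hS hnil M hex hk x hx h0
  obtain ⟨y', hy', hzy⟩ := hT0 z hz hz0
  exact ⟨y' + y, Submodule.add_mem _ hy' hy, by rw [map_add, hzy, hxy]⟩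

end HS

set_option linter.all false
namespace HS
open Finsupp

lemma prL_mem {α : Type} (φ : α → α) (l : List α) :
    prL φ l ∈ sp {l' : List α | (∀ x ∈ l', x ∈ l ∨ ∃ y ∈ l, x = φ y) ∧ l'.length = l.length + 1} := by
  induction l with
  | nil => simp [prL]
  | cons a l ih =>
    rw [prL]
    refine Submodule.sub_mem _ (sg_mem_sp (s := {l' : List α | (∀ x ∈ l', x ∈ a :: l ∨ ∃ y ∈ a :: l, x = φ y) ∧ l'.length = (a :: l).length + 1}) ⟨?_, ?_⟩) ?_
    · intro x hx
      simp only [List.mem_cons, List.mem_map] at hx ⊢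
      rcases hx with rfl | rfl | ⟨y, hy, rfl⟩
      · exact Or.inl (Or.inl rfl)
      · exact Or.inr ⟨a, Or.inl rfl, rfl⟩
      · exact Or.inr ⟨y, Or.inr hy, rfl⟩
    · simp
    · refine sp_le (cn a) _ ?_ _ ih
      rintro l' ⟨h1, h2⟩
      rw [lx_sg]
      refine sg_mem_sp (s := {l' : List α | (∀ x ∈ l', x ∈ a :: l ∨ ∃ y ∈ a :: l, x = φ y) ∧ l'.length = (a :: l).length + 1}) ⟨?_, by simp [h2]⟩
      intro x hx
      simp only [List.mem_cons] at hx ⊢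
      rcases hx with rfl | hx
      · exact Or.inl (Or.inl rfl)
      · rcases h1 x hx with h | ⟨y, hy, h⟩
        · exact Or.inl (Or.inr h)
        · exact Or.inr ⟨y, Or.inr hy, h⟩

section geom
variable {F E : Type} [Field F] [AddCommGroup E] [Module F E] (Q : QuadraticForm F E)

noncomputable def be : E →ₗ[F] E →ₗ[F] F := Q.polarBilin

lemma be_def (x y : E) : be Q x y = Q (x + y) - Q x - Q y := by
  simp [be, QuadraticMap.polar]
lemma be_comm (x y : E) : be Q x y = be Q y x := by
  rw [be_def, be_def, add_comm x y]; ring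
lemma Q_add (x y : E) : Q (x + y) = Q x + Q y + be Q x y := by rw [be_def]; ring
lemma Q_smul (c : F) (x : E) : Q (c • x) = c * c * Q x := by
  rw [QuadraticMap.map_smul]; rfl
lemma Q_neg (x : E) : Q (-x) = Q x := QuadraticMap.map_neg Q x
lemma be_self (x : E) : be Q x x = 2 * Q x := by
  have := Q_smul Q 2 x
  rw [two_smul, Q_add] at this
  linear_combination this
lemma Q_sub (x y : E) : Q (x - y) = Q x + Q y - be Q x y := by
  rw [sub_eq_add_neg, Q_add, Q_neg, map_neg]; ring

lemma be_self0 {x : E} (h : Q x = 0) : be Q x x = 0 := by rw [be_self, h, mul_zero]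

/-- orthogonal of a list inside V -/
def op (V : Submodule F E) (L : List E) : Submodule F E where
  carrier := {v | v ∈ V ∧ ∀ z ∈ L, be Q z v = 0}
  add_mem' := by
    rintro a b ⟨ha, ha'⟩ ⟨hb, hb'⟩
    exact ⟨V.add_mem ha hb, fun z hz => by rw [map_add, ha' z hz, hb' z hz, add_zero]⟩
  zero_mem' := ⟨V.zero_mem, fun z _ => map_zero _⟩
  smul_mem' := by
    rintro c x ⟨hx, hx'⟩
    exact ⟨V.smul_mem c hx, fun z hz => by rw [map_smul, hx' z hz, smul_zero]⟩

lemma mem_op {V : Submodule F E} {L : List E} {v : E} : v ∈ op Q V L ↔ v ∈ V ∧ ∀ z ∈ L, be Q z v = 0 := Iff.rfl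

/-- V contains m orthogonal hyperbolic planes -/
def hyp : ℕ → Submodule F E → Prop
  | 0, _ => True
  | m+1, V => ∃ e ∈ V, ∃ f ∈ V, Q e = 0 ∧ Q f = 0 ∧ be Q e f = 1 ∧ hyp m (op Q V [e, f])

lemma hyp_map {m : ℕ} {V V' : Submodule F E} (T : E →ₗ[F] E) (hT : ∀ x ∈ V, T x ∈ V')
    (hQ : ∀ x ∈ V, Q (T x) = Q x) (h : hyp Q m V) : hyp Q m V' := by
  induction m generalizing V V' with
  | zero => trivial
  | succ m ih =>
    obtain ⟨e, he, f, hf, h1, h2, h3, h4⟩ := h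
    have hb : ∀ x ∈ V, ∀ y ∈ V, be Q (T x) (T y) = be Q x y := by
      intro x hx y hy
      rw [be_def, be_def, ← map_add, hQ _ (V.add_mem hx hy), hQ x hx, hQ y hy]
    refine ⟨T e, hT e he, T f, hT f hf, by rw [hQ e he, h1], by rw [hQ f hf, h2], by rw [hb e he f hf, h3], ?_⟩
    refine ih (V := op Q V [e,f]) ?_ ?_ h4
    · rintro x ⟨hx, hx'⟩
      refine ⟨hT x hx, ?_⟩
      intro z hz
      simp only [List.mem_cons, List.not_mem_nil, or_false] at hz
      rcases hz with rfl | rfl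
      · rw [hb e he x hx]; exact hx' e (by simp)
      · rw [hb f hf x hx]; exact hx' f (by simp)
    · rintro x ⟨hx, hx'⟩
      exact hQ x hx

lemma hyp_mono {m : ℕ} {V V' : Submodule F E} (h : hyp Q m V) (hV : V ≤ V') : hyp Q m V' :=
  hyp_map Q LinearMap.id (fun x hx => hV hx) (fun x _ => rfl) h

lemma hyp_ker_aux {m : ℕ} {V W : Submodule F E} (φ : E →ₗ[F] F) (hWV : W ≤ V) (e : E) (he : e ∈ V) (hQ : Q e = 0)
    (hW : ∀ x ∈ W, be Q e x = 0) (hφ : φ e ≠ 0) (h : hyp Q m W) : hyp Q m (V ⊓ LinearMap.ker φ) := by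
  refine hyp_map Q (LinearMap.id - (LinearMap.toSpanSingleton F E e) ∘ₗ ((φ e)⁻¹ • φ)) ?_ ?_ h
  · intro x hx
    refine ⟨?_, ?_⟩
    · simp only [LinearMap.sub_apply, LinearMap.id_apply, LinearMap.comp_apply, LinearMap.toSpanSingleton_apply]
      exact V.sub_mem (hWV hx) (V.smul_mem _ he)
    · show φ _ = 0
      simp only [LinearMap.sub_apply, LinearMap.id_apply, LinearMap.comp_apply, LinearMap.toSpanSingleton_apply, map_sub, map_smul, LinearMap.smul_apply, smul_eq_mul]
      field_simp; ring
  · intro x hx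
    simp only [LinearMap.sub_apply, LinearMap.id_apply, LinearMap.comp_apply, LinearMap.toSpanSingleton_apply]
    rw [Q_sub, Q_smul, hQ, map_smul, be_comm Q x e, hW x hx]; simp

lemma hyp_ker {m : ℕ} {V : Submodule F E} (φ : E →ₗ[F] F) (h : hyp Q (m+1) V) :
    hyp Q m (V ⊓ LinearMap.ker φ) := by
  induction m generalizing V with
  | zero => trivial
  | succ m ih =>
    obtain ⟨e, he, f, hf, h1, h2, h3, h4⟩ := h
    have hWV : op Q V [e,f] ≤ V := fun x hx => hx.1
    by_cases h5 : φ e = 0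
    · by_cases h6 : φ f = 0
      · refine ⟨e, ⟨he, h5⟩, f, ⟨hf, h6⟩, h1, h2, h3, ?_⟩
        refine hyp_mono Q (ih h4) ?_
        rintro x ⟨⟨hx, hx'⟩, hx''⟩
        exact ⟨⟨hx, hx''⟩, hx'⟩
      · exact hyp_ker_aux Q φ hWV f hf h2 (fun x hx => hx.2 f (by simp)) h6 h4
    · exact hyp_ker_aux Q φ hWV e he h1 (fun x hx => hx.2 e (by simp)) h5 h4

lemma hyp_op {m : ℕ} {V : Submodule F E} (L : List E) (h : hyp Q (m+L.length) V) :
    hyp Q m (op Q V L) := by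
  induction L generalizing V with
  | nil => exact hyp_mono Q h (fun x hx => ⟨hx, by simp⟩)
  | cons z L ih =>
    have h1 := hyp_ker Q (be Q z) (m := m + L.length) h
    refine hyp_mono Q (ih h1) ?_
    rintro x ⟨⟨hx, hx'⟩, hx''⟩
    refine ⟨hx, ?_⟩
    intro w hw
    rcases List.mem_cons.mp hw with rfl | hw
    · exact hx'
    · exact hx'' w hw

lemma hyp_pair {m : ℕ} {V : Submodule F E} {b z : E} (hb : b ∈ V) (hQb : Q b = 0)
    (hbz : be Q b z ≠ 0) (h : hyp Q (m+1) V) : hyp Q m (op Q V [b, z]) := by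
  have h1 := hyp_ker Q (be Q b) h
  refine hyp_map Q (LinearMap.id - (LinearMap.toSpanSingleton F E b) ∘ₗ ((be Q b z)⁻¹ • be Q z)) ?_ ?_ h1
  · rintro x ⟨hx, hx'⟩
    have hx' : be Q b x = 0 := hx'
    refine ⟨?_, ?_⟩
    · simp only [LinearMap.sub_apply, LinearMap.id_apply, LinearMap.comp_apply, LinearMap.toSpanSingleton_apply]
      exact V.sub_mem hx (V.smul_mem _ hb)
    · intro w hw
      simp only [LinearMap.sub_apply, LinearMap.id_apply, LinearMap.comp_apply, LinearMap.toSpanSingleton_apply, map_sub, map_smul, LinearMap.smul_apply, smul_eq_mul]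
      simp only [List.mem_cons, List.not_mem_nil, or_false] at hw
      rcases hw with rfl | rfl
      · rw [hx', be_self0 Q hQb]; simp
      · rw [be_comm Q w b]; field_simp; ring
  · rintro x ⟨hx, hx'⟩
    have hx' : be Q b x = 0 := hx'
    simp only [LinearMap.sub_apply, LinearMap.id_apply, LinearMap.comp_apply, LinearMap.toSpanSingleton_apply]
    rw [Q_sub, Q_smul, hQb, map_smul, be_comm Q x b, hx']; simp

lemma hyp_link {m : ℕ} {V : Submodule F E} {b z : E} (L : List E) (hb : b ∈ V) (hQb : Q b = 0)
    (hbz : be Q b z ≠ 0) (h : hyp Q (m+(z :: L).length) V) : hyp Q m (op Q V (b :: z :: L)) := by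
  have h1 := hyp_op Q (m := m) L (hyp_pair Q (m := m + L.length) hb hQb hbz h)
  refine hyp_mono Q h1 ?_
  rintro x ⟨⟨hx, hx'⟩, hx''⟩
  refine ⟨hx, fun w hw => ?_⟩
  simp only [List.mem_cons] at hw
  rcases hw with rfl | rfl | hw
  · exact hx' _ (by simp)
  · exact hx' _ (by simp)
  · exact hx'' w hw

/-- functionals vanishing on `V ∩ L^⊥` -/
lemma rep_of_vanish {V : Submodule F E} (L : List E) (ψ : E →ₗ[F] F) (h : ∀ v ∈ op Q V L, ψ v = 0) :
    ∃ a ∈ Submodule.span F {z | z ∈ L}, ∀ v ∈ V, ψ v = be Q a v := by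
  induction L generalizing V with
  | nil => exact ⟨0, Submodule.zero_mem _, fun v hv => by rw [h v ⟨hv, by simp⟩]; simp⟩
  | cons z L ih =>
    obtain ⟨a, ha, hav⟩ := ih (V := op Q V [z]) (by
      rintro v ⟨⟨h1, h2⟩, h3⟩
      refine h v ⟨h1, fun w hw => ?_⟩
      rcases List.mem_cons.mp hw with rfl | hw
      · exact h2 _ (by simp)
      · exact h3 w hw)
    have hle : Submodule.span F {w | w ∈ L} ≤ Submodule.span F {w | w ∈ z :: L} :=
      Submodule.span_mono (fun w hw => List.mem_cons_of_mem z hw)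
    by_cases h0 : ∃ v ∈ V, be Q z v ≠ 0
    · obtain ⟨v0, hv0, hz⟩ := h0
      set c := (ψ v0 - be Q a v0) * (be Q z v0)⁻¹ with hc
      refine ⟨a + c • z, Submodule.add_mem _ (hle ha) (Submodule.smul_mem _ _ (Submodule.subset_span (by simp))), ?_⟩
      intro v hv
      have := hav (v - (be Q z v * (be Q z v0)⁻¹) • v0) ⟨V.sub_mem hv (V.smul_mem _ hv0), by
        intro w hw
        simp only [List.mem_cons, List.not_mem_nil, or_false] at hw
        subst hw
        rw [map_sub, map_smul, smul_eq_mul]; field_simp; ring⟩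
      simp only [map_sub, map_smul, smul_eq_mul] at this
      simp only [map_add, map_smul, smul_eq_mul, LinearMap.add_apply, LinearMap.smul_apply, hc]
      linear_combination this
    · push Not at h0
      refine ⟨a, hle ha, fun v hv => hav v ⟨hv, ?_⟩⟩
      intro w hw
      simp only [List.mem_cons, List.not_mem_nil, or_false] at hw
      subst hw; exact h0 v hv

/-- lists of isotropic pairwise orthogonal vectors satisfying P -/
def IL (P : E → Prop) : Set (List E) :=
  {l | (∀ x ∈ l, P x ∧ Q x = 0) ∧ ∀ x ∈ l, ∀ y ∈ l, be Q x y = 0}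

lemma IL_FC (P : E → Prop) : FC (IL Q P) := by
  rintro l ⟨h1, h2⟩ l' hl
  exact ⟨fun x hx => h1 x (hl.subset hx), fun x hx y hy => h2 x (hl.subset hx) y (hl.subset hy)⟩

lemma IL_nil (P : E → Prop) : [] ∈ IL Q P := ⟨by simp, by simp⟩

lemma IL_congr {P P' : E → Prop} (h : ∀ x, P x ↔ P' x) : IL Q P = IL Q P' := by
  have : P = P' := funext fun x => propext (h x)
  rw [this]

lemma IL_cons {P : E → Prop} {a : E} {l : List E} (ha : P a) (hQ : Q a = 0) (hl : l ∈ IL Q P)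
    (hal : ∀ x ∈ l, be Q a x = 0) : a :: l ∈ IL Q P := by
  refine ⟨?_, ?_⟩
  · intro x hx
    rcases List.mem_cons.mp hx with rfl | hx
    · exact ⟨ha, hQ⟩
    · exact hl.1 x hx
  · intro x hx y hy
    rcases List.mem_cons.mp hx with rfl | hx
    · rcases List.mem_cons.mp hy with rfl | hy
      · exact be_self0 Q hQ
      · exact hal y hy
    · rcases List.mem_cons.mp hy with rfl | hy
      · rw [be_comm]; exact hal x (by assumption)
      · exact hl.2 x (by assumption) y hy

lemma IL_cone {P : E → Prop} {a : E} (ha : P a) (hQ : Q a = 0) (hP : ∀ x, P x → be Q a x = 0) (k : ℕ) :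
    Ex (IL Q P) k :=
  Ex_cone a (fun l hl => IL_cons Q ha hQ hl (fun x hx => hP x (hl.1 x hx).1)) k

lemma IL_link {P : E → Prop} (b : E) {σ : List E} (hσ : σ ∈ IL Q P) :
    {τ | τ ∈ IL Q (fun x => P x ∧ be Q b x = 0) ∧ σ ++ τ ∈ IL Q P}
      = IL Q (fun x => P x ∧ ∀ z ∈ b :: σ, be Q z x = 0) := by
  ext τ
  constructor
  · rintro ⟨⟨h1, h2⟩, h3, h4⟩
    refine ⟨fun x hx => ⟨⟨(h1 x hx).1.1, fun z hz => ?_⟩, (h1 x hx).2⟩, h2⟩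
    rcases List.mem_cons.mp hz with rfl | hz
    · exact (h1 x hx).1.2
    · exact h4 z (by simp [hz]) x (by simp [hx])
  · rintro ⟨h1, h2⟩
    refine ⟨⟨fun x hx => ⟨⟨(h1 x hx).1.1, (h1 x hx).1.2 b (by simp)⟩, (h1 x hx).2⟩, h2⟩, ?_, ?_⟩
    · intro x hx
      rcases List.mem_append.mp hx with hx | hx
      · exact hσ.1 x hx
      · exact ⟨(h1 x hx).1.1, (h1 x hx).2⟩
    · intro x hx y hy
      rcases List.mem_append.mp hx with hx | hx <;> rcases List.mem_append.mp hy with hy | hy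
      · exact hσ.2 x hx y hy
      · exact (h1 y hy).1.2 x (by simp [hx])
      · rw [be_comm]; exact (h1 x hx).1.2 y (by simp [hy])
      · exact h2 x hx y hy

/-- exactness of links when the head is orthogonal to b -/
lemma IL_link_cone {P : E → Prop} (b z : E) {σ : List E} (hσ : z :: σ ∈ IL Q P) (hz : be Q b z = 0) (k : ℕ) :
    Ex (IL Q (fun x => P x ∧ ∀ w ∈ b :: z :: σ, be Q w x = 0)) k := by
  refine IL_cone Q (a := z) ⟨(hσ.1 z (by simp)).1, ?_⟩ (hσ.1 z (by simp)).2 (fun x hx => hx.2 z (by simp)) k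
  intro w hw
  rcases List.mem_cons.mp hw with rfl | hw
  · exact hz
  · exact hσ.2 w hw z (by simp)

theorem ThmK (n : ℕ) (V : Submodule F E) (h : hyp Q n V) (k : ℕ) (hk : k < n) :
    Ex (IL Q (fun x => x ∈ V ∧ x ≠ 0)) k := by
  induction n using Nat.strong_induction_on generalizing V k with
  | _ n ih =>
    have h' := h
    cases n with
    | zero => omega
    | succ n =>
      obtain ⟨e, he, f, hf, h1, h2, h3, -⟩ := h
      have he0 : e ≠ 0 := by rintro rfl; simp at h3
      refine DC_Ex (T := IL Q (fun x => (x ∈ V ∧ x ≠ 0) ∧ be Q e x = 0)) (IL_FC Q _) (IL_nil Q _) (n+1) ?_ hk ?_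
      · intro σ hσ hl t ht
        rw [IL_link Q e hσ]
        cases σ with
        | nil => simp at hl
        | cons z σ =>
          by_cases hz : be Q e z = 0
          · exact IL_link_cone Q e z hσ hz t
          · have := ih (n + 1 - (z :: σ).length) (by omega) (op Q V (e :: z :: σ))
              (hyp_link Q σ he h1 hz (by convert h' using 1; omega)) t (by omega)
            rw [IL_congr Q (P' := fun x => x ∈ op Q V (e :: z :: σ) ∧ x ≠ 0)]
            · exact this
            · intro x; rw [mem_op]; tauto
      · intro z hz hz0
        obtain ⟨y, hy, hyz⟩ := IL_cone Q (P := fun x => (x ∈ V ∧ x ≠ 0) ∧ be Q e x = 0) (a := e)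
          ⟨⟨he, he0⟩, be_self0 Q h1⟩ h1 (fun x hx => hx.2) k z hz hz0
        refine ⟨y, sp_mono ?_ hy, hyz⟩
        rintro l ⟨⟨l1, l2⟩, l3⟩
        exact ⟨⟨fun x hx => ⟨(l1 x hx).1.1, (l1 x hx).2⟩, l2⟩, l3⟩

lemma iso_exists {V : Submodule F E} (α : E →ₗ[F] F) (h : hyp Q 1 V) (hα : ∃ v ∈ V, α v ≠ 0) :
    ∃ z ∈ V, Q z = 0 ∧ α z = 1 := by
  suffices ∃ z ∈ V, Q z = 0 ∧ α z ≠ 0 by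
    obtain ⟨z, hz, h1, h2⟩ := this
    refine ⟨(α z)⁻¹ • z, V.smul_mem _ hz, by rw [Q_smul, h1, mul_zero], ?_⟩
    rw [map_smul, smul_eq_mul, inv_mul_cancel₀ h2]
  obtain ⟨e, he, f, hf, h1, h2, h3, -⟩ := h
  by_cases h4 : α e = 0
  · by_cases h5 : α f = 0
    · obtain ⟨v, hv, hv'⟩ := hα
      set v' := v - be Q v f • e - be Q v e • f with hvd
      have a1 : be Q v' e = 0 := by
        simp [hvd, be_self0 Q h1, be_comm Q f e, h3]
      have a2 : be Q v' f = 0 := by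
        simp [hvd, be_self0 Q h2, h3]
      refine ⟨e - Q v' • f + v', ?_, ?_, ?_⟩
      · exact V.add_mem (V.sub_mem he (V.smul_mem _ hf)) (V.sub_mem (V.sub_mem hv (V.smul_mem _ he)) (V.smul_mem _ hf))
      · rw [Q_add, Q_sub, Q_smul, h1, h2]
        simp only [map_sub, map_smul, LinearMap.sub_apply, LinearMap.smul_apply, smul_eq_mul, h3, be_comm Q _ v', a1, a2]
        ring
      · simp [hvd, h4, h5, hv']
    · exact ⟨f, hf, h2, h5⟩
  · exact ⟨e, he, h1, h4⟩

lemma Q_span_zero (σ : List E) (P : E → Prop) (hσ : σ ∈ IL Q P) :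
    (∀ w ∈ Submodule.span F {z | z ∈ σ}, ∀ z ∈ σ, be Q w z = 0) ∧ ∀ w ∈ Submodule.span F {z | z ∈ σ}, Q w = 0 := by
  have h1 : ∀ w ∈ Submodule.span F {z | z ∈ σ}, ∀ z ∈ σ, be Q w z = 0 := by
    intro w hw z hz
    induction hw using Submodule.span_induction with
    | mem x hx => exact hσ.2 x hx z hz
    | zero => simp
    | add x y _ _ hx hy => simp [hx, hy]
    | smul c x _ hx => simp [hx]
  refine ⟨h1, ?_⟩
  intro w hw
  have h2 : ∀ w' ∈ Submodule.span F {z | z ∈ σ}, be Q w w' = 0 := by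
    intro w' hw'
    induction hw' using Submodule.span_induction with
    | mem x hx => exact h1 w hw x hx
    | zero => simp
    | add x y _ _ hx hy => simp [hx, hy]
    | smul c x _ hx => simp [hx]
  clear h1
  induction hw using Submodule.span_induction with
  | mem x hx => exact (hσ.1 x hx).2
  | zero => simp
  | add x y hx' hy' hx hy =>
    have hxy : ∀ a ∈ Submodule.span F {z | z ∈ σ}, ∀ b ∈ Submodule.span F {z | z ∈ σ}, be Q a b = 0 := by
      intro a ha b hb
      induction ha using Submodule.span_induction with
      | mem x hx =>
        induction hb using Submodule.span_induction with
        | mem y hy => exact hσ.2 x hx y hy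
        | zero => simp
        | add x y _ _ hx hy => simp [hx, hy]
        | smul c x _ hx => simp [hx]
      | zero => simp
      | add x y _ _ hx hy => simp [hx, hy]
      | smul c x _ hx => simp [hx]
    rw [Q_add, hx (hxy x hx'), hy (hxy y hy'), hxy x hx' y hy']; simp
  | smul c x hx' hx =>
    rw [Q_smul]
    by_cases hc : c = 0
    · simp [hc]
    · rw [hx (fun w' hw' => by
        have := h2 w' hw'
        simpa [hc] using this), mul_zero]

end geom
end HS

set_option linter.all false
namespace HS
open Finsupp

section geom
variable {F E : Type} [Field F] [AddCommGroup E] [Module F E] (Q : QuadraticForm F E)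

/-- Q vanishes on the radical of V -/
def radz (V : Submodule F E) : Prop := ∀ x ∈ V, (∀ y ∈ V, be Q x y = 0) → Q x = 0

lemma rep2 {V : Submodule F E} (b : E) (L : List E) (ψ : E →ₗ[F] F) (h : ∀ v ∈ op Q V (b :: L), ψ v = 0) :
    ∃ c : F, ∃ w ∈ Submodule.span F {z | z ∈ L}, ∀ v ∈ V, ψ v = c * be Q b v + be Q w v := by
  obtain ⟨a, ha, hav⟩ := rep_of_vanish Q _ ψ h
  have : {z | z ∈ b :: L} = insert b {z | z ∈ L} := by ext z; simp
  rw [this, Submodule.mem_span_insert] at ha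
  obtain ⟨c, w, hw, rfl⟩ := ha
  refine ⟨c, w, hw, fun v hv => ?_⟩
  rw [hav v hv]; simp

lemma span_le_of_IL {V : Submodule F E} {P : E → Prop} {σ : List E} (hσ : σ ∈ IL Q P) (hP : ∀ x, P x → x ∈ V) :
    Submodule.span F {z | z ∈ σ} ≤ V :=
  Submodule.span_le.mpr (fun z hz => hP z (hσ.1 z hz).1)

lemma radz_link {V : Submodule F E} {P : E → Prop} {b : E} {σ : List E} (hσ : σ ∈ IL Q P) (hP : ∀ x, P x → x ∈ V)
    (hb : b ∈ V) (hQb : Q b = 0) (hr : radz Q V) : radz Q (op Q V (b :: σ)) := by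
  intro x hx hx'
  obtain ⟨c, w, hw, h⟩ := rep2 Q b σ (be Q x) hx'
  have hwV := span_le_of_IL Q hσ hP hw
  obtain ⟨q1, q2⟩ := Q_span_zero Q σ P hσ
  have hxb : be Q x b = 0 := by rw [be_comm]; exact hx.2 b (by simp)
  have hxw : be Q x w = 0 := by
    have : ∀ w ∈ Submodule.span F {z | z ∈ σ}, be Q x w = 0 := by
      intro w hw
      induction hw using Submodule.span_induction with
      | mem z hz => rw [be_comm]; exact hx.2 z (by simp; right; exact hz)
      | zero => simp
      | add x y _ _ hx hy => simp [hx, hy]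
      | smul c x _ hx => simp [hx]
    exact this w hw
  have h0 := h b hb
  rw [hxb, be_self0 Q hQb] at h0
  have hwb : be Q w b = 0 := by linear_combination -h0
  have := hr (x - (c • b + w)) (V.sub_mem hx.1 (V.add_mem (V.smul_mem _ hb) hwV)) (by
    intro y hy
    simp only [map_sub, map_add, map_smul, LinearMap.sub_apply, LinearMap.add_apply, LinearMap.smul_apply, smul_eq_mul]
    rw [h y hy]; ring)
  rw [Q_sub, Q_add, Q_smul, hQb, q2 w hw] at this
  simp only [map_add, map_smul, LinearMap.smul_apply, smul_eq_mul, hxb, hxw, be_comm Q b w, hwb] at this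
  linear_combination this

lemma alpha_link {V : Submodule F E} {α : E →ₗ[F] F} {b z : E} {σ : List E}
    (hσ : z :: σ ∈ IL Q (fun x => x ∈ V ∧ α x = 1))
    (hb : b ∈ V) (hQb : Q b = 0) (hbz : be Q b z ≠ 0) (hr : radz Q V)
    (hcase : (α b = 1 ∧ ¬ ∃ a ∈ V, (∀ v ∈ V, α v = be Q a v) ∧ Q a ≠ 0) ∨
      (α b = 0 ∧ ∃ a ∈ V, (∀ v ∈ V, α v = be Q a v) ∧ Q a ≠ 0)) :
    ∃ v ∈ op Q V (b :: z :: σ), α v ≠ 0 := by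
  by_contra hcon
  push Not at hcon
  obtain ⟨c, w, hw, h⟩ := rep2 Q b (z :: σ) α hcon
  have hwV : w ∈ V := span_le_of_IL Q hσ (fun x hx => hx.1) hw
  obtain ⟨q1, q2⟩ := Q_span_zero Q _ _ hσ
  have hz := h z (hσ.1 z (by simp)).1.1
  rw [(hσ.1 z (by simp)).1.2, q1 w hw z (by simp), add_zero] at hz
  have hc : c ≠ 0 := by rintro rfl; simp at hz
  have hab := h b hb
  rw [be_self0 Q hQb, mul_zero, zero_add] at hab
  have haV : c • b + w ∈ V := V.add_mem (V.smul_mem _ hb) hwV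
  have ha : ∀ v ∈ V, α v = be Q (c • b + w) v := by
    intro v hv; rw [h v hv]; simp
  have hQa : Q (c • b + w) = c * α b := by
    rw [Q_add, Q_smul, hQb, q2 w hw, hab, be_comm Q w b]; simp
  rcases hcase with ⟨h1, h2⟩ | ⟨h1, a1, ha1, h2, h3⟩
  · exact h2 ⟨_, haV, ha, by rw [hQa, h1]; simpa using hc⟩
  · apply h3
    rw [h1, mul_zero] at hQa
    have := hr (c • b + w - a1) (V.sub_mem haV ha1) (by
      intro y hy
      rw [map_sub, LinearMap.sub_apply, ← ha y hy, ← h2 y hy, sub_self])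
    rw [Q_sub, hQa, be_comm, ← h2 _ haV, ha _ haV, be_self0 Q hQa] at this
    linear_combination this

lemma IL_mono {P P' : E → Prop} (h : ∀ x, P x → P' x) : IL Q P ⊆ IL Q P' := by
  rintro l ⟨h1, h2⟩
  exact ⟨fun x hx => ⟨h x (h1 x hx).1, (h1 x hx).2⟩, h2⟩

lemma lev_mono {α : Type} {X Y : Set (List α)} (h : X ⊆ Y) (k : ℕ) : lev X k ⊆ lev Y k :=
  fun l hl => ⟨h hl.1, hl.2⟩

/-- Case II nullhomotopy -/
lemma null_II {V : Submodule F E} {α : E →ₗ[F] F} {b y : E} (hb : b ∈ V) (hQb : Q b = 0) (hab : α b = 0)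
    (hy : y ∈ V) (hQy : Q y = 0) (hay : α y = 1) (hyb : be Q y b ≠ 0) (k : ℕ) (z : LC E)
    (hz : z ∈ sp (lev (IL Q (fun x => (x ∈ V ∧ α x = 1) ∧ be Q b x = 0)) k)) (hz0 : bd z = 0) :
    ∃ w ∈ sp (lev (IL Q (fun x => x ∈ V ∧ α x = 1)) (k+1)), bd w = z := by
  set φ : E → E := fun x => x - (be Q y x * (be Q y b)⁻¹) • b with hφ
  have hbb := be_self0 Q hQb
  have hp := prism φ z
  rw [hz0, map_zero, add_zero] at hp
  refine ⟨cn y (mp (List.map φ) z) - pr φ z, Submodule.sub_mem _ ?_ ?_, ?_⟩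
  · have h1 : mp (List.map φ) z ∈ sp (lev (IL Q (fun x => (x ∈ V ∧ α x = 1) ∧ be Q y x = 0)) k) := by
      refine sp_le _ _ ?_ z hz
      rintro l ⟨⟨l1, l2⟩, l3⟩
      rw [lx_sg]
      refine sg_mem_sp (s := lev (IL Q (fun x => (x ∈ V ∧ α x = 1) ∧ be Q y x = 0)) k) ⟨⟨?_, ?_⟩, by simp [l3]⟩
      · intro x hx
        obtain ⟨x, hx2, rfl⟩ := List.mem_map.mp hx
        obtain ⟨⟨⟨a1, a2⟩, a3⟩, a4⟩ := l1 x hx2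
        refine ⟨⟨⟨V.sub_mem a1 (V.smul_mem _ hb), ?_⟩, ?_⟩, ?_⟩
        · simp [hφ, hab, a2]
        · simp [hφ, hyb]
        · simp only [hφ]; rw [Q_sub, Q_smul, hQb, a4, map_smul, be_comm Q x b, a3]; simp
      · intro x hx x' hx'
        obtain ⟨x, hx2, rfl⟩ := List.mem_map.mp hx
        obtain ⟨x', hx2', rfl⟩ := List.mem_map.mp hx'
        have := l2 x hx2 x' hx2'
        have h3 := (l1 x hx2).1.2
        have h4 := (l1 x' hx2').1.2
        simp [hφ, this, be_comm Q x b, h3, h4, hbb]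
    refine sp_le (cn y) _ ?_ _ h1
    rintro l ⟨l1, l2⟩
    rw [lx_sg]
    refine sg_mem_sp (s := lev (IL Q (fun x => x ∈ V ∧ α x = 1)) (k+1)) ⟨?_, by simp [l2]⟩
    exact IL_cons Q ⟨hy, hay⟩ hQy (IL_mono Q (fun x hx => hx.1) l1) (fun x hx => (l1.1 x hx).1.2)
  · refine sp_le _ _ ?_ z hz
    rintro l ⟨⟨l1, l2⟩, l3⟩
    rw [lx_sg]
    refine sp_mono ?_ (prL_mem φ l)
    rintro l' ⟨h1, h2⟩
    -- every element of l' is x + t b with x in l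
    have h1' : ∀ x ∈ l', ∃ x0 ∈ l, ∃ t : F, x = x0 - t • b := by
      intro x hx
      rcases h1 x hx with h | ⟨x0, h, rfl⟩
      · exact ⟨x, h, 0, by simp⟩
      · exact ⟨x0, h, _, rfl⟩
    refine ⟨⟨?_, ?_⟩, by omega⟩
    · intro x hx
      obtain ⟨x, hx0, t, rfl⟩ := h1' x hx
      obtain ⟨⟨⟨a1, a2⟩, a3⟩, a4⟩ := l1 x hx0
      refine ⟨⟨V.sub_mem a1 (V.smul_mem _ hb), by simp [hab, a2]⟩, ?_⟩
      rw [Q_sub, Q_smul, hQb, a4, map_smul, be_comm Q x b, a3]; simp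
    · intro x hx x' hx'
      obtain ⟨x, hx0, t, rfl⟩ := h1' x hx
      obtain ⟨x', hx0', t', rfl⟩ := h1' x' hx'
      have := l2 x hx0 x' hx0'
      have h3 := (l1 x hx0).1.2
      have h4 := (l1 x' hx0').1.2
      simp [this, be_comm Q x b, h3, h4, hbb]
  · have e1 : bd (mp (List.map φ) z) = 0 := by rw [bd_map, hz0, map_zero]
    rw [map_sub, bd_cn, e1, hp]; simp

lemma exists_y {V : Submodule F E} {α : E →ₗ[F] F} {b u : E} (hb : b ∈ V) (hQb : Q b = 0) (hab : α b = 0)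
    (hu : u ∈ V) (hQu : Q u = 0) (hub : be Q u b ≠ 0) (h : ∃ z ∈ V, Q z = 0 ∧ α z = 1) :
    ∃ y ∈ V, Q y = 0 ∧ α y = 1 ∧ be Q y b ≠ 0 := by
  by_cases h1 : α u = 0
  · obtain ⟨z, hz, hQz, haz⟩ := h
    by_cases h2 : be Q z b = 0
    · have hbu : be Q b u ≠ 0 := by rwa [be_comm]
      set r := - be Q z u * (be Q b u)⁻¹ with hr
      refine ⟨z + r • b + u, V.add_mem (V.add_mem hz (V.smul_mem _ hb)) hu, ?_, ?_, ?_⟩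
      · rw [Q_add, Q_add, Q_smul, hQz, hQb, hQu]
        simp only [map_add, map_smul, LinearMap.add_apply, LinearMap.smul_apply, smul_eq_mul, h2, hr]
        field_simp; ring
      · simp [haz, hab, h1]
      · simpa [h2, be_self0 Q hQb] using hub
    · exact ⟨z, hz, hQz, haz, h2⟩
  · refine ⟨(α u)⁻¹ • u, V.smul_mem _ hu, by rw [Q_smul, hQu, mul_zero], by simp [h1], by simp [h1, hub]⟩

lemma exists_b {V : Submodule F E} {α : E →ₗ[F] F} (h : hyp Q 2 V) :
    ∃ b ∈ V, Q b = 0 ∧ α b = 0 ∧ ∃ u ∈ V, Q u = 0 ∧ be Q u b ≠ 0 := by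
  obtain ⟨e, he, f, hf, h1, h2, h3, e', he', f', hf', h1', h2', h3', -⟩ := h
  have a1 : be Q e e' = 0 := he'.2 e (by simp)
  have a2 : be Q f e' = 0 := he'.2 f (by simp)
  have a3 : be Q e f' = 0 := hf'.2 e (by simp)
  have a4 : be Q f' e = 0 := by rw [be_comm]; exact a3
  by_cases h0 : α e = 0
  · exact ⟨e, he, h1, h0, f, hf, h2, by rw [be_comm, h3]; simp⟩
  · refine ⟨α e' • e - α e • e', V.sub_mem (V.smul_mem _ he) (V.smul_mem _ he'.1), ?_, ?_, f', hf'.1, h2', ?_⟩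
    · rw [Q_sub, Q_smul, Q_smul, h1, h1']; simp [a1]
    · simp; ring
    · simp [a4, be_comm Q f' e', h3', h0]

theorem ThmA (m : ℕ) (V : Submodule F E) (α : E →ₗ[F] F) (h : hyp Q m V) (hr : radz Q V)
    (hα : ∃ v ∈ V, α v ≠ 0) (k : ℕ) (hk : k < m) :
    Ex (IL Q (fun x => x ∈ V ∧ α x = 1)) k := by
  induction m using Nat.strong_induction_on generalizing V k with
  | _ m ih =>
    have h1V : hyp Q 1 V := by
      cases m with
      | zero => omega
      | succ m =>
        obtain ⟨e, he, f, hf, h1, h2, h3, _⟩ := h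
        exact ⟨e, he, f, hf, h1, h2, h3, trivial⟩
    obtain ⟨z1, hz1, hQz1, haz1⟩ := iso_exists Q α h1V hα
    have main : ∀ b ∈ V, Q b = 0 → ((α b = 1 ∧ ¬ ∃ a ∈ V, (∀ v ∈ V, α v = be Q a v) ∧ Q a ≠ 0) ∨
      (α b = 0 ∧ ∃ a ∈ V, (∀ v ∈ V, α v = be Q a v) ∧ Q a ≠ 0)) →
      (∀ z ∈ sp (lev (IL Q (fun x => (x ∈ V ∧ α x = 1) ∧ be Q b x = 0)) k), bd z = 0 →
        ∃ y ∈ sp (lev (IL Q (fun x => x ∈ V ∧ α x = 1)) (k+1)), bd y = z) →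
      Ex (IL Q (fun x => x ∈ V ∧ α x = 1)) k := by
      intro b hb hQb hcase hnull
      refine DC_Ex (T := IL Q (fun x => (x ∈ V ∧ α x = 1) ∧ be Q b x = 0)) (IL_FC Q _) (IL_nil Q _) m ?_ hk hnull
      intro σ hσ hl t ht
      rw [IL_link Q b hσ]
      cases σ with
      | nil => simp at hl
      | cons z σ =>
        by_cases hz : be Q b z = 0
        · exact IL_link_cone Q b z hσ hz t
        · have := ih (m - (z :: σ).length) (by omega) (op Q V (b :: z :: σ))
            (hyp_link Q σ hb hQb hz (by convert h using 1; omega))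
            (radz_link Q hσ (fun x hx => hx.1) hb hQb hr) (alpha_link Q hσ hb hQb hz hr hcase) t (by omega)
          rw [IL_congr Q (P' := fun x => x ∈ op Q V (b :: z :: σ) ∧ α x = 1)]
          · exact this
          · intro x; rw [mem_op]; tauto
    by_cases hcase : ∃ a ∈ V, (∀ v ∈ V, α v = be Q a v) ∧ Q a ≠ 0
    · by_cases hm : 2 ≤ m
      · have h2V : hyp Q 2 V := by
          obtain ⟨m, rfl⟩ := Nat.exists_eq_add_of_le hm
          rw [add_comm] at h
          obtain ⟨e, he, f, hf, h1, h2, h3, e', he', f', hf', h1', h2', h3', _⟩ := h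
          exact ⟨e, he, f, hf, h1, h2, h3, e', he', f', hf', h1', h2', h3', trivial⟩
        obtain ⟨b, hb, hQb, hab, u, hu, hQu, hub⟩ := exists_b Q (α := α) h2V
        obtain ⟨y, hy, hQy, hay, hyb⟩ := exists_y Q hb hQb hab hu hQu hub ⟨z1, hz1, hQz1, haz1⟩
        exact main b hb hQb (Or.inr ⟨hab, hcase⟩) (fun z hz hz0 => null_II Q hb hQb hab hy hQy hay hyb k z hz hz0)
      · have : k = 0 := by omega
        subst this
        intro x hx hx0
        refine ⟨cn z1 x, ?_, by rw [bd_cn, hx0]; simp⟩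
        refine sp_le (cn z1) _ ?_ x hx
        rintro l ⟨l1, l2⟩
        rw [lx_sg]
        have : l = [] := List.length_eq_zero_iff.mp l2
        subst this
        exact sg_mem_sp (s := lev (IL Q (fun x => x ∈ V ∧ α x = 1)) (0+1)) ⟨IL_cons Q ⟨hz1, haz1⟩ hQz1 l1 (by simp), by simp⟩
    · refine main z1 hz1 hQz1 (Or.inl ⟨haz1, hcase⟩) ?_
      intro z hz hz0
      obtain ⟨y, hy, hyz⟩ := IL_cone Q (P := fun x => (x ∈ V ∧ α x = 1) ∧ be Q z1 x = 0) (a := z1)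
          ⟨⟨hz1, haz1⟩, be_self0 Q hQz1⟩ hQz1 (fun x hx => hx.2) k z hz hz0
      exact ⟨y, sp_mono (lev_mono (IL_mono Q (fun x hx => hx.1)) _) hy, hyz⟩

end geom
end HS

set_option linter.all false
namespace HS
open Finsupp

section chains
variable {G Ω : Type} [Group G] [MulAction G Ω]

/-- left translation of lists -/
abbrev gl (g : G) (l : List G) : List G := l.map (fun x => g * x)
abbrev gw (g : G) (σ : List Ω) : List Ω := σ.map (fun x => g • x)

lemma gw_mul (g h : G) (σ : List Ω) : gw (g * h) σ = gw g (gw h σ) := by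
  simp [gw, mul_smul]
lemma gl_mul (g h : G) (σ : List G) : gl (g * h) σ = gl g (gl h σ) := by
  simp [gl, mul_assoc]
lemma gw_one (σ : List Ω) : gw (1 : G) σ = σ := by simp [gw]
lemma gl_one (σ : List G) : gl (1 : G) σ = σ := by simp [gl]
lemma gw_inv {g : G} {σ τ : List Ω} (h : gw g τ = σ) : gw g⁻¹ σ = τ := by
  rw [← h, ← gw_mul, inv_mul_cancel, gw_one]

noncomputable def N0 (K : Subgroup G) : Submodule ℤ (LC G) :=
  Submodule.span ℤ ({x | ∃ k ∈ K, ∃ l, x = sg (gl k l) - sg l} ∪ {sg []})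

noncomputable def NN (Ω : Type) [MulAction G Ω] (K : Subgroup G) : Submodule ℤ (PC G Ω) :=
  Submodule.span ℤ ({x | ∃ k ∈ K, ∃ l, ∃ σ : List Ω, x = sg (gl k l, gw k σ) - sg (l, σ)} ∪ {x | ∃ σ : List Ω, x = sg ([], σ)})

lemma N0_le {K : Subgroup G} {M : Type} [AddCommGroup M] (f : LC G →ₗ[ℤ] M) (p : Submodule ℤ M)
    (h1 : ∀ k ∈ K, ∀ l, f (sg (gl k l)) - f (sg l) ∈ p) (h2 : f (sg []) ∈ p) : ∀ x ∈ N0 K, f x ∈ p := by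
  have : N0 K ≤ p.comap f := by
    rw [N0, Submodule.span_le]
    rintro x (⟨k, hk, l, rfl⟩ | rfl)
    · show f _ ∈ p
      rw [map_sub]; exact h1 k hk l
    · exact h2
  exact this

lemma NN_le {K : Subgroup G} {M : Type} [AddCommGroup M] (f : PC G Ω →ₗ[ℤ] M) (p : Submodule ℤ M)
    (h1 : ∀ k ∈ K, ∀ l σ, f (sg (gl k l, gw k σ)) - f (sg (l, σ)) ∈ p) (h2 : ∀ σ, f (sg ([], σ)) ∈ p) :
    ∀ x ∈ NN Ω K, f x ∈ p := by
  have : NN Ω K ≤ p.comap f := by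
    rw [NN, Submodule.span_le]
    rintro x (⟨k, hk, l, σ, rfl⟩ | ⟨σ, rfl⟩)
    · show f _ ∈ p
      rw [map_sub]; exact h1 k hk l σ
    · exact h2 σ
  exact this

lemma N0_gen {K : Subgroup G} {k : G} (hk : k ∈ K) (l : List G) : sg (gl k l) - sg l ∈ N0 K :=
  Submodule.subset_span (Or.inl ⟨k, hk, l, rfl⟩)
lemma N0_nil {K : Subgroup G} : sg [] ∈ N0 K := Submodule.subset_span (Or.inr rfl)
lemma NN_gen {K : Subgroup G} {k : G} (hk : k ∈ K) (l : List G) (σ : List Ω) :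
    sg (gl k l, gw k σ) - sg (l, σ) ∈ NN Ω K :=
  Submodule.subset_span (Or.inl ⟨k, hk, l, σ, rfl⟩)
lemma NN_nil {K : Subgroup G} (σ : List Ω) : sg ([], σ) ∈ NN Ω K := Submodule.subset_span (Or.inr ⟨σ, rfl⟩)

lemma N0_mono {K K' : Subgroup G} (h : K ≤ K') : N0 K ≤ N0 K' :=
  fun x hx => N0_le LinearMap.id (N0 K') (fun k hk l => N0_gen (h hk) l) N0_nil x hx
lemma NN_mono {K K' : Subgroup G} (h : K ≤ K') : NN Ω K ≤ NN Ω K' :=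
  fun x hx => NN_le LinearMap.id (NN Ω K') (fun k hk l σ => NN_gen (h hk) l σ) NN_nil x hx

lemma N0_tr {K : Subgroup G} {k : G} (hk : k ∈ K) (x : LC G) : mp (gl k) x - x ∈ N0 K := by
  have := sp_le (s := Set.univ) (mp (gl k) - LinearMap.id) (N0 K) (fun l _ => by
    simpa using N0_gen hk l) x (by simp [sp])
  simpa using this

/-- translation on pairs -/
abbrev gp (k : G) (p : List G × List Ω) : List G × List Ω := (gl k p.1, gw k p.2)

lemma NN_tr {K : Subgroup G} {k : G} (hk : k ∈ K) (x : PC G Ω) : mp (gp k) x - x ∈ NN Ω K := by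
  have := sp_le (s := Set.univ) (mp (gp k) - LinearMap.id) (NN Ω K) (fun l _ => by
    simpa using NN_gen hk l.1 l.2) x (by simp [sp])
  simpa using this

lemma bd_N0 {K : Subgroup G} {x : LC G} (hx : x ∈ N0 K) : bd x ∈ N0 K := by
  refine N0_le bd _ ?_ (by simp [bdL]) x hx
  intro k hk l
  rw [lx_sg, lx_sg, gl, bdL_map]
  exact N0_tr hk _

lemma in1_gp (k : G) (σ : List Ω) (x : LC G) : in1 (gw k σ) (mp (gl k) x) = mp (gp k) (in1 σ x) := by
  refine lhom_congr (α := List G) (M := PC G Ω) (f := LinearMap.comp (in1 (gw k σ)) (mp (gl k))) (g := LinearMap.comp (mp (gp k)) (in1 σ)) ?_ x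
  intro l
  simp only [LinearMap.comp_apply, lx_sg]
lemma in2_gp (k : G) (l : List G) (x : LC Ω) : in2 (gl k l) (mp (gw k) x) = mp (gp k) (in2 l x) := by
  refine lhom_congr (α := List Ω) (M := PC G Ω) (f := LinearMap.comp (in2 (gl k l)) (mp (gw k))) (g := LinearMap.comp (mp (gp k)) (in2 l)) ?_ x
  intro l
  simp only [LinearMap.comp_apply, lx_sg]

lemma bd1_gp (k : G) (x : PC G Ω) : bd1 (mp (gp k) x) = mp (gp k) (bd1 x) := by
  refine lhom_congr (α := List G × List Ω) (M := PC G Ω) (f := LinearMap.comp bd1 (mp (gp k))) (g := LinearMap.comp (mp (gp k)) bd1) ?_ x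
  rintro ⟨l, σ⟩
  have h : bdL (gl k l) = mp (gl k) (bdL l) := bdL_map _ l
  simp only [LinearMap.comp_apply, lx_sg]
  rw [h, in1_gp]

lemma bd2_gp (k : G) (x : PC G Ω) : bd2 (mp (gp k) x) = mp (gp k) (bd2 x) := by
  refine lhom_congr (α := List G × List Ω) (M := PC G Ω) (f := LinearMap.comp bd2 (mp (gp k))) (g := LinearMap.comp (mp (gp k)) bd2) ?_ x
  rintro ⟨l, σ⟩
  have h : bdL (gw k σ) = mp (gw k) (bdL σ) := bdL_map _ σ
  simp only [LinearMap.comp_apply, lx_sg]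
  rw [h, in2_gp]

lemma bd1_NN {K : Subgroup G} {x : PC G Ω} (hx : x ∈ NN Ω K) : bd1 x ∈ NN Ω K := by
  refine NN_le bd1 _ ?_ ?_ x hx
  · intro k hk l σ
    have := bd1_gp k (sg (l, σ))
    rw [lx_sg (fun a => sg (gp k a)) (l, σ)] at this
    rw [this]
    exact NN_tr hk _
  · intro σ; rw [lx_sg]; simp [bdL]

lemma bd2_NN {K : Subgroup G} {x : PC G Ω} (hx : x ∈ NN Ω K) : bd2 x ∈ NN Ω K := by
  refine NN_le bd2 _ ?_ ?_ x hx
  · intro k hk l σ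
    have := bd2_gp k (sg (l, σ))
    rw [lx_sg (fun a => sg (gp k a)) (l, σ)] at this
    rw [this]
    exact NN_tr hk _
  · intro σ; rw [lx_sg]
    refine sp_le (s := Set.univ) (in2 []) (NN Ω K) (fun τ _ => ?_) _ (by simp [sp])
    rw [lx_sg]; exact NN_nil τ

/-! equivariant retraction -/
lemma exists_kappa (K : Subgroup G) : ∃ κ : G → G, (∀ g, κ g ∈ K) ∧ (∀ k ∈ K, ∀ g, κ (k * g) = k * κ g) ∧
    (∀ k ∈ K, κ k = k) := by
  let κ0 : G → G := fun g => g * (Quotient.out (Quotient.mk (QuotientGroup.rightRel K) g))⁻¹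
  have h1 : ∀ g, κ0 g ∈ K := by
    intro g
    have := Quotient.mk_out (s := QuotientGroup.rightRel K) g
    rw [← QuotientGroup.rightRel_apply]
    exact this
  have h2 : ∀ k ∈ K, ∀ g, κ0 (k * g) = k * κ0 g := by
    intro k hk g
    have : Quotient.mk (QuotientGroup.rightRel K) (k * g) = Quotient.mk (QuotientGroup.rightRel K) g := by
      apply Quotient.sound
      show QuotientGroup.rightRel K _ _
      rw [QuotientGroup.rightRel_apply]
      simpa using hk
    simp only [κ0]
    rw [this, mul_assoc]
  refine ⟨fun g => κ0 g * (κ0 1)⁻¹, fun g => K.mul_mem (h1 g) (K.inv_mem (h1 1)), ?_, ?_⟩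
  · intro k hk g
    simp only
    rw [h2 k hk, mul_assoc]
  · intro k hk
    have := h2 k hk 1
    rw [mul_one] at this
    simp only
    rw [this]; simp

def dgP (m : ℕ) (Y : Set (List Ω)) : Set (List G × List Ω) := {p | p.1.length = m ∧ p.2 ∈ Y}

lemma row_exact {K : Subgroup G} {X : Set (List Ω)} (hX : ∀ k ∈ K, ∀ σ ∈ X, gw k σ ∈ X) {k : ℕ} (hE : Ex X k)
    (m : ℕ) (x : PC G Ω) (hx : x ∈ sp (dgP m (lev X k))) (h0 : bd2 x ∈ NN Ω K) :
    ∃ w ∈ sp (dgP (G := G) m (lev X (k+1))), x - bd2 w ∈ NN Ω K := by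
  obtain ⟨κ, k1, k2, -⟩ := exists_kappa K
  let c : List G → G := fun l => (κ (l.headD 1))⁻¹
  let ν : PC G Ω →ₗ[ℤ] PC G Ω := lx (fun p => match p.1 with
    | [] => 0
    | a :: l => sg (gp (κ a)⁻¹ (a :: l, p.2)))
  have hν1 : ∀ x ∈ NN Ω K, ν x = 0 := by
    intro x hx
    have := NN_le ν ⊥ ?_ ?_ x hx
    · simpa using this
    · intro k hk l σ
      rw [Submodule.mem_bot]
      simp only [ν]
      rw [lx_sg, lx_sg]
      cases l with
      | nil => simp
      | cons a l =>
        simp only [gl, List.map_cons]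
        rw [k2 k hk a]
        simp [gp, gl, gw, mul_assoc, mul_smul]
        simp [← mul_smul, ← mul_assoc, Function.comp_def]
    · intro σ; simp [ν]
  have hν2 : ∀ x, ν (bd2 x) = bd2 (ν x) := by
    intro x
    refine lhom_congr (f := ν ∘ₗ bd2) (g := bd2 ∘ₗ ν) ?_ x
    rintro ⟨l, σ⟩
    simp only [LinearMap.comp_apply, ν]
    rw [lx_sg, lx_sg]
    cases l with
    | nil =>
      simp only [map_zero]
      refine lhom_congr (f := (lx _) ∘ₗ in2 []) (g := 0) ?_ (bdL σ)
      intro τ; simp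
    | cons a l =>
      simp only
      have := bd2_gp (κ a)⁻¹ (sg (a :: l, σ))
      rw [lx_sg (fun b => sg (gp (κ a)⁻¹ b)) (a :: l, σ)] at this
      rw [this, lx_sg]
      refine lhom_congr (f := (lx _) ∘ₗ in2 (a :: l)) (g := mp (gp (κ a)⁻¹) ∘ₗ in2 (a :: l)) ?_ (bdL σ)
      intro τ; simp
  have hν3 : ∀ x, x - ν x ∈ NN Ω K := by
    intro x
    refine sp_le (s := Set.univ) (LinearMap.id - ν) (NN Ω K) ?_ x (by simp [sp])
    rintro ⟨l, σ⟩ -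
    simp only [LinearMap.sub_apply, LinearMap.id_apply, ν]
    rw [lx_sg]
    cases l with
    | nil => simpa using NN_nil σ
    | cons a l =>
      have := NN_gen (Ω := Ω) (K.inv_mem (k1 a)) (a :: l) σ
      rw [← neg_sub]
      exact Submodule.neg_mem _ this
  have hν4 : ν x ∈ sp {p : List G × List Ω | p.1 ∈ {l : List G | l.length = m} ∧ p.2 ∈ X ∧ p.2.length = k} := by
    refine sp_le ν _ ?_ x hx
    rintro ⟨l, σ⟩ ⟨h1, h2, h3⟩
    simp only [ν]
    rw [lx_sg]
    cases l with
    | nil => exact Submodule.zero_mem _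
    | cons a l =>
      refine sg_mem_sp (s := {p : List G × List Ω | p.1 ∈ {l : List G | l.length = m} ∧ p.2 ∈ X ∧ p.2.length = k}) ⟨?_, ?_, ?_⟩
      · simpa [gp] using h1
      · exact hX _ (K.inv_mem (k1 a)) _ h2
      · simpa [gp] using h3
  obtain ⟨w, hw, hw2⟩ := slice_exact {l : List G | l.length = m} (fun _ => X) k (fun _ _ => hE) (ν x) hν4
    (by rw [← hν2, hν1 _ h0])
  exact ⟨w, hw, by rw [hw2]; exact hν3 x⟩

/-! ## Cones -/
abbrev MC (G : Type) := LC G × LC G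
abbrev MP (G Ω : Type) := PC G Ω × PC G Ω

noncomputable def cd : MC G →ₗ[ℤ] MC G :=
  LinearMap.prod (bd ∘ₗ LinearMap.fst ℤ _ _ + LinearMap.snd ℤ _ _) (-(bd ∘ₗ LinearMap.snd ℤ _ _))
noncomputable def cD1 : MP G Ω →ₗ[ℤ] MP G Ω :=
  LinearMap.prod (bd1 ∘ₗ LinearMap.fst ℤ _ _ + LinearMap.snd ℤ _ _) (-(bd1 ∘ₗ LinearMap.snd ℤ _ _))
noncomputable def cD2 : MP G Ω →ₗ[ℤ] MP G Ω :=
  LinearMap.prod (bd2 ∘ₗ LinearMap.fst ℤ _ _) (bd2 ∘ₗ LinearMap.snd ℤ _ _)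

lemma cd_apply (w : MC G) : cd w = (bd w.1 + w.2, - bd w.2) := rfl
lemma cD1_apply (w : MP G Ω) : cD1 w = (bd1 w.1 + w.2, - bd1 w.2) := rfl
lemma cD2_apply (w : MP G Ω) : cD2 w = (bd2 w.1, bd2 w.2) := rfl

lemma cd_cd (w : MC G) : cd (cd w) = 0 := by
  rw [cd_apply, cd_apply]
  simp only [map_add, map_neg, bd_bd]; simp
lemma cD1_cD1 (w : MP G Ω) : cD1 (cD1 w) = 0 := by
  rw [cD1_apply, cD1_apply]
  simp only [map_add, map_neg, bd1_bd1]; simp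
lemma cD2_cD2 (w : MP G Ω) : cD2 (cD2 w) = 0 := by
  rw [cD2_apply, cD2_apply]
  simp only [bd2_bd2]; rfl
lemma cD_comm (w : MP G Ω) : cD1 (cD2 w) = cD2 (cD1 w) := by
  simp only [cD1_apply, cD2_apply, map_add, map_neg, bd_comm]

noncomputable def R0 (K' K : Subgroup G) : Submodule ℤ (MC G) := (N0 K').prod (N0 K)
noncomputable def RR (Ω : Type) [MulAction G Ω] (K' K : Subgroup G) : Submodule ℤ (MP G Ω) := (NN Ω K').prod (NN Ω K)

noncomputable def dg0 (q : ℕ) : Submodule ℤ (MC G) := (sp {l : List G | l.length = q + 1}).prod (sp {l : List G | l.length = q})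
noncomputable def dg (q : ℕ) (Y' Y : Set (List Ω)) : Submodule ℤ (MP G Ω) := (sp (dgP (q+1) Y')).prod (sp (dgP q Y))

lemma R0_mono {K' K L' L : Subgroup G} (h' : K' ≤ L') (h : K ≤ L) : R0 K' K ≤ R0 L' L :=
  fun x hx => ⟨N0_mono h' hx.1, N0_mono h hx.2⟩

lemma cd_R0 {K' K : Subgroup G} (h : K ≤ K') {w : MC G} (hw : w ∈ R0 K' K) : cd w ∈ R0 K' K :=
  ⟨Submodule.add_mem _ (bd_N0 hw.1) (N0_mono h hw.2), Submodule.neg_mem _ (bd_N0 hw.2)⟩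
lemma cD1_RR {K' K : Subgroup G} (h : K ≤ K') {w : MP G Ω} (hw : w ∈ RR Ω K' K) : cD1 w ∈ RR Ω K' K :=
  ⟨Submodule.add_mem _ (bd1_NN hw.1) (NN_mono h hw.2), Submodule.neg_mem _ (bd1_NN hw.2)⟩
lemma cD2_RR {K' K : Subgroup G} {w : MP G Ω} (hw : w ∈ RR Ω K' K) : cD2 w ∈ RR Ω K' K :=
  ⟨bd2_NN hw.1, bd2_NN hw.2⟩

lemma bd_len {q : ℕ} {x : LC G} (hx : x ∈ sp {l : List G | l.length = q + 1}) : bd x ∈ sp {l : List G | l.length = q} := by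
  refine sp_le bd _ ?_ x hx
  intro l hl
  rw [lx_sg]
  exact sp_mono (fun l' h => h.2) (bdL_mem l q hl)

lemma bd1_len {q : ℕ} {Y : Set (List Ω)} {x : PC G Ω} (hx : x ∈ sp (dgP (q+1) Y)) : bd1 x ∈ sp (dgP (G := G) q Y) := by
  refine sp_le bd1 _ ?_ x hx
  rintro ⟨l, σ⟩ ⟨h1, h2⟩
  rw [lx_sg]
  refine sp_le (in1 σ) _ ?_ _ (bdL_mem l q h1)
  rintro l' ⟨_, h3⟩
  rw [lx_sg]; exact sg_mem_sp (s := dgP q Y) ⟨h3, h2⟩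

lemma bd2_len {q k : ℕ} {X : Set (List Ω)} (hX : FC X) {x : PC G Ω} (hx : x ∈ sp (dgP q (lev X (k+1)))) :
    bd2 x ∈ sp (dgP (G := G) q (lev X k)) := by
  refine sp_le bd2 _ ?_ x hx
  rintro ⟨l, σ⟩ ⟨h1, h2, h3⟩
  rw [lx_sg]
  refine sp_le (in2 l) _ ?_ _ (bdL_mem σ k h3)
  rintro l' ⟨h4, h5⟩
  rw [lx_sg]; exact sg_mem_sp (s := dgP q (lev X k)) ⟨h1, hX _ h2 _ h4, h5⟩

lemma len0_N0 {K : Subgroup G} {x : LC G} (hx : x ∈ sp {l : List G | l.length = 0}) : x ∈ N0 K := by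
  refine sp_le LinearMap.id (N0 K) ?_ x hx
  intro l hl
  have : l = [] := List.length_eq_zero_iff.mp hl
  subst this
  exact N0_nil
lemma len0_NN {K : Subgroup G} {Y : Set (List Ω)} {x : PC G Ω} (hx : x ∈ sp (dgP 0 Y)) : x ∈ NN Ω K := by
  refine sp_le LinearMap.id (NN Ω K) ?_ x hx
  rintro ⟨l, σ⟩ ⟨hl, -⟩
  have : l = [] := List.length_eq_zero_iff.mp hl
  subst this
  exact NN_nil σ

lemma cd_dg0 {q : ℕ} {w : MC G} (hw : w ∈ dg0 (q+1)) : cd w ∈ dg0 (G := G) q :=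
  ⟨Submodule.add_mem _ (bd_len hw.1) hw.2, Submodule.neg_mem _ (bd_len hw.2)⟩
lemma dgP_mono {q : ℕ} {Y Y' : Set (List Ω)} (h : Y ⊆ Y') {x : PC G Ω} (hx : x ∈ sp (dgP q Y)) : x ∈ sp (dgP (G := G) q Y') :=
  sp_mono (s := dgP q Y) (t := dgP q Y') (fun p hp => And.intro hp.1 (h hp.2)) hx
lemma cD1_dg {q : ℕ} {Y' Y : Set (List Ω)} (h : Y ⊆ Y') {w : MP G Ω} (hw : w ∈ dg (q+1) Y' Y) : cD1 w ∈ dg (G := G) q Y' Y :=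
  ⟨Submodule.add_mem _ (bd1_len hw.1) (dgP_mono h hw.2), Submodule.neg_mem _ (bd1_len hw.2)⟩
lemma cD2_dg {q k : ℕ} {X' X : Set (List Ω)} (hX' : FC X') (hX : FC X) {w : MP G Ω} (hw : w ∈ dg q (lev X' (k+1)) (lev X (k+1))) :
    cD2 w ∈ dg (G := G) q (lev X' k) (lev X k) := ⟨bd2_len hX' hw.1, bd2_len hX hw.2⟩

/-- in degree zero everything is a cycle -/
lemma cD1_zero {K' K : Subgroup G} (h : K ≤ K') {Y' Y : Set (List Ω)} {w : MP G Ω} (hw : w ∈ dg 0 Y' Y) :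
    cD1 w ∈ RR Ω K' K :=
  ⟨Submodule.add_mem _ (len0_NN (bd1_len hw.1)) (len0_NN hw.2), Submodule.neg_mem _ (bd1_NN (len0_NN hw.2))⟩

/-- vanishing of relative homology in degree q -/
def RV (K' K : Subgroup G) (q : ℕ) : Prop :=
  ∀ w ∈ dg0 q, cd w ∈ R0 K' K → ∃ y ∈ dg0 (q+1), w - cd y ∈ R0 K' K

/-- surjectivity on relative homology in degree q -/
def RS (K' K K1' K1 : Subgroup G) (q : ℕ) : Prop :=
  ∀ w ∈ dg0 q, cd w ∈ R0 K' K → ∃ w1 ∈ dg0 q, cd w1 ∈ R0 K1' K1 ∧ ∃ y ∈ dg0 (q+1), w - w1 - cd y ∈ R0 K' K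

lemma RV_zero {K' K : Subgroup G} (h : K ≤ K') : RV K' K 0 := by
  rintro ⟨x', x⟩ ⟨h1, h2⟩ _
  refine ⟨(0, x'), ⟨Submodule.zero_mem _, h1⟩, ?_⟩
  rw [cd_apply]
  refine ⟨by simp, ?_⟩
  show x - (- bd x') ∈ _
  rw [sub_neg_eq_add]
  exact Submodule.add_mem _ (len0_N0 h2) (len0_N0 (bd_len h1))

lemma RS_zero {K' K K1' K1 : Subgroup G} (h : K ≤ K') : RS K' K K1' K1 0 := by
  intro w hw hc
  obtain ⟨y, hy, h1⟩ := RV_zero h w hw hc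
  exact ⟨0, Submodule.zero_mem _, by rw [map_zero]; exact Submodule.zero_mem _, y, hy, by simpa using h1⟩

end chains
end HS

set_option linter.all false
namespace HS
open Finsupp

/-! ## Abstract spectral sequence argument -/
lemma SS_claim {M : Type} [AddCommGroup M] (R : Submodule ℤ M) (d1 d2 : M →ₗ[ℤ] M) (D : ℕ → ℕ → Submodule ℤ M) (N : ℕ)
    (hc : ∀ x, d1 (d2 x) = d2 (d1 x)) (h11 : ∀ x, d1 (d1 x) = 0) (h22 : ∀ x, d2 (d2 x) = 0)
    (hR1 : ∀ x ∈ R, d1 x ∈ R) (hR2 : ∀ x ∈ R, d2 x ∈ R)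
    (hD1 : ∀ q k, ∀ x ∈ D (q+1) k, d1 x ∈ D q k) (hD2 : ∀ q k, ∀ x ∈ D q (k+1), d2 x ∈ D q k)
    (h0 : ∀ k, ∀ x ∈ D 0 k, d1 x ∈ R)
    (hE : ∀ q k, q + k = N → ∀ x ∈ D q k, d2 x ∈ R → ∃ w ∈ D q (k+1), x - d2 w ∈ R)
    (hZ : ∀ q k, q + (k+1) = N → ∀ w ∈ D q (k+2), d1 w ∈ R → w ∈ R.comap d2 ⊔ (D (q+1) (k+2)).map d1) :
    ∀ q k, q + (k+1) = N → ∀ x ∈ D q (k+1), d1 x ∈ R → d2 x ∈ R → ∃ y ∈ D (q+1) (k+1), x - d1 y ∈ R ∧ d2 y ∈ R := by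
  intro q
  induction q with
  | zero =>
    intro k hk x hx h1 h2
    obtain ⟨w, hw, hxw⟩ := hE 0 (k+1) hk x hx h2
    obtain ⟨z, hz, u, ⟨y, hy, rfl⟩, hzu⟩ := Submodule.mem_sup.mp (hZ 0 k hk w hw (h0 _ w hw))
    refine ⟨d2 y, hD2 _ _ y hy, ?_, by rw [h22]; exact R.zero_mem⟩
    have : x - d1 (d2 y) = (x - d2 w) + d2 z := by rw [← hzu, map_add, hc]; abel
    rw [this]; exact R.add_mem hxw hz
  | succ q ih =>
    intro k hk x hx h1 h2
    obtain ⟨w, hw, hxw⟩ := hE (q+1) (k+1) hk x hx h2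
    have h3 : d2 (d1 w) ∈ R := by
      have := R.sub_mem h1 (hR1 _ hxw)
      rw [map_sub, hc w] at this; simpa using this
    obtain ⟨y0, hy0, h4, h5⟩ := ih (k+1) (by omega) (d1 w) (hD1 _ _ w hw) (by rw [h11]; exact R.zero_mem) h3
    obtain ⟨z, hz, u, ⟨y, hy, rfl⟩, hzu⟩ := Submodule.mem_sup.mp
      (hZ (q+1) k hk (w - y0) (Submodule.sub_mem _ hw hy0) (by rw [map_sub]; exact h4))
    refine ⟨d2 y, hD2 _ _ y hy, ?_, by rw [h22]; exact R.zero_mem⟩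
    have : x - d1 (d2 y) = (x - d2 w) + d2 z + d2 y0 := by
      have e : w = z + d1 y + y0 := by rw [hzu]; abel
      rw [e, map_add, map_add, hc]; abel
    rw [this]; exact R.add_mem (R.add_mem hxw hz) h5

lemma SS_main {M : Type} [AddCommGroup M] (R : Submodule ℤ M) (d1 d2 : M →ₗ[ℤ] M) (D : ℕ → ℕ → Submodule ℤ M) (N : ℕ)
    (hc : ∀ x, d1 (d2 x) = d2 (d1 x)) (h11 : ∀ x, d1 (d1 x) = 0) (h22 : ∀ x, d2 (d2 x) = 0)
    (hR1 : ∀ x ∈ R, d1 x ∈ R) (hR2 : ∀ x ∈ R, d2 x ∈ R)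
    (hD1 : ∀ q k, ∀ x ∈ D (q+1) k, d1 x ∈ D q k) (hD2 : ∀ q k, ∀ x ∈ D q (k+1), d2 x ∈ D q k)
    (h0 : ∀ k, ∀ x ∈ D 0 k, d1 x ∈ R) (h00 : ∀ q, ∀ x ∈ D q 0, d2 x ∈ R)
    (hE : ∀ q k, q + k = N → ∀ x ∈ D q k, d2 x ∈ R → ∃ w ∈ D q (k+1), x - d2 w ∈ R)
    (hZ : ∀ q k, q + (k+1) = N → ∀ w ∈ D q (k+2), d1 w ∈ R → w ∈ R.comap d2 ⊔ (D (q+1) (k+2)).map d1)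
    (hN : 1 ≤ N) (x : M) (hx : x ∈ D N 0) (hx1 : d1 x ∈ R) :
    ∃ w ∈ D N 1, d1 w ∈ R ∧ x - d2 w ∈ R := by
  obtain ⟨N, rfl⟩ : ∃ m, N = m + 1 := ⟨N-1, by omega⟩
  obtain ⟨w, hw, hxw⟩ := hE (N+1) 0 rfl x hx (h00 _ x hx)
  have h3 : d2 (d1 w) ∈ R := by
    have := R.sub_mem hx1 (hR1 _ hxw)
    rw [map_sub, hc w] at this; simpa using this
  obtain ⟨y0, hy0, h4, h5⟩ := SS_claim R d1 d2 D (N+1) hc h11 h22 hR1 hR2 hD1 hD2 h0 hE hZ N 0 rfl (d1 w) (hD1 _ _ w hw)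
    (by rw [h11]; exact R.zero_mem) h3
  refine ⟨w - y0, Submodule.sub_mem _ hw hy0, by rw [map_sub]; exact h4, ?_⟩
  have : x - d2 (w - y0) = (x - d2 w) + d2 y0 := by rw [map_sub]; abel
  rw [this]; exact R.add_mem hxw h5

section chains
variable {G Ω : Type} [Group G] [MulAction G Ω]

/-- pointwise stabilizer -/
def St (K : Subgroup G) (τ : List Ω) : Subgroup G where
  carrier := {g | g ∈ K ∧ gw g τ = τ}
  one_mem' := ⟨K.one_mem, gw_one τ⟩
  mul_mem' := fun {a b} ha hb => ⟨K.mul_mem ha.1 hb.1, by rw [gw_mul, hb.2, ha.2]⟩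
  inv_mem' := fun {a} ha => ⟨K.inv_mem ha.1, gw_inv ha.2⟩

lemma mem_St {K : Subgroup G} {τ : List Ω} {g : G} : g ∈ St K τ ↔ g ∈ K ∧ gw g τ = τ := Iff.rfl

open Classical in
noncomputable def psi (Y : Set (List Ω)) (r : List Ω → List Ω) (c : List Ω → G) (τ : List Ω) : PC G Ω →ₗ[ℤ] LC G :=
  lx (fun p => if p.2 ∈ Y ∧ r p.2 = τ then sg (gl (c p.2)⁻¹ p.1) else 0)

lemma psi_sg (Y : Set (List Ω)) (r : List Ω → List Ω) (c : List Ω → G) (τ : List Ω) (l : List G) (σ : List Ω)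
    (h : σ ∈ Y ∧ r σ = τ) : psi Y r c τ (sg (l, σ)) = sg (gl (c σ)⁻¹ l) := by
  rw [psi, lx_sg]; exact if_pos h
lemma psi_sg0 (Y : Set (List Ω)) (r : List Ω → List Ω) (c : List Ω → G) (τ : List Ω) (l : List G) (σ : List Ω)
    (h : ¬ (σ ∈ Y ∧ r σ = τ)) : psi Y r c τ (sg (l, σ)) = 0 := by
  rw [psi, lx_sg]; exact if_neg h

lemma psi_in1 (Y : Set (List Ω)) (r : List Ω → List Ω) (c : List Ω → G) (τ : List Ω) (x : LC G) (σ : List Ω)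
    (h : σ ∈ Y ∧ r σ = τ) : psi Y r c τ (in1 σ x) = mp (gl (c σ)⁻¹) x := by
  refine lhom_congr (α := List G) (M := LC G) (f := LinearMap.comp (psi Y r c τ) (in1 σ)) (g := mp (gl (c σ)⁻¹)) ?_ x
  intro l
  rw [LinearMap.comp_apply, lx_sg, psi_sg _ _ _ _ _ _ h, lx_sg]
lemma psi_in10 (Y : Set (List Ω)) (r : List Ω → List Ω) (c : List Ω → G) (τ : List Ω) (x : LC G) (σ : List Ω)
    (h : ¬ (σ ∈ Y ∧ r σ = τ)) : psi Y r c τ (in1 σ x) = 0 := by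
  refine lhom_congr (α := List G) (M := LC G) (f := LinearMap.comp (psi Y r c τ) (in1 σ)) (g := 0) ?_ x
  intro l
  rw [LinearMap.comp_apply, lx_sg, psi_sg0 _ _ _ _ _ _ h, LinearMap.zero_apply]

lemma psi_bd (Y : Set (List Ω)) (r : List Ω → List Ω) (c : List Ω → G) (τ : List Ω) (x : PC G Ω) :
    psi Y r c τ (bd1 x) = bd (psi Y r c τ x) := by
  refine lhom_congr (α := List G × List Ω) (M := LC G) (f := LinearMap.comp (psi Y r c τ) bd1) (g := LinearMap.comp bd (psi Y r c τ)) ?_ x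
  rintro ⟨l, σ⟩
  rw [LinearMap.comp_apply, LinearMap.comp_apply, lx_sg]
  by_cases h : σ ∈ Y ∧ r σ = τ
  · rw [psi_in1 _ _ _ _ _ _ h, psi_sg _ _ _ _ _ _ h, lx_sg]
    exact (bdL_map _ l).symm
  · rw [psi_in10 _ _ _ _ _ _ h, psi_sg0 _ _ _ _ _ _ h, map_zero]

lemma psi_NN {K : Subgroup G} {Y : Set (List Ω)} {r : List Ω → List Ω} {c : List Ω → G}
    (hY : ∀ k ∈ K, ∀ σ ∈ Y, gw k σ ∈ Y) (hr : ∀ k ∈ K, ∀ σ, r (gw k σ) = r σ)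
    (hc : ∀ σ ∈ Y, c σ ∈ K ∧ gw (c σ) (r σ) = σ) (τ : List Ω) (x : PC G Ω) (hx : x ∈ NN Ω K) :
    psi Y r c τ x ∈ N0 (St K τ) := by
  refine NN_le (psi Y r c τ) _ ?_ ?_ x hx
  · intro k hk l σ
    by_cases h : σ ∈ Y ∧ r σ = τ
    · have h' : gw k σ ∈ Y ∧ r (gw k σ) = τ := ⟨hY k hk σ h.1, by rw [hr k hk, h.2]⟩
      rw [psi_sg _ _ _ _ _ _ h, psi_sg _ _ _ _ _ _ h']
      have e : gl (c (gw k σ))⁻¹ (gl k l) = gl ((c (gw k σ))⁻¹ * k * c σ) (gl (c σ)⁻¹ l) := by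
        rw [← gl_mul, ← gl_mul]; congr 1; group
      rw [e]
      apply N0_gen
      obtain ⟨h1, h2⟩ := hc σ h.1
      obtain ⟨h3, h4⟩ := hc _ h'.1
      refine ⟨K.mul_mem (K.mul_mem (K.inv_mem h3) hk) h1, ?_⟩
      rw [h.2] at h2; rw [h'.2] at h4
      rw [gw_mul, h2, gw_mul]
      exact gw_inv h4
    · have h' : ¬ (gw k σ ∈ Y ∧ r (gw k σ) = τ) := by
        rintro ⟨h1, h2⟩
        apply h
        refine ⟨?_, by rw [← hr k hk, h2]⟩
        have := hY k⁻¹ (K.inv_mem hk) _ h1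
        rwa [gw_inv (g := k) (τ := σ) rfl] at this
      rw [psi_sg0 _ _ _ _ _ _ h, psi_sg0 _ _ _ _ _ _ h', sub_zero]
      exact Submodule.zero_mem _
  · intro σ
    by_cases h : σ ∈ Y ∧ r σ = τ
    · rw [psi_sg _ _ _ _ _ _ h]; exact N0_nil
    · rw [psi_sg0 _ _ _ _ _ _ h]; exact Submodule.zero_mem _

lemma psi_sum {K : Subgroup G} {Y : Set (List Ω)} {r : List Ω → List Ω} {c : List Ω → G}
    (hc : ∀ σ ∈ Y, c σ ∈ K ∧ gw (c σ) (r σ) = σ) (s : Finset (List Ω)) (x : PC G Ω)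
    (hx : x ∈ sp {p : List G × List Ω | p.2 ∈ Y ∧ r p.2 ∈ s}) :
    x - ∑ τ ∈ s, in1 τ (psi Y r c τ x) ∈ NN Ω K := by
  classical
  have := sp_le (LinearMap.id - ∑ τ ∈ s, LinearMap.comp (in1 τ) (psi Y r c τ)) (NN Ω K) ?_ x hx
  · simpa using this
  rintro ⟨l, σ⟩ ⟨h1, h2⟩
  simp only [LinearMap.sub_apply, LinearMap.id_apply, LinearMap.sum_apply, LinearMap.comp_apply]
  rw [Finset.sum_eq_single (r σ)]
  · rw [psi_sg _ _ _ _ _ _ ⟨h1, rfl⟩, lx_sg]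
    have := NN_gen (Ω := Ω) (hc σ h1).1 (gl (c σ)⁻¹ l) (r σ)
    rw [← gl_mul, mul_inv_cancel, gl_one, (hc σ h1).2] at this
    exact this
  · intro τ _ hτ
    rw [psi_sg0 _ _ _ _ _ _ (by rintro ⟨_, h⟩; exact hτ h.symm), map_zero]
  · intro h; exact absurd h2 h

lemma psi_len (Y : Set (List Ω)) (r : List Ω → List Ω) (c : List Ω → G) (τ : List Ω) {q : ℕ} {Y0 : Set (List Ω)} {x : PC G Ω}
    (hx : x ∈ sp (dgP q Y0)) : psi Y r c τ x ∈ sp {l : List G | l.length = q} := by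
  refine sp_le (psi Y r c τ) _ ?_ x hx
  rintro ⟨l, σ⟩ ⟨h1, h2⟩
  by_cases h : σ ∈ Y ∧ r σ = τ
  · rw [psi_sg _ _ _ _ _ _ h]
    refine sg_mem_sp (s := {l : List G | l.length = q}) ?_
    simpa using h1
  · rw [psi_sg0 _ _ _ _ _ _ h]; exact Submodule.zero_mem _

noncomputable def In1 (τ : List Ω) : MC G →ₗ[ℤ] MP G Ω := LinearMap.prodMap (in1 τ) (in1 τ)
lemma In1_apply (τ : List Ω) (w : MC G) : In1 τ w = (in1 τ w.1, in1 τ w.2) := rfl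
lemma cD1_In1 (τ : List Ω) (w : MC G) : cD1 (In1 τ w) = In1 τ (cd w) := by
  rw [In1_apply, In1_apply, cD1_apply, cd_apply]
  simp only [map_add, map_neg, bd1_in1]

lemma in1_NN {K1 K : Subgroup G} {τ : List Ω} (h : K1 ≤ St K τ) {x : LC G} (hx : x ∈ N0 K1) : in1 τ x ∈ NN Ω K := by
  refine N0_le (in1 τ) _ ?_ ?_ x hx
  · intro k hk l
    rw [lx_sg, lx_sg]
    have := NN_gen (Ω := Ω) (h hk).1 l τ
    rwa [(h hk).2] at this
  · rw [lx_sg]; exact NN_nil τ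
lemma In1_RR {K1' K1 K' K : Subgroup G} {τ : List Ω} (h' : K1' ≤ St K' τ) (h : K1 ≤ St K τ) {x : MC G} (hx : x ∈ R0 K1' K1) :
    In1 τ x ∈ RR Ω K' K := ⟨in1_NN h' hx.1, in1_NN h hx.2⟩
lemma in1_dgP {q : ℕ} {Y : Set (List Ω)} {τ : List Ω} (hτ : τ ∈ Y) {x : LC G} (hx : x ∈ sp {l : List G | l.length = q}) :
    in1 τ x ∈ sp (dgP (G := G) q Y) := by
  refine sp_le (in1 τ) _ ?_ x hx
  intro l hl
  rw [lx_sg]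
  exact sg_mem_sp (s := dgP q Y) (And.intro hl hτ)
lemma In1_dg {q : ℕ} {Y' Y : Set (List Ω)} {τ : List Ω} (h' : τ ∈ Y') (h : τ ∈ Y) {x : MC G} (hx : x ∈ dg0 q) :
    In1 τ x ∈ dg (G := G) q Y' Y := ⟨in1_dgP h' hx.1, in1_dgP h hx.2⟩

lemma orbit_lemma {K K' : Subgroup G} (hKK : K ≤ K') {Y Y' : Set (List Ω)} (hYY : Y ⊆ Y')
    (hY : ∀ k ∈ K, ∀ σ ∈ Y, gw k σ ∈ Y) (hY' : ∀ k ∈ K', ∀ σ ∈ Y', gw k σ ∈ Y') (P : List Ω → Prop)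
    (hP : ∀ σ ∈ Y', ∃ τ ∈ Y, P τ ∧ ∃ g ∈ K', gw g τ = σ)
    (hO : ∀ σ ∈ Y, ∀ τ ∈ Y, (∃ g ∈ K', gw g τ = σ) → ∃ g ∈ K, gw g τ = σ)
    (q : ℕ) (w : MP G Ω) (hw : w ∈ dg q Y' Y) (hc : cD1 w ∈ RR Ω K' K) :
    ∃ (s : Finset (List Ω)) (ω : List Ω → MC G), (∀ τ ∈ s, τ ∈ Y ∧ P τ ∧ ω τ ∈ dg0 q ∧ cd (ω τ) ∈ R0 (St K' τ) (St K τ)) ∧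
      w - ∑ τ ∈ s, In1 τ (ω τ) ∈ RR Ω K' K := by
  classical
  let S : Setoid (List Ω) :=
    { r := fun σ τ => ∃ g ∈ K', gw g τ = σ
      iseqv := ⟨fun σ => ⟨1, K'.one_mem, gw_one σ⟩, fun {σ τ} ⟨g, hg, h⟩ => ⟨g⁻¹, K'.inv_mem hg, gw_inv h⟩,
        fun {a b c} ⟨g, hg, h⟩ ⟨g2, hg2, h2⟩ => ⟨g * g2, K'.mul_mem hg hg2, by rw [gw_mul, h2, h]⟩⟩ }
  have hrep : ∀ σ : List Ω, ∃ τ, σ ∈ Y' → τ ∈ Y ∧ P τ ∧ ∃ g ∈ K', gw g τ = σ := by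
    intro σ
    by_cases h : σ ∈ Y'
    · obtain ⟨τ, h1, h2⟩ := hP σ h; exact ⟨τ, fun _ => ⟨h1, h2⟩⟩
    · exact ⟨[], fun h' => absurd h' h⟩
  choose r0 hr0 using hrep
  let r : List Ω → List Ω := fun σ => r0 (Quotient.out (Quotient.mk S σ))
  have hr : ∀ k ∈ K', ∀ σ, r (gw k σ) = r σ := by
    intro k hk σ
    have : Quotient.mk S (gw k σ) = Quotient.mk S σ := Quotient.sound ⟨k, hk, rfl⟩
    simp only [r, this]
  have hr1 : ∀ σ ∈ Y', r σ ∈ Y ∧ P (r σ) ∧ ∃ g ∈ K', gw g (r σ) = σ := by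
    intro σ hσ
    obtain ⟨g, hg, h⟩ : ∃ g ∈ K', gw g σ = Quotient.out (Quotient.mk S σ) := Quotient.mk_out (s := S) σ
    have h1 : Quotient.out (Quotient.mk S σ) ∈ Y' := by rw [← h]; exact hY' g hg σ hσ
    obtain ⟨h2, h3, g2, hg2, h4⟩ := hr0 _ h1
    refine ⟨h2, h3, g⁻¹ * g2, K'.mul_mem (K'.inv_mem hg) hg2, ?_⟩
    rw [gw_mul]
    show gw g⁻¹ (gw g2 (r0 _)) = σ
    rw [h4]; exact gw_inv h
  have hcex : ∀ σ, ∃ c : G, (σ ∈ Y' → c ∈ K' ∧ gw c (r σ) = σ) ∧ (σ ∈ Y → c ∈ K) := by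
    intro σ
    by_cases h : σ ∈ Y
    · obtain ⟨h1, _, h2⟩ := hr1 σ (hYY h)
      obtain ⟨g, hg, h3⟩ := hO σ h (r σ) h1 h2
      exact ⟨g, fun _ => ⟨hKK hg, h3⟩, fun _ => hg⟩
    · by_cases h' : σ ∈ Y'
      · obtain ⟨h1, _, g, hg, h2⟩ := hr1 σ h'
        exact ⟨g, fun _ => ⟨hg, h2⟩, fun h3 => absurd h3 h⟩
      · exact ⟨1, fun h3 => absurd h3 h', fun h3 => absurd h3 h⟩
  choose c hc1 hc2 using hcex
  have hcY : ∀ σ ∈ Y, c σ ∈ K ∧ gw (c σ) (r σ) = σ := fun σ h => ⟨hc2 σ h, (hc1 σ (hYY h)).2⟩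
  let s : Finset (List Ω) := (w.1.support.image (fun p => r p.2)) ∪ (w.2.support.image (fun p => r p.2))
  have hψ : ∀ τ, psi Y r c τ w.2 = psi Y' r c τ w.2 := by
    intro τ
    refine sp_congr ?_ w.2 hw.2
    rintro ⟨l, σ⟩ ⟨h1, h2⟩
    by_cases h : r σ = τ
    · rw [psi_sg _ _ _ _ _ _ ⟨h2, h⟩, psi_sg _ _ _ _ _ _ ⟨hYY h2, h⟩]
    · rw [psi_sg0 _ _ _ _ _ _ (fun h' => h h'.2), psi_sg0 _ _ _ _ _ _ (fun h' => h h'.2)]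
  refine ⟨s, fun τ => (psi Y' r c τ w.1, psi Y r c τ w.2), ?_, ?_⟩
  · intro τ hτ
    have hτ1 : τ ∈ Y ∧ P τ := by
      rcases Finset.mem_union.mp hτ with h | h
      · obtain ⟨p, hp, rfl⟩ := Finset.mem_image.mp h
        have := hr1 p.2 (hw.1 hp).2
        exact ⟨this.1, this.2.1⟩
      · obtain ⟨p, hp, rfl⟩ := Finset.mem_image.mp h
        have := hr1 p.2 (hYY (hw.2 hp).2)
        exact ⟨this.1, this.2.1⟩
    refine ⟨hτ1.1, hτ1.2, ⟨psi_len _ _ _ _ hw.1, psi_len _ _ _ _ hw.2⟩, ?_⟩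
    rw [cd_apply]
    refine ⟨?_, ?_⟩
    · show bd (psi Y' r c τ w.1) + psi Y r c τ w.2 ∈ _
      rw [hψ, ← psi_bd, ← map_add]
      exact psi_NN hY' hr (fun σ h => hc1 σ h) τ _ hc.1
    · show - bd (psi Y r c τ w.2) ∈ _
      rw [← psi_bd, ← map_neg]
      exact psi_NN hY (fun k hk => hr k (hKK hk)) hcY τ _ hc.2
  · have e : w - ∑ τ ∈ s, In1 τ (psi Y' r c τ w.1, psi Y r c τ w.2) =
        (w.1 - ∑ τ ∈ s, in1 τ (psi Y' r c τ w.1), w.2 - ∑ τ ∈ s, in1 τ (psi Y r c τ w.2)) := by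
      simp only [In1_apply]
      refine Prod.ext ?_ ?_
      · rw [Prod.fst_sub, Prod.fst_sum]
      · rw [Prod.snd_sub, Prod.snd_sum]
    rw [e]
    refine ⟨psi_sum (fun σ h => hc1 σ h) s w.1 ?_, psi_sum hcY s w.2 ?_⟩
    · intro p hp
      exact ⟨(hw.1 hp).2, Finset.mem_union_left _ (Finset.mem_image_of_mem (fun p : List G × List Ω => r p.2) hp)⟩
    · intro p hp
      exact ⟨(hw.2 hp).2, Finset.mem_union_right _ (Finset.mem_image_of_mem (fun p : List G × List Ω => r p.2) hp)⟩

/-! ## the submodule Z -/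
noncomputable def Zs (K' K : Subgroup G) (q : ℕ) (Y' Y : Set (List Ω)) : Submodule ℤ (MP G Ω) :=
  (RR Ω K' K).comap cD2 ⊔ (dg (q+1) Y' Y).map cD1

lemma RR_Zs {K' K : Subgroup G} {q : ℕ} {Y' Y : Set (List Ω)} {w : MP G Ω} (hw : w ∈ RR Ω K' K) : w ∈ Zs K' K q Y' Y :=
  Submodule.mem_sup_left (cD2_RR hw)
lemma cD2_Zs {K' K : Subgroup G} {q : ℕ} {Y' Y : Set (List Ω)} (w : MP G Ω) : cD2 w ∈ Zs K' K q Y' Y :=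
  Submodule.mem_sup_left (by show cD2 (cD2 w) ∈ RR Ω K' K; rw [cD2_cD2]; exact Submodule.zero_mem _)
lemma cD1_Zs {K' K : Subgroup G} {q : ℕ} {Y' Y : Set (List Ω)} {w : MP G Ω} (hw : w ∈ dg (q+1) Y' Y) : cD1 w ∈ Zs K' K q Y' Y :=
  Submodule.mem_sup_right ⟨w, hw, rfl⟩

lemma Z_of_bdry {K1' K1 K' K : Subgroup G} {q : ℕ} {Y' Y : Set (List Ω)} {τ : List Ω} (h' : K1' ≤ St K' τ) (h : K1 ≤ St K τ)
    (hτ' : τ ∈ Y') (hτ : τ ∈ Y) {ω y : MC G} (hy : y ∈ dg0 (q+1)) (hω : ω - cd y ∈ R0 K1' K1) : In1 τ ω ∈ Zs K' K q Y' Y := by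
  have e : In1 τ ω = In1 τ (ω - cd y) + cD1 (In1 τ y) := by rw [cD1_In1, ← map_add]; congr 1; abel
  rw [e]
  exact Submodule.add_mem _ (RR_Zs (In1_RR h' h hω)) (cD1_Zs (In1_dg hτ' hτ hy))

lemma Z_of_RV {K1' K1 K' K : Subgroup G} {q : ℕ} {Y' Y : Set (List Ω)} {τ : List Ω} (h' : K1' ≤ St K' τ) (h : K1 ≤ St K τ)
    (hτ' : τ ∈ Y') (hτ : τ ∈ Y) (hRV : RV K1' K1 q) {ω : MC G} (hω : ω ∈ dg0 q) (hc : cd ω ∈ R0 K1' K1) : In1 τ ω ∈ Zs K' K q Y' Y := by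
  obtain ⟨y, hy, h1⟩ := hRV ω hω hc
  exact Z_of_bdry h' h hτ' hτ hy h1

/-- faces of τ⁺ -/
lemma Z_face {K' K : Subgroup G} {q : ℕ} {Y' Y : Set (List Ω)} (v0 v1 c : Ω) (ws : List Ω) (ω : MC G)
    (hmid : In1 (v1 :: c :: ws) ω - In1 (v0 :: c :: ws) ω ∈ Zs K' K q Y' Y)
    (hrest : ∀ ws', List.Sublist ws' ws → ws'.length + 1 = ws.length → In1 (v0 :: v1 :: c :: ws') ω ∈ Zs K' K q Y' Y) :
    In1 (v0 :: v1 :: ws) ω ∈ Zs K' K q Y' Y := by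
  have hT : ∀ (y : LC Ω), (tn ω.1 y, tn ω.2 y) = lx (fun τ => In1 τ ω) y := by
    intro y
    refine lhom_congr (f := LinearMap.prod (tn ω.1) (tn ω.2)) (g := lx (fun τ => In1 τ ω)) ?_ y
    intro τ
    rw [lx_sg]
    show (tn ω.1 (sg τ), tn ω.2 (sg τ)) = _
    rw [tn_sg2, tn_sg2]; rfl
  have h1 : cD2 (In1 (v0 :: v1 :: c :: ws) ω) = lx (fun τ => In1 τ ω) (bdL (v0 :: v1 :: c :: ws)) := by
    rw [← hT, In1_apply, cD2_apply, bd2_in1, bd2_in1]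
  have h2 : bdL (v0 :: v1 :: c :: ws) = sg (v1 :: c :: ws) - sg (v0 :: c :: ws) + sg (v0 :: v1 :: ws) - cn v0 (cn v1 (cn c (bdL ws))) := by
    simp only [bdL, map_sub, lx_sg]; abel
  have h3 : lx (fun τ => In1 τ ω) (cn v0 (cn v1 (cn c (bdL ws)))) ∈ Zs K' K q Y' Y := by
    cases hws : ws.length with
    | zero =>
      have : ws = [] := List.length_eq_zero_iff.mp hws
      subst this
      simp [bdL]
    | succ m =>
      have := sp_le (LinearMap.comp (lx (fun τ => In1 τ ω)) (LinearMap.comp (cn v0) (LinearMap.comp (cn v1) (cn c)))) (Zs K' K q Y' Y) ?_ _ (bdL_mem ws m hws)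
      · exact this
      · rintro ws' ⟨h4, h5⟩
        simp only [LinearMap.comp_apply, lx_sg]
        exact hrest ws' h4 (by rw [h5, hws])
  have h4 := cD2_Zs (K' := K') (K := K) (q := q) (Y' := Y') (Y := Y) (In1 (v0 :: v1 :: c :: ws) ω)
  rw [h1, h2, map_sub, map_add, map_sub, lx_sg, lx_sg, lx_sg] at h4
  have h5 := Submodule.add_mem _ (Submodule.sub_mem _ h4 hmid) h3
  convert h5 using 1
  abel

/-! homotopy -/
noncomputable def HH (g : G) : MC G →ₗ[ℤ] MC G := LinearMap.prodMap (pr (fun x => g * x)) (-(pr (fun x => g * x)))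
noncomputable def gM (g : G) : MC G →ₗ[ℤ] MC G := LinearMap.prodMap (mp (gl g)) (mp (gl g))
lemma HH_apply (g : G) (w : MC G) : HH g w = (pr (fun x => g * x) w.1, - pr (fun x => g * x) w.2) := rfl
lemma gM_apply (g : G) (w : MC G) : gM g w = (mp (gl g) w.1, mp (gl g) w.2) := rfl
lemma cd_HH (g : G) (w : MC G) : cd (HH g w) + HH g (cd w) = gM g w - w := by
  have h1 := prism (fun x => g * x) w.1
  have h2 := prism (fun x => g * x) w.2
  rw [HH_apply, HH_apply, cd_apply, cd_apply, gM_apply]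
  refine Prod.ext ?_ ?_
  · simp only [Prod.fst_add, Prod.fst_sub, map_add]
    rw [← h1]; abel
  · simp only [Prod.snd_add, Prod.snd_sub, map_neg]
    rw [← h2]; abel

lemma pr_len (φ : G → G) {q : ℕ} {x : LC G} (hx : x ∈ sp {l : List G | l.length = q}) : pr φ x ∈ sp {l : List G | l.length = q + 1} := by
  refine sp_le (pr φ) _ ?_ x hx
  intro l hl
  rw [lx_sg]
  have : ∀ l : List G, prL φ l ∈ sp {l' : List G | l'.length = l.length + 1} := by
    intro l
    induction l with
    | nil => exact Submodule.zero_mem _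
    | cons a l ih =>
      rw [prL]
      refine Submodule.sub_mem _ (sg_mem_sp (s := {l' : List G | l'.length = (a :: l).length + 1}) (by simp)) ?_
      refine sp_le (cn a) _ ?_ _ ih
      intro l' hl'
      rw [lx_sg]
      refine sg_mem_sp (s := {l' : List G | l'.length = (a :: l).length + 1}) ?_
      have : l'.length = l.length + 1 := hl'
      simp [this]
  have h := this l
  have hl' : l.length = q := hl
  rwa [hl'] at h
lemma HH_dg0 (g : G) {q : ℕ} {w : MC G} (hw : w ∈ dg0 q) : HH g w ∈ dg0 (G := G) (q+1) :=
  ⟨pr_len _ hw.1, Submodule.neg_mem _ (pr_len _ hw.2)⟩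

lemma prL_comm (φ ψ : G → G) (h : ∀ x, φ (ψ x) = ψ (φ x)) (l : List G) : prL φ (l.map ψ) = mp (List.map ψ) (prL φ l) := by
  induction l with
  | nil => simp [prL]
  | cons a l ih =>
    simp only [List.map_cons, prL, map_sub, ih, lx_sg]
    congr 1
    · congr 1; simp [h, Function.comp_def]
    · refine lhom_congr (f := LinearMap.comp (cn (ψ a)) (mp (List.map ψ))) (g := LinearMap.comp (mp (List.map ψ)) (cn a)) ?_ _
      intro l; simp
lemma pr_N0 {K : Subgroup G} {g : G} (hg : ∀ k ∈ K, g * k = k * g) {x : LC G} (hx : x ∈ N0 K) : pr (fun x => g * x) x ∈ N0 K := by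
  refine N0_le (pr (fun x => g * x)) _ ?_ ?_ x hx
  · intro k hk l
    rw [lx_sg, lx_sg]
    have : prL (fun x => g * x) (gl k l) = mp (gl k) (prL (fun x => g * x) l) := prL_comm _ _ (fun x => by rw [← mul_assoc, hg k hk, mul_assoc]) l
    rw [this]
    exact N0_tr hk _
  · rw [lx_sg]; exact Submodule.zero_mem _
lemma HH_R0 {K' K : Subgroup G} {g : G} (h : K ≤ K') (hg : ∀ k ∈ K', g * k = k * g) {w : MC G} (hw : w ∈ R0 K' K) : HH g w ∈ R0 K' K :=
  ⟨pr_N0 hg hw.1, Submodule.neg_mem _ (pr_N0 (fun k hk => hg k (h hk)) hw.2)⟩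

lemma In1_gM {K' K : Subgroup G} (hKK : K ≤ K') {g : G} (hg : g ∈ K) (σ : List Ω) (w : MC G) : In1 (gw g σ) (gM g w) - In1 σ w ∈ RR Ω K' K := by
  rw [In1_apply, In1_apply, gM_apply]
  simp only
  rw [in1_gp, in1_gp]
  exact ⟨NN_tr (hKK hg) _, NN_tr hg _⟩

lemma Z_mid {K' K K1' K1 K2' K2 : Subgroup G} (hKK : K ≤ K') {q : ℕ} {Y' Y : Set (List Ω)} (σ0 σ1 : List Ω) {g : G} (hg : g ∈ K) (hgσ : gw g σ1 = σ0)
    (h0' : K1' ≤ St K' σ0) (h0 : K1 ≤ St K σ0) (h1' : K1' ≤ St K' σ1) (h1 : K1 ≤ St K σ1)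
    (hY0' : σ0 ∈ Y') (hY0 : σ0 ∈ Y) (hY1' : σ1 ∈ Y') (hY1 : σ1 ∈ Y)
    (h2' : K2' ≤ K1') (h2 : K2 ≤ K1) (hK2 : K2 ≤ K2') (hcen : ∀ k ∈ K2', g * k = k * g) (hRS : RS K1' K1 K2' K2 q)
    {ω : MC G} (hω : ω ∈ dg0 q) (hc : cd ω ∈ R0 K1' K1) : In1 σ1 ω - In1 σ0 ω ∈ Zs K' K q Y' Y := by
  obtain ⟨ω2, hω2, hc2, y, hy, h3⟩ := hRS ω hω hc
  have e1 := Z_of_bdry (K' := K') (K := K) (ω := ω - ω2) h0' h0 hY0' hY0 hy h3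
  have e2 := Z_of_bdry (K' := K') (K := K) (ω := ω - ω2) h1' h1 hY1' hY1 hy h3
  have e3 := In1_gM (Ω := Ω) hKK hg σ1 ω2
  rw [hgσ] at e3
  have e4 : In1 σ0 (gM g ω2 - ω2) ∈ Zs K' K q Y' Y := by
    refine Z_of_bdry (K1' := K2') (K1 := K2) (h2'.trans h0') (h2.trans h0) hY0' hY0 (HH_dg0 g hω2) ?_
    rw [← cd_HH]
    have : cd (HH g ω2) + HH g (cd ω2) - cd (HH g ω2) = HH g (cd ω2) := by abel
    rw [this]
    exact HH_R0 hK2 hcen hc2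
  have e5 := Submodule.add_mem _ (Submodule.sub_mem _ (Submodule.sub_mem _ e2 e1) (RR_Zs (q := q) (Y' := Y') (Y := Y) e3)) e4
  convert e5 using 1
  simp only [map_sub]; abel

/-! degree zero -/
lemma Z0_inX {K' K : Subgroup G} {Y' Y : Set (List Ω)} (hYY : Y ⊆ Y') {σ τ : List Ω} (hτ : τ ∈ Y) {g : G} (hg : g ∈ K') (h : gw g τ = σ) (γ : G) :
    In1 σ (sg [γ], 0) ∈ Zs K' K 0 Y' Y := by
  have e : cD1 ((0, sg ([g⁻¹ * γ], τ)) : MP G Ω) ∈ Zs K' K 0 Y' Y :=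
    cD1_Zs ⟨Submodule.zero_mem _, sg_mem_sp (s := dgP 1 Y) ⟨rfl, hτ⟩⟩
  rw [cD1_apply] at e
  have h1 : In1 σ (sg [γ], 0) - (bd1 0 + sg ([g⁻¹ * γ], τ), - bd1 (sg ([g⁻¹ * γ], τ))) ∈ RR Ω K' K := by
    rw [In1_apply]
    refine ⟨?_, ?_⟩
    · simp only [map_zero, zero_add, Prod.fst_sub]
      rw [lx_sg]
      have := NN_gen (Ω := Ω) hg [g⁻¹ * γ] τ
      rw [h] at this
      simpa [gl] using this
    · simp only [map_zero, Prod.snd_sub]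
      rw [lx_sg, zero_sub, neg_neg]
      simp only [bdL, map_zero, sub_zero, lx_sg]
      exact NN_nil τ
  have := Submodule.add_mem _ (RR_Zs (q := 0) (Y' := Y') (Y := Y) h1) e
  convert this using 1
  abel

lemma Z0_mid {K' K : Subgroup G} {Y' Y : Set (List Ω)} (σ0 σ1 : List Ω) {g : G} (hg : g ∈ K') (hgσ : gw g σ1 = σ0)
    (hY0' : σ0 ∈ Y') (γ : G) : In1 σ1 (sg [γ], 0) - In1 σ0 (sg [γ], 0) ∈ Zs K' K 0 Y' Y := by
  have e : cD1 ((sg ([γ, g * γ], σ0), 0) : MP G Ω) ∈ Zs K' K 0 Y' Y :=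
    cD1_Zs ⟨sg_mem_sp (s := dgP 2 Y') ⟨rfl, hY0'⟩, Submodule.zero_mem _⟩
  rw [cD1_apply] at e
  have h1 : In1 σ1 (sg [γ], 0) - In1 σ0 (sg [γ], 0) - (bd1 (sg ([γ, g * γ], σ0)) + 0, - bd1 0) ∈ RR Ω K' K := by
    rw [In1_apply, In1_apply]
    refine ⟨?_, ?_⟩
    · simp only [Prod.fst_sub]
      rw [lx_sg, lx_sg, lx_sg]
      simp only [bdL, map_zero, sub_zero, lx_sg, map_sub, add_zero]
      have := NN_gen (Ω := Ω) hg [γ] σ1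
      rw [hgσ] at this
      have := Submodule.neg_mem _ this
      show _ ∈ NN Ω K'
      convert this using 1
      simp only [gl, List.map_cons, List.map_nil]
      abel
    · simp
  have := Submodule.add_mem _ (RR_Zs (q := 0) (Y' := Y') (Y := Y) h1) e
  convert this using 1
  abel

/-- reduction for q = 0 -/
lemma Z0_all {K' K : Subgroup G} {Y' Y : Set (List Ω)} (h : ∀ σ ∈ Y', ∀ γ : G, In1 σ (sg [γ], 0) ∈ Zs K' K 0 Y' Y)
    (w : MP G Ω) (hw : w ∈ dg 0 Y' Y) : w ∈ Zs K' K 0 Y' Y := by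
  have h1 : ((0, w.2) : MP G Ω) ∈ Zs K' K 0 Y' Y := RR_Zs ⟨Submodule.zero_mem _, len0_NN hw.2⟩
  have h2 : LinearMap.inl ℤ (PC G Ω) (PC G Ω) w.1 ∈ Zs K' K 0 Y' Y := by
    refine sp_le (LinearMap.inl ℤ (PC G Ω) (PC G Ω)) (Zs K' K 0 Y' Y) ?_ w.1 hw.1
    rintro ⟨l, σ⟩ ⟨hl, hσ⟩
    obtain ⟨γ, rfl⟩ := List.length_eq_one_iff.mp hl
    have := h σ hσ γ
    rw [In1_apply] at this
    simpa using this
  have := Submodule.add_mem _ h2 h1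
  simpa using this

/-- the spectral sequence, specialised -/
lemma SS_app {K' K : Subgroup G} (hKK : K ≤ K') {X' X : Set (List Ω)} (hXX : X ⊆ X') (hF' : FC X') (hF : FC X)
    (hI' : ∀ k ∈ K', ∀ σ ∈ X', gw k σ ∈ X') (hI : ∀ k ∈ K, ∀ σ ∈ X, gw k σ ∈ X) (N : ℕ) (hN : 1 ≤ N)
    (hE' : ∀ k ≤ N, Ex X' k) (hE : ∀ k < N, Ex X k)
    (hZ : ∀ q k, q + (k+1) = N → ∀ w ∈ dg q (lev X' (k+2)) (lev X (k+2)), cD1 w ∈ RR Ω K' K → w ∈ Zs K' K q (lev X' (k+2)) (lev X (k+2)))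
    (x : MP G Ω) (hx : x ∈ dg N (lev X' 0) (lev X 0)) (hx1 : cD1 x ∈ RR Ω K' K) :
    ∃ w ∈ dg N (lev X' 1) (lev X 1), cD1 w ∈ RR Ω K' K ∧ x - cD2 w ∈ RR Ω K' K := by
  have hl : ∀ k, lev X k ⊆ lev X' k := fun k σ h => ⟨hXX h.1, h.2⟩
  refine SS_main (RR Ω K' K) cD1 cD2 (fun q k => dg q (lev X' k) (lev X k)) N cD_comm cD1_cD1 cD2_cD2
    (fun x h => cD1_RR hKK h) (fun x h => cD2_RR h) (fun q k x h => cD1_dg (hl k) h) (fun q k x h => cD2_dg hF' hF h)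
    (fun k x h => cD1_zero hKK h) ?_ ?_ hZ hN x hx hx1
  · have : ∀ (q : ℕ) (X : Set (List Ω)) (x : PC G Ω), x ∈ sp (dgP q (lev X 0)) → bd2 x = 0 := by
      intro q X x hx
      refine sp_congr (f := bd2) (g := 0) ?_ x hx
      rintro ⟨l, σ⟩ ⟨h1, h2, h3⟩
      have : σ = [] := List.length_eq_zero_iff.mp h3
      subst this
      rw [lx_sg]; simp [bdL]
    intro q x hx
    rw [cD2_apply, this _ _ _ hx.1, this _ _ _ hx.2]
    exact Submodule.zero_mem _
  · intro q k hqk x hx h0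
    obtain ⟨w', hw', h1⟩ := row_exact hI' (hE' k (by omega)) (q+1) x.1 hx.1 h0.1
    rcases Nat.eq_zero_or_pos q with rfl | hq
    · refine ⟨(w', 0), ⟨hw', Submodule.zero_mem _⟩, ?_⟩
      rw [cD2_apply]
      refine ⟨h1, ?_⟩
      simp only [map_zero, Prod.snd_sub, sub_zero]
      exact len0_NN hx.2
    · obtain ⟨w, hw, h2⟩ := row_exact hI (hE k (by omega)) q x.2 hx.2 h0.2
      exact ⟨(w', w), ⟨hw', hw⟩, ⟨h1, h2⟩⟩

end chains
end HS

set_option linter.all false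
namespace HS
open Finsupp

section ambient
variable {F : Type} [Field F]

abbrev EE (F : Type) [Field F] := ℕ →₀ F × F

variable (F) in
noncomputable def bF : EE F →ₗ[F] EE F →ₗ[F] F :=
  Finsupp.lsum F (fun i => (LinearMap.fst F F F).smulRight ((LinearMap.snd F F F).comp (Finsupp.lapply i)))

variable (F) in
noncomputable def qF : QuadraticForm F (EE F) := LinearMap.BilinMap.toQuadraticMap (bF F)

lemma bF_single (i : ℕ) (p : F × F) (w : EE F) : bF F (single i p) w = p.1 * (w i).2 := by
  simp [bF]
lemma bF_single' (i : ℕ) (p : F × F) (w : EE F) : bF F w (single i p) = (w i).1 * p.2 := by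
  induction w using Finsupp.induction_linear with
  | zero => simp
  | add f g hf hg => rw [map_add, LinearMap.add_apply, hf, hg]; simp; ring
  | single j r =>
    rw [bF_single]
    by_cases h : i = j
    · subst h; simp
    · rw [single_eq_of_ne (by tauto), single_eq_of_ne (by tauto)]; simp

lemma qF_apply (v : EE F) : qF F v = bF F v v := rfl
lemma be_bF (v w : EE F) : be (qF F) v w = bF F v w + bF F w v := by
  rw [be_def, qF_apply, qF_apply, qF_apply]; simp only [map_add, LinearMap.add_apply]; ring

noncomputable def e (i : ℕ) : EE F := single i (1, 0)
noncomputable def f (i : ℕ) : EE F := single i (0, 1)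

lemma be_e (v : EE F) (i : ℕ) : be (qF F) v (e i) = (v i).2 := by
  rw [be_bF, e, bF_single, bF_single']; simp
lemma be_f (v : EE F) (i : ℕ) : be (qF F) v (f i) = (v i).1 := by
  rw [be_bF, f, bF_single, bF_single']; simp
lemma Q_e (i : ℕ) : qF F (e i) = 0 := by rw [qF_apply, e, bF_single]; simp
lemma Q_f (i : ℕ) : qF F (f i) = 0 := by rw [qF_apply, f, bF_single]; simp
lemma e_self (i : ℕ) : (e i : EE F) i = (1, 0) := by simp [e]
lemma f_self (i : ℕ) : (f i : EE F) i = (0, 1) := by simp [f]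
lemma e_ne {i j : ℕ} (h : j ≠ i) : (e i : EE F) j = 0 := by rw [e, single_eq_of_ne h]
lemma f_ne {i j : ℕ} (h : j ≠ i) : (f i : EE F) j = 0 := by rw [f, single_eq_of_ne h]
lemma e_snd (i j : ℕ) : ((e i : EE F) j).2 = 0 := by
  by_cases h : j = i
  · subst h; rw [e_self]
  · rw [e_ne h]; rfl
lemma f_fst (i j : ℕ) : ((f i : EE F) j).1 = 0 := by
  by_cases h : j = i
  · subst h; rw [f_self]
  · rw [f_ne h]; rfl
lemma e_fst_ne {i j : ℕ} (h : j ≠ i) : ((e i : EE F) j).1 = 0 := by rw [e_ne h]; rfl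
lemma f_snd_ne {i j : ℕ} (h : j ≠ i) : ((f i : EE F) j).2 = 0 := by rw [f_ne h]; rfl
lemma e_ne_zero (i : ℕ) : (e i : EE F) ≠ 0 := by
  intro h
  have := congrArg (fun v : EE F => (v i).1) h
  simp [e_self] at this

variable (F) in
/-- the ambient group -/
noncomputable abbrev GG := quadIsoms F (qF F)

lemma smul_def (g : GG F) (v : EE F) : g • v = g.1 v := rfl
lemma g_add (g : GG F) (v w : EE F) : g • (v + w) = g • v + g • w := map_add g.1 v w
lemma g_sub (g : GG F) (v w : EE F) : g • (v - w) = g • v - g • w := map_sub g.1 v w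
lemma g_smul (g : GG F) (c : F) (v : EE F) : g • (c • v) = c • (g • v) := map_smul g.1 c v
lemma g_zero (g : GG F) : g • (0 : EE F) = 0 := map_zero g.1
lemma g_Q (g : GG F) (v : EE F) : qF F (g • v) = qF F v := g.2 v
lemma g_be (g : GG F) (v w : EE F) : be (qF F) (g • v) (g • w) = be (qF F) v w := by
  rw [be_def, be_def, ← g_add, g_Q, g_Q, g_Q]
lemma g_ext {g h : GG F} (H : ∀ v : EE F, g • v = h • v) : g = h :=
  Subtype.ext (LinearEquiv.ext H)
lemma g_inv_fix {g : GG F} {v : EE F} (h : g • v = v) : g⁻¹ • v = v := by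
  rw [inv_smul_eq_iff, h]

/-- fixing lemma -/
lemma g_fix (g : GG F) (v : EE F) (h1 : ∀ j, (v j).1 ≠ 0 → g • (e j : EE F) = e j) (h2 : ∀ j, (v j).2 ≠ 0 → g • (f j : EE F) = f j) :
    g • v = v := by
  have : ∀ j, g • (single j (v j) : EE F) = single j (v j) := by
    intro j
    have hs : (single j (v j) : EE F) = (v j).1 • e j + (v j).2 • f j := by
      rw [e, f, smul_single, smul_single, ← single_add]; congr 1
      ext <;> simp
    rw [hs, g_add, g_smul, g_smul]
    congr 1
    · by_cases h : (v j).1 = 0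
      · rw [h, zero_smul, zero_smul]
      · rw [h1 j h]
    · by_cases h : (v j).2 = 0
      · rw [h, zero_smul, zero_smul]
      · rw [h2 j h]
  conv_lhs => rw [← Finsupp.sum_single v]
  conv_rhs => rw [← Finsupp.sum_single v]
  show g.1 (v.sum single) = _
  rw [Finsupp.sum, map_sum]
  exact Finset.sum_congr rfl (fun j _ => this j)

lemma g_ext_basis {g h : GG F} (h1 : ∀ j, g • (e j : EE F) = h • e j) (h2 : ∀ j, g • (f j : EE F) = h • f j) : g = h := by
  apply g_ext
  intro v
  have := g_fix (h⁻¹ * g) v (fun j _ => by rw [mul_smul, h1, inv_smul_smul]) (fun j _ => by rw [mul_smul, h2, inv_smul_smul])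
  rw [mul_smul, inv_smul_eq_iff] at this
  exact this

variable (F) in
/-- the groups Γ(A,B) -/
def Ga (A B : Finset ℕ) : Subgroup (GG F) where
  carrier := {g | (∀ j, j ∉ A → g • (e j : EE F) = e j) ∧ ∀ j, j ∉ A → j ∉ B → g • (f j : EE F) = f j}
  one_mem' := ⟨fun _ _ => one_smul _ _, fun _ _ _ => one_smul _ _⟩
  mul_mem' := fun {a b} ha hb => ⟨fun j hj => by rw [mul_smul, hb.1 j hj, ha.1 j hj],
    fun j hj hj' => by rw [mul_smul, hb.2 j hj hj', ha.2 j hj hj']⟩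
  inv_mem' := fun {a} ha => ⟨fun j hj => g_inv_fix (ha.1 j hj), fun j hj hj' => g_inv_fix (ha.2 j hj hj')⟩

lemma mem_Ga {A B : Finset ℕ} {g : GG F} : g ∈ Ga F A B ↔ (∀ j, j ∉ A → g • (e j : EE F) = e j) ∧ ∀ j, j ∉ A → j ∉ B → g • (f j : EE F) = f j := Iff.rfl

lemma Ga_mono {A B A' B' : Finset ℕ} (hA : A ⊆ A') (hB : B ⊆ A' ∪ B') : Ga F A B ≤ Ga F A' B' := by
  rintro g ⟨h1, h2⟩
  refine ⟨fun j hj => h1 j (fun h => hj (hA h)), fun j hj hj' => h2 j (fun h => hj (hA h)) (fun h => ?_)⟩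
  rcases Finset.mem_union.mp (hB h) with h | h
  · exact hj h
  · exact hj' h

variable (F) in
def Va (A B : Finset ℕ) : Submodule F (EE F) where
  carrier := {v | (∀ j, j ∉ A → (v j).2 = 0) ∧ ∀ j, j ∉ A → j ∉ B → (v j).1 = 0}
  add_mem' := fun {v w} hv hw => ⟨fun j hj => by simp [hv.1 j hj, hw.1 j hj], fun j hj hj' => by simp [hv.2 j hj hj', hw.2 j hj hj']⟩
  zero_mem' := ⟨fun _ _ => rfl, fun _ _ _ => rfl⟩
  smul_mem' := fun c v hv => ⟨fun j hj => by simp [hv.1 j hj], fun j hj hj' => by simp [hv.2 j hj hj']⟩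

lemma mem_Va {A B : Finset ℕ} {v : EE F} : v ∈ Va F A B ↔ (∀ j, j ∉ A → (v j).2 = 0) ∧ ∀ j, j ∉ A → j ∉ B → (v j).1 = 0 := Iff.rfl

lemma Va_mono {A B A' B' : Finset ℕ} (hA : A ⊆ A') (hB : B ⊆ A' ∪ B') : Va F A B ≤ Va F A' B' := by
  rintro g ⟨h1, h2⟩
  refine ⟨fun j hj => h1 j (fun h => hj (hA h)), fun j hj hj' => h2 j (fun h => hj (hA h)) (fun h => ?_)⟩
  rcases Finset.mem_union.mp (hB h) with h | h
  · exact hj h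
  · exact hj' h

lemma e_Va {A B : Finset ℕ} {i : ℕ} (h : i ∈ A ∨ i ∈ B) : (e i : EE F) ∈ Va F A B := by
  refine ⟨fun j _ => e_snd i j, fun j hj hj' => e_fst_ne ?_⟩
  rintro rfl; tauto
lemma f_Va {A B : Finset ℕ} {i : ℕ} (h : i ∈ A) : (f i : EE F) ∈ Va F A B := by
  refine ⟨fun j hj => f_snd_ne ?_, fun j hj hj' => f_fst i j⟩
  rintro rfl; exact hj h

/-- group preserves V if it fixes the complement vectors -/
lemma Va_inv {A B : Finset ℕ} {g : GG F} (h1 : ∀ j, j ∉ A → g • (e j : EE F) = e j) (h2 : ∀ j, j ∉ A → j ∉ B → g • (f j : EE F) = f j)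
    {v : EE F} (hv : v ∈ Va F A B) : g • v ∈ Va F A B := by
  refine ⟨fun j hj => ?_, fun j hj hj' => ?_⟩
  · rw [← be_e]
    have := g_be g v (e j)
    rw [h1 j hj] at this
    rw [this, be_e, hv.1 j hj]
  · rw [← be_f]
    have := g_be g v (f j)
    rw [h2 j hj hj'] at this
    rw [this, be_f, hv.2 j hj hj']
lemma Ga_Va {A B : Finset ℕ} {g : GG F} (hg : g ∈ Ga F A B) {v : EE F} (hv : v ∈ Va F A B) : g • v ∈ Va F A B :=
  Va_inv hg.1 hg.2 hv

lemma hyp_Va (A B : Finset ℕ) (hAB : Disjoint A B) : hyp (qF F) A.card (Va F A B) := by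
  induction A using Finset.induction_on with
  | empty => trivial
  | insert i A hi ih =>
    rw [Finset.card_insert_of_notMem hi]
    have hiB : i ∉ B := Finset.disjoint_left.mp hAB (Finset.mem_insert_self i A)
    refine ⟨e i, e_Va (Or.inl (Finset.mem_insert_self i A)), f i, f_Va (Finset.mem_insert_self i A), Q_e i, Q_f i,
      by rw [be_f, e_self], ?_⟩
    refine hyp_mono _ (ih (Finset.disjoint_of_subset_left (Finset.subset_insert i A) hAB)) ?_
    intro v hv
    refine ⟨Va_mono (Finset.subset_insert i A) Finset.subset_union_right hv, ?_⟩
    intro z hz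
    rcases List.mem_cons.mp hz with rfl | hz
    · rw [be_comm, be_e]; exact hv.1 i hi
    · rw [List.mem_singleton.mp hz, be_comm, be_f]; exact hv.2 i hi hiB

lemma radz_Va (A B : Finset ℕ) : radz (qF F) (Va F A B) := by
  intro x hx h
  have h1 : ∀ j, (x j).2 = 0 := by
    intro j
    by_cases hj : j ∈ A
    · rw [← be_e]; exact h _ (e_Va (Or.inl hj))
    · exact hx.1 j hj
  rw [qF_apply]
  have : bF F x = 0 ∨ True := Or.inr trivial
  have h2 : ∀ v : EE F, bF F v x = 0 := by
    intro v
    induction v using Finsupp.induction_linear with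
    | zero => simp
    | add f g hf hg => rw [map_add, LinearMap.add_apply, hf, hg, add_zero]
    | single j r => rw [bF_single, h1, mul_zero]
  exact h2 x

/-- making group elements -/
noncomputable def mkG (T S : EE F →ₗ[F] EE F) (h1 : ∀ v, S (T v) = v) (h2 : ∀ v, T (S v) = v) (hQ : ∀ v, qF F (T v) = qF F v) : GG F :=
  ⟨LinearEquiv.ofLinear T S (LinearMap.ext h2) (LinearMap.ext h1), hQ⟩
lemma mkG_smul (T S : EE F →ₗ[F] EE F) (h1 : ∀ v, S (T v) = v) (h2 : ∀ v, T (S v) = v) (hQ : ∀ v, qF F (T v) = qF F v) (v : EE F) :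
    mkG T S h1 h2 hQ • v = T v := rfl

lemma refl_exists (v : EE F) (hv : qF F v ≠ 0) : ∃ g : GG F, ∀ x : EE F, g • x = x - ((qF F v)⁻¹ * be (qF F) x v) • v := by
  let T : EE F →ₗ[F] EE F := LinearMap.id - ((qF F v)⁻¹ • (be (qF F)).flip v).smulRight v
  have hT : ∀ x, T x = x - ((qF F v)⁻¹ * be (qF F) x v) • v := by
    intro x; simp [T]
  have hTT : ∀ x, T (T x) = x := by
    intro x
    rw [hT (T x), hT x]
    simp only [map_sub, map_smul, LinearMap.sub_apply, LinearMap.smul_apply, be_self, smul_eq_mul]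
    have : (qF F v)⁻¹ * (be (qF F) x v - (qF F v)⁻¹ * be (qF F) x v * (2 * qF F v)) = - ((qF F v)⁻¹ * be (qF F) x v) := by
      field_simp; ring
    rw [this]; simp
  refine ⟨mkG T T hTT hTT ?_, fun x => by rw [mkG_smul, hT]⟩
  intro x
  rw [hT, Q_sub, Q_smul, map_smul, smul_eq_mul]
  field_simp; ring

lemma refl_Ga {A B : Finset ℕ} (hAB : Disjoint A B) {v : EE F} (hv : v ∈ Va F A B) {g : GG F} (c : EE F → F)
    (hg : ∀ x : EE F, g • x = x - (c x * be (qF F) x v) • v) : g ∈ Ga F A B := by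
  refine ⟨fun j hj => ?_, fun j hj hj' => ?_⟩
  · rw [hg, be_comm, be_e, hv.1 j hj]; simp
  · rw [hg, be_comm, be_f, hv.2 j hj hj']; simp

/-- moving isotropic vectors -/
lemma move1 {A B : Finset ℕ} (hAB : Disjoint A B) {u t : EE F} (hu : u ∈ Va F A B) (ht : t ∈ Va F A B) (hQu : qF F u = 0) (hQt : qF F t = 0)
    (h : be (qF F) u t ≠ 0) : ∃ g ∈ Ga F A B, g • u = t := by
  have hQ : qF F (u - t) = - be (qF F) u t := by rw [Q_sub, hQu, hQt]; ring
  obtain ⟨g, hg⟩ := refl_exists (u - t) (by rw [hQ]; exact neg_ne_zero.mpr h)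
  refine ⟨g, refl_Ga hAB (Submodule.sub_mem _ hu ht) (fun _ => (qF F (u - t))⁻¹) hg, ?_⟩
  rw [hg, hQ, map_sub, be_self0 _ hQu]
  have : (-(be (qF F)) u t)⁻¹ * (0 - (be (qF F)) u t) = 1 := by field_simp; ring
  rw [this]; simp

lemma move {A B : Finset ℕ} (hAB : Disjoint A B) {u : EE F} (hu : u ∈ Va F A B) (hQu : qF F u = 0) (hne : ∃ j ∈ A, u j ≠ 0) {i : ℕ} (hi : i ∈ A) :
    ∃ g ∈ Ga F A B, g • u = e i := by
  have hei : (e i : EE F) ∈ Va F A B := e_Va (Or.inl hi)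
  by_cases h1 : be (qF F) u (e i) ≠ 0
  · exact move1 hAB hu hei hQu (Q_e i) h1
  push Not at h1
  suffices ∃ t ∈ Va F A B, qF F t = 0 ∧ be (qF F) u t ≠ 0 ∧ be (qF F) t (e i) ≠ 0 by
    obtain ⟨t, ht, hQt, h2, h3⟩ := this
    obtain ⟨g, hg, h4⟩ := move1 hAB hu ht hQu hQt h2
    obtain ⟨g', hg', h5⟩ := move1 hAB ht hei hQt (Q_e i) h3
    exact ⟨g' * g, Subgroup.mul_mem _ hg' hg, by rw [mul_smul, h4, h5]⟩
  by_cases h2 : be (qF F) u (f i) ≠ 0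
  · exact ⟨f i, f_Va hi, Q_f i, h2, by rw [be_e, f_self]; simp⟩
  push Not at h2
  obtain ⟨j, hj, hu⟩ := hne
  have hij : j ≠ i := by
    rintro rfl
    apply hu
    rw [be_e] at h1; rw [be_f] at h2
    exact Prod.ext h2 h1
  by_cases h3 : (u j).1 = 0
  · have h4 : (u j).2 ≠ 0 := fun h => hu (Prod.ext h3 h)
    refine ⟨f i + e j, Submodule.add_mem _ (f_Va hi) (e_Va (Or.inl hj)), ?_, ?_, ?_⟩
    · rw [Q_add, Q_f, Q_e, be_e, f_snd_ne hij]; simp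
    · rw [map_add, h2, be_e]; simpa using h4
    · rw [be_e]; simp [f_self, e_snd]
  · refine ⟨f i + f j, Submodule.add_mem _ (f_Va hi) (f_Va hj), ?_, ?_, ?_⟩
    · rw [Q_add, Q_f, Q_f, be_f, f_fst]; simp
    · rw [map_add, h2, be_f]; simpa using h3
    · rw [be_e]; simp [f_self, f_snd_ne hij.symm]

/-- torus -/
lemma torus_exists (i : ℕ) (x : F) (hx : x ≠ 0) : ∃ g ∈ Ga F {i} ∅, g • (e i : EE F) = x • e i ∧ g • (f i : EE F) = x⁻¹ • f i := by
  have hd : Disjoint ({i} : Finset ℕ) ∅ := Finset.disjoint_empty_right _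
  have hi : i ∈ ({i} : Finset ℕ) := Finset.mem_singleton_self i
  have key : ∀ y : F, y ≠ 0 → ∃ g ∈ Ga F {i} ∅, g • (e i : EE F) = y • f i ∧ g • (f i : EE F) = y⁻¹ • e i := by
    intro y hy
    have hQ : qF F (e i - y • f i) = - y := by
      rw [Q_sub, Q_smul, Q_e, Q_f, map_smul, be_f, e_self]; simp
    obtain ⟨g, hg⟩ := refl_exists (e i - y • f i : EE F) (by rw [hQ]; exact neg_ne_zero.mpr hy)
    have hv : (e i - y • f i : EE F) ∈ Va F {i} ∅ := Submodule.sub_mem _ (e_Va (Or.inl hi)) (Submodule.smul_mem _ _ (f_Va hi))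
    refine ⟨g, refl_Ga hd hv (fun _ => (qF F (e i - y • f i))⁻¹) hg, ?_, ?_⟩
    · rw [hg, hQ, map_sub, map_smul, be_e, be_f, e_self]
      have : (-y)⁻¹ * ((1, (0:F)).2 - y • ((1:F), (0:F)).1) = 1 := by simp; field_simp
      rw [this]; simp
    · rw [hg, hQ, map_sub, map_smul, be_e, be_f, f_self]
      have : (-y)⁻¹ * (((0:F), (1:F)).2 - y • ((0:F), (1:F)).1) = - y⁻¹ := by simp
      rw [this, smul_sub, smul_smul]
      have : -y⁻¹ * y = -1 := by field_simp
      rw [this]; simp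
  obtain ⟨g, hg, h1, h2⟩ := key x hx
  obtain ⟨g', hg', h1', h2'⟩ := key 1 one_ne_zero
  refine ⟨g' * g, Subgroup.mul_mem _ hg' hg, ?_, ?_⟩
  · rw [mul_smul, h1, g_smul, h2']; simp
  · rw [mul_smul, h2, g_smul, h1']; simp

/-- Eichler transformation -/
lemma eich_exists (z u : EE F) (hz : qF F z = 0) (hzu : be (qF F) z u = 0) :
    ∃ g : GG F, ∀ x : EE F, g • x = x + be (qF F) x z • u - (be (qF F) x u + qF F u * be (qF F) x z) • z := by
  have key : ∀ u : EE F, ∃ T : EE F →ₗ[F] EE F, ∀ x, T x = x + be (qF F) x z • u - (be (qF F) x u + qF F u * be (qF F) x z) • z := by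
    intro u
    refine ⟨LinearMap.id + ((be (qF F)).flip z).smulRight u - ((be (qF F)).flip u + qF F u • (be (qF F)).flip z).smulRight z, ?_⟩
    intro x; simp
  obtain ⟨T, hT⟩ := key u
  obtain ⟨S, hS⟩ := key (-u)
  have hzz := be_self0 (qF F) hz
  have huz : be (qF F) u z = 0 := by rw [be_comm]; exact hzu
  have huu := be_self (qF F) u
  have h1 : ∀ v, S (T v) = v := by
    intro x
    rw [hS, Q_neg, hT]
    simp only [map_add, map_sub, map_smul, LinearMap.add_apply, LinearMap.sub_apply, LinearMap.smul_apply, smul_eq_mul, map_neg, hzz, huz, hzu, huu]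
    module
  have h2 : ∀ v, T (S v) = v := by
    intro x
    rw [hT, hS, Q_neg]
    simp only [map_add, map_sub, map_smul, LinearMap.add_apply, LinearMap.sub_apply, LinearMap.smul_apply, smul_eq_mul, map_neg, LinearMap.neg_apply, hzz, huz, hzu, huu]
    module
  refine ⟨mkG T S h1 h2 ?_, fun x => by rw [mkG_smul, hT]⟩
  intro x
  rw [hT, Q_sub, Q_add, Q_smul, Q_smul, hz]
  simp only [map_add, map_smul, LinearMap.add_apply, LinearMap.smul_apply, smul_eq_mul, huz]
  ring

/-- commuting -/
lemma comm_Ga {S : Finset ℕ} {g k : GG F} (hg : g ∈ Ga F S ∅) (hk1 : ∀ j ∈ S, k • (e j : EE F) = e j) (hk2 : ∀ j ∈ S, k • (f j : EE F) = f j) :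
    g * k = k * g := by
  have hd : ∀ v : EE F, (∀ j ∈ S, v j = 0) → g • v = v := by
    intro v hv
    refine g_fix g v (fun j hj => hg.1 j ?_) (fun j hj => hg.2 j ?_ (by simp))
    · intro h; rw [hv j h] at hj; exact hj rfl
    · intro h; rw [hv j h] at hj; exact hj rfl
  have hd2 : ∀ v : EE F, (∀ j, j ∉ S → v j = 0) → k • v = v := by
    intro v hv
    refine g_fix k v (fun j hj => hk1 j ?_) (fun j hj => hk2 j ?_)
    · by_contra h; rw [hv j h] at hj; exact hj rfl
    · by_contra h; rw [hv j h] at hj; exact hj rfl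
  have hV : ∀ v ∈ Va F S ∅, k • v = v := fun v hv => hd2 v (fun j hj => Prod.ext (hv.2 j hj (by simp)) (hv.1 j hj))
  have hV2 : ∀ v : EE F, (∀ j ∈ S, v j = 0) → ∀ j ∈ S, (k • v) j = 0 := by
    intro v hv j hj
    refine Prod.ext ?_ ?_
    · rw [← be_f]
      have := g_be k v (f j)
      rw [hk2 j hj] at this
      rw [this, be_f, hv j hj]
    · rw [← be_e]
      have := g_be k v (e j)
      rw [hk1 j hj] at this
      rw [this, be_e, hv j hj]
  apply g_ext_basis
  · intro j
    rw [mul_smul, mul_smul]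
    by_cases hj : j ∈ S
    · rw [hk1 j hj, hV _ (Ga_Va hg (e_Va (Or.inl hj)))]
    · rw [hg.1 j hj]
      exact hd _ (hV2 _ (fun i hi => e_ne (by rintro rfl; exact hj hi)))
  · intro j
    rw [mul_smul, mul_smul]
    by_cases hj : j ∈ S
    · rw [hk2 j hj, hV _ (Ga_Va hg (f_Va hj))]
    · rw [hg.2 j hj (by simp)]
      exact hd _ (hV2 _ (fun i hi => f_ne (by rintro rfl; exact hj hi)))

end ambient
end HS

set_option linter.all false
namespace HS
open Finsupp
section nf
variable {F : Type} [Field F]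

lemma fixV {C : Finset ℕ} {g : GG F} (hg : ∀ j ∈ C, g • (e j : EE F) = e j) {v : EE F} (hv : v ∈ Va F ∅ C) : g • v = v := by
  refine g_fix g v (fun j hj => hg j ?_) (fun j hj => absurd (hv.1 j (by simp)) hj)
  by_contra h; exact hj (hv.2 j (by simp) h)

/-- the span of a list and e_B -/
noncomputable def SB (B : Finset ℕ) (L : List (EE F)) : Submodule F (EE F) :=
  Submodule.span F ({x | x ∈ L} ∪ {x | ∃ b ∈ B, x = e b})

lemma SB_fix {B : Finset ℕ} {L : List (EE F)} {g : GG F} (h1 : ∀ j ∈ B, g • (e j : EE F) = e j) (h2 : ∀ v ∈ L, g • v = v)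
    {x : EE F} (hx : x ∈ SB B L) : g • x = x := by
  have : SB B L ≤ LinearMap.eqLocus (g.1 : EE F ≃ₗ[F] EE F).toLinearMap LinearMap.id := by
    refine Submodule.span_le.mpr ?_
    rintro x (hx | ⟨b, hb, rfl⟩)
    · exact h2 x hx
    · exact h1 b hb
  exact this hx

lemma SB_orth {B : Finset ℕ} {L : List (EE F)} {v : EE F} (h1 : ∀ j ∈ B, (v j).2 = 0) (h2 : ∀ w ∈ L, be (qF F) v w = 0)
    {x : EE F} (hx : x ∈ SB B L) : be (qF F) v x = 0 := by
  have : SB B L ≤ LinearMap.ker (be (qF F) v) := by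
    refine Submodule.span_le.mpr ?_
    rintro x (hx | ⟨b, hb, rfl⟩)
    · exact h2 x hx
    · show be (qF F) v (e b) = 0
      rw [be_e]; exact h1 b hb
  exact this hx

lemma SB_mono {B : Finset ℕ} {L L' : List (EE F)} (h : ∀ x ∈ L, x ∈ L') : SB B L ≤ SB B L' := by
  refine Submodule.span_mono ?_
  rintro x (hx | hx)
  · exact Or.inl (h x hx)
  · exact Or.inr hx

lemma gw_mem {G Ω : Type} [Group G] [MulAction G Ω] {g : G} {L : List Ω} {x : Ω} (hx : x ∈ L) : g • x ∈ gw g L := List.mem_map_of_mem hx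
lemma gw_forall {G Ω : Type} [Group G] [MulAction G Ω] {g : G} {L : List Ω} {P : Ω → Prop} (h : ∀ x ∈ L, P (g • x)) : ∀ y ∈ gw g L, P y := by
  intro y hy
  obtain ⟨x, hx, rfl⟩ := List.mem_map.mp hy
  exact h x hx
lemma gw_congr {G Ω : Type} [Group G] [MulAction G Ω] {g h : G} {L : List Ω} (H : ∀ x ∈ L, g • x = h • x) : gw g L = gw h L :=
  List.map_congr_left H
lemma gw_fix {G Ω : Type} [Group G] [MulAction G Ω] {g : G} {L : List Ω} (H : ∀ x ∈ L, g • x = x) : gw g L = L := by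
  conv_rhs => rw [← List.map_id L]
  exact List.map_congr_left H
lemma gw_fix' {G Ω : Type} [Group G] [MulAction G Ω] {g : G} {L : List Ω} (H : gw g L = L) : ∀ x ∈ L, g • x = x := by
  intro x hx
  have h2 : L.map (fun x => g • x) = L.map id := by rw [List.map_id]; exact H
  exact List.map_inj_left.mp h2 x hx

lemma Va_sdiff {A B S : Finset ℕ} {v : EE F} (hv : v ∈ Va F A B) (h : ∀ j ∈ S, (v j).2 = 0) : v ∈ Va F (A \ S) (B ∪ S) := by
  refine ⟨fun j hj => ?_, fun j hj hj' => ?_⟩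
  · by_cases h1 : j ∈ A
    · exact h j (by by_contra h2; exact hj (Finset.mem_sdiff.mpr ⟨h1, h2⟩))
    · exact hv.1 j h1
  · have : j ∉ S := fun h => hj' (Finset.mem_union_right _ h)
    exact hv.2 j (fun h => hj (Finset.mem_sdiff.mpr ⟨h, this⟩)) (fun h => hj' (Finset.mem_union_left _ h))

lemma Va_empty {A B : Finset ℕ} {v : EE F} (hv : v ∈ Va F A B) (h : ∀ j ∈ A, v j = 0) : v ∈ Va F ∅ B := by
  refine ⟨fun j _ => ?_, fun j _ hj' => ?_⟩
  · by_cases h1 : j ∈ A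
    · rw [h j h1]; rfl
    · exact hv.1 j h1
  · by_cases h1 : j ∈ A
    · rw [h j h1]; rfl
    · exact hv.2 j h1 hj'

lemma dj_sdiff {A B S : Finset ℕ} (h : Disjoint A B) : Disjoint (A \ S) (B ∪ S) := by
  rw [Finset.disjoint_left] at *
  intro x hx hx'
  simp only [Finset.mem_sdiff, Finset.mem_union] at hx hx'
  have := h hx.1
  tauto

lemma Ga_sdiff {A B S : Finset ℕ} (hS : S ⊆ A) : Ga F (A \ S) (B ∪ S) ≤ Ga F A B :=
  Ga_mono Finset.sdiff_subset (by intro x hx; rcases Finset.mem_union.mp hx with h | h; exacts [Finset.mem_union_right _ h, Finset.mem_union_left _ (hS h)])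

set_option maxHeartbeats 1000000 in
lemma NF {A B : Finset ℕ} (hAB : Disjoint A B) (a : ℕ) (L : List (EE F)) (hL : L ∈ IL (qF F) (fun x => x ∈ Va F A B)) :
    ∃ h ∈ Ga F A B, ∃ S ⊆ A, S.card ≤ L.length ∧ (∀ v ∈ gw h L, v ∈ Va F ∅ (B ∪ S)) ∧
      (∀ j ∈ S, (e j : EE F) ∈ SB B (gw h L)) ∧
      (S.card = L.length → ∃ is : List ℕ, is.Nodup ∧ is.toFinset = S ∧ gw h L = is.map e) ∧ (a ∈ S → S = A) := by
  induction L with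
  | nil => exact ⟨1, Subgroup.one_mem _, ∅, by simp, by simp, by simp, by simp, fun _ => ⟨[], by simp⟩, by simp⟩
  | cons v L ih =>
    obtain ⟨h, hh, S, hS, hc, h1, h2, h3, h4⟩ := ih ((IL_FC _ _) _ hL _ (List.sublist_cons_self v L))
    have hv := hL.1 v (by simp)
    have hv1 : h • v ∈ Va F A B := Ga_Va hh hv.1
    have hvS : ∀ j ∈ S, ((h • v) j).2 = 0 := by
      intro j hj
      rw [← be_e]
      refine SB_orth (B := B) (L := gw h L) ?_ ?_ (h2 j hj)
      · intro j hj; exact hv1.1 j (Finset.disjoint_right.mp hAB hj)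
      · refine gw_forall fun x hx => ?_
        rw [g_be]; exact hL.2 _ (by simp) _ (by simp [hx])
    have hv2 := Va_sdiff hv1 hvS
    by_cases hz : ∀ j ∈ A \ S, (h • v) j = 0
    · refine ⟨h, hh, S, hS, by simp; omega, ?_, ?_, ?_, h4⟩
      · intro x hx
        rcases List.mem_cons.mp hx with rfl | hx
        · exact Va_empty hv2 hz
        · exact h1 x hx
      · intro j hj; exact SB_mono (fun x hx => List.mem_cons_of_mem _ hx) (h2 j hj)
      · intro hl; simp at hl; omega
    · push Not at hz
      obtain ⟨j, hj, hjz⟩ := hz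
      obtain ⟨i, hi, hia⟩ : ∃ i ∈ A \ S, i = a → A \ S = {a} := by
        by_cases H : ∃ i ∈ A \ S, i ≠ a
        · obtain ⟨i, hi, h⟩ := H
          exact ⟨i, hi, fun h' => absurd h' h⟩
        · push Not at H
          refine ⟨j, hj, fun _ => ?_⟩
          ext x; rw [Finset.mem_singleton]
          exact ⟨H x, fun hx => by rw [hx, ← H j hj]; exact hj⟩
      obtain ⟨m, hm, hme⟩ := move (dj_sdiff hAB) hv2 (by rw [g_Q]; exact hv.2) ⟨j, hj, hjz⟩ hi
      have hmfix : ∀ x ∈ gw h L, m • x = x := fun x hx => fixV (fun j hj => hm.1 j (Finset.disjoint_right.mp (dj_sdiff hAB) hj)) (h1 x hx)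
      have hgw : gw (m * h) (v :: L) = e i :: gw h L := by
        rw [gw_mul, gw, gw, List.map_cons, List.map_cons, hme]
        congr 1
        exact gw_fix hmfix
      have hiS : i ∉ S := (Finset.mem_sdiff.mp hi).2
      have hiA : i ∈ A := (Finset.mem_sdiff.mp hi).1
      refine ⟨m * h, Subgroup.mul_mem _ (Ga_sdiff hS hm) hh, insert i S, Finset.insert_subset hiA hS, ?_, ?_, ?_, ?_, ?_⟩
      · rw [Finset.card_insert_of_notMem hiS, List.length_cons]; omega
      · rw [hgw]
        intro x hx
        rcases List.mem_cons.mp hx with rfl | hx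
        · exact e_Va (Or.inr (by simp))
        · refine Va_mono (by rfl) ?_ (h1 x hx)
          intro y hy; simp at hy ⊢; tauto
      · rw [hgw]
        intro k hk
        rcases Finset.mem_insert.mp hk with rfl | hk
        · exact Submodule.subset_span (Or.inl (by simp))
        · exact SB_mono (fun x hx => List.mem_cons_of_mem _ hx) (h2 k hk)
      · intro hl
        rw [Finset.card_insert_of_notMem hiS, List.length_cons] at hl
        obtain ⟨is, hn, hf, he⟩ := h3 (by omega)
        refine ⟨i :: is, ?_, by simp [hf], by rw [hgw, he]; rfl⟩
        rw [List.nodup_cons]; refine ⟨?_, hn⟩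
        intro hmem; apply hiS; rw [← hf]; simpa using hmem
      · intro ha
        rcases Finset.mem_insert.mp ha with rfl | ha
        · have := hia rfl
          ext x
          constructor
          · exact fun hx => Finset.insert_subset hiA hS hx
          · intro hx
            by_cases hxS : x ∈ S
            · exact Finset.mem_insert_of_mem hxS
            · have : x ∈ A \ S := Finset.mem_sdiff.mpr ⟨hx, hxS⟩
              rw [hia rfl] at this
              rw [Finset.mem_singleton.mp this]; exact Finset.mem_insert_self _ _
        · exact absurd (h4 ha ▸ hiA) hiS

lemma gw_IL {P : EE F → Prop} {g : GG F} (hP : ∀ x, P x → P (g • x)) {L : List (EE F)} (hL : L ∈ IL (qF F) P) : gw g L ∈ IL (qF F) P := by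
  refine ⟨gw_forall fun x hx => ⟨hP x (hL.1 x hx).1, by rw [g_Q]; exact (hL.1 x hx).2⟩, gw_forall fun x hx => gw_forall fun y hy => by rw [g_be]; exact hL.2 x hx y hy⟩

set_option maxHeartbeats 1000000 in
lemma ORB {A B : Finset ℕ} (hAB : Disjoint A B) (L : List (EE F)) (g' : GG F) (hB : ∀ j ∈ B, g' • (e j : EE F) = e j)
    (hL : L ∈ IL (qF F) (fun x => x ∈ Va F A B)) (hM : gw g' L ∈ IL (qF F) (fun x => x ∈ Va F A B)) :
    ∃ g ∈ Ga F A B, gw g L = gw g' L := by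
  induction L with
  | nil => exact ⟨1, Subgroup.one_mem _, rfl⟩
  | cons v L ih =>
    have hL0 := (IL_FC _ _) _ hL _ (List.sublist_cons_self v L)
    have hM0 := (IL_FC _ _) _ hM _ (List.sublist_cons_self _ (gw g' L))
    obtain ⟨g0, hg0, h0⟩ := ih hL0 hM0
    obtain ⟨h, hh, S, hS, -, h1, h2, -, -⟩ := NF hAB 0 (gw g' L) hM0
    have hBA : ∀ j ∈ B, j ∉ A := fun j hj => Finset.disjoint_right.mp hAB hj
    have hv := hL.1 v (by simp)
    have hw := hM.1 (g' • v) (by simp)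
    have hv1 : h • g0 • v ∈ Va F A B := Ga_Va hh (Ga_Va hg0 hv.1)
    have hw1 : h • g' • v ∈ Va F A B := Ga_Va hh hw.1
    have horth : ∀ x ∈ gw h (gw g' L), be (qF F) (h • g0 • v) x = 0 ∧ be (qF F) (h • g' • v) x = 0 := by
      intro x hx
      constructor
      · revert x
        rw [← h0]
        refine gw_forall (gw_forall fun x hx => ?_)
        rw [g_be, g_be]; exact hL.2 _ (by simp) _ (by simp [hx])
      · revert x
        refine gw_forall (gw_forall fun x hx => ?_)
        rw [g_be, g_be]; exact hL.2 _ (by simp) _ (by simp [hx])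
    have hv2 := Va_sdiff (S := S) hv1 (fun j hj => by
      rw [← be_e]
      exact SB_orth (B := B) (fun j hj => hv1.1 j (hBA j hj)) (fun x hx => (horth x hx).1) (h2 j hj))
    have hw2 := Va_sdiff (S := S) hw1 (fun j hj => by
      rw [← be_e]
      exact SB_orth (B := B) (fun j hj => hw1.1 j (hBA j hj)) (fun x hx => (horth x hx).2) (h2 j hj))
    -- the transporter
    set t : GG F := h * g' * g0⁻¹ * h⁻¹ with ht
    have ht1 : t • h • g0 • v = h • g' • v := by simp [ht, mul_smul]
    have htB : ∀ j ∈ B, t • (e j : EE F) = e j := by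
      intro j hj
      rw [ht, mul_smul, mul_smul, mul_smul, g_inv_fix (hh.1 j (hBA j hj)), g_inv_fix (hg0.1 j (hBA j hj)), hB j hj, hh.1 j (hBA j hj)]
    have htL : ∀ x ∈ gw h (gw g' L), t • x = x := by
      have : ∀ x ∈ L, g0 • x = g' • x := List.map_inj_left.mp h0
      refine gw_forall (gw_forall fun x hx => ?_)
      rw [← this x hx, ht]
      simp only [mul_smul, inv_smul_smul]
      rw [this x hx]
    have htS : ∀ j ∈ B ∪ S, t • (e j : EE F) = e j := by
      intro j hj
      rcases Finset.mem_union.mp hj with hj | hj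
      · exact htB j hj
      · exact SB_fix htB htL (h2 j hj)
    by_cases hz : ∀ j ∈ A \ S, (h • g0 • v) j = 0
    · have : h • g0 • v = h • g' • v := by rw [← ht1, fixV htS (Va_empty hv2 hz)]
      refine ⟨g0, hg0, ?_⟩
      show g0 • v :: gw g0 L = _
      rw [h0, smul_left_cancel _ this]; rfl
    by_cases hz' : ∀ j ∈ A \ S, (h • g' • v) j = 0
    · have : h • g0 • v = h • g' • v := by
        have h5 := fixV htS (Va_empty hw2 hz')
        have h6 := g_inv_fix h5
        rw [← ht1, inv_smul_smul, ht1] at h6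
        exact h6
      refine ⟨g0, hg0, ?_⟩
      show g0 • v :: gw g0 L = _
      rw [h0, smul_left_cancel _ this]; rfl
    push Not at hz hz'
    obtain ⟨i, hi, hiz⟩ := hz
    obtain ⟨m1, hm1, he1⟩ := move (dj_sdiff hAB) hv2 (by rw [g_Q, g_Q]; exact hv.2) ⟨i, hi, hiz⟩ hi
    obtain ⟨m2, hm2, he2⟩ := move (dj_sdiff hAB) hw2 (by rw [g_Q, g_Q]; exact hv.2) hz' hi
    have hfix : ∀ m ∈ Ga F (A \ S) (B ∪ S), ∀ x ∈ gw h (gw g' L), m • x = x := fun m hm x hx =>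
      fixV (fun j hj => hm.1 j (Finset.disjoint_right.mp (dj_sdiff hAB) hj)) (h1 x hx)
    refine ⟨h⁻¹ * m2⁻¹ * m1 * h * g0, ?_, ?_⟩
    · exact Subgroup.mul_mem _ (Subgroup.mul_mem _ (Subgroup.mul_mem _ (Subgroup.mul_mem _ (Subgroup.inv_mem _ hh) (Subgroup.inv_mem _ (Ga_sdiff hS hm2))) (Ga_sdiff hS hm1)) hh) hg0
    · show _ :: gw _ L = _ :: gw g' L
      congr 1
      · simp only [mul_smul]
        rw [he1, ← he2, inv_smul_smul, inv_smul_smul]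
      · rw [gw_mul, h0, gw_mul, gw_mul, gw_mul, gw_fix (hfix m1 hm1), gw_fix (hfix _ (Subgroup.inv_mem _ hm2)), ← gw_mul, inv_mul_cancel, gw_one]
end nf
end HS

set_option linter.all false
namespace HS
open Finsupp
section gen
variable {G Ω : Type} [Group G] [MulAction G Ω]

noncomputable def fg : PC G Ω →ₗ[ℤ] LC G := mp (fun p : List G × List Ω => p.1)

lemma fg_in1 (τ : List Ω) (x : LC G) : fg (in1 τ x) = x := by
  refine lhom_congr (f := LinearMap.comp fg (in1 (β := List Ω) τ)) (g := LinearMap.id) ?_ x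
  intro l
  simp [fg, in1]
lemma fg_NN {K : Subgroup G} {x : PC G Ω} (hx : x ∈ NN Ω K) : fg x ∈ N0 K := by
  refine NN_le fg (N0 K) ?_ ?_ x hx
  · intro k hk l σ
    simp only [fg, lx_sg]
    exact N0_gen hk l
  · intro σ
    simp only [fg, lx_sg]
    exact N0_nil

lemma In1_nil (t : Ω) (ω : MC G) : cD2 (In1 [t] ω) = In1 [] ω := by
  have hb : bdL [t] = sg [] := by simp [bdL]
  rw [In1_apply, cD2_apply, bd2_in1, bd2_in1, hb, tn_sg2, tn_sg2, In1_apply]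

lemma D1gen {K' K : Subgroup G} (hKK : K ≤ K') {X' X : Set (List Ω)} (hXX : X ⊆ X') (hF' : FC X') (hF : FC X)
    (hI' : ∀ k ∈ K', ∀ σ ∈ X', gw k σ ∈ X') (hI : ∀ k ∈ K, ∀ σ ∈ X, gw k σ ∈ X) (N : ℕ) (hN : 1 ≤ N)
    (hE' : ∀ k ≤ N, Ex X' k) (hE : ∀ k < N, Ex X k)
    (hZ : ∀ q k, q + (k+1) = N → ∀ w ∈ dg q (lev X' (k+2)) (lev X (k+2)), cD1 w ∈ RR Ω K' K → w ∈ Zs K' K q (lev X' (k+2)) (lev X (k+2)))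
    (t : Ω) (ht : [t] ∈ X) (h1' : ∀ v, [v] ∈ X' → ∃ g ∈ K', g • t = v) (h1 : ∀ v, [v] ∈ X → ∃ g ∈ K, g • t = v)
    (w0 : MC G) (hw0 : w0 ∈ dg0 N) (hc0 : cd w0 ∈ R0 K' K) :
    ∃ ω ∈ dg0 N, cd ω ∈ R0 (St K' [t]) (St K [t]) ∧ w0 - ω ∈ R0 K' K := by
  have hnil : ([] : List Ω) ∈ X := hF _ ht _ (List.nil_sublist _)
  have hnil' := hXX hnil
  have hs : ∀ H : Subgroup G, H ≤ St H ([] : List Ω) := fun H g hg => ⟨hg, rfl⟩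
  obtain ⟨w, hw, hcw, hxw⟩ := SS_app hKK hXX hF' hF hI' hI N hN hE' hE hZ (In1 [] w0)
    (In1_dg (Y' := lev X' 0) (Y := lev X 0) ⟨hnil', rfl⟩ ⟨hnil, rfl⟩ hw0) (by rw [cD1_In1]; exact In1_RR (hs K') (hs K) hc0)
  obtain ⟨s, ω, hs1, hs2⟩ := orbit_lemma hKK (lev_mono hXX 1)
    (fun k hk σ hσ => ⟨hI k hk σ hσ.1, by simpa using hσ.2⟩) (fun k hk σ hσ => ⟨hI' k hk σ hσ.1, by simpa using hσ.2⟩)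
    (fun τ => τ = [t])
    (by
      rintro σ ⟨hσ, hl⟩
      obtain ⟨v, rfl⟩ := List.length_eq_one_iff.mp hl
      obtain ⟨g, hg, hgv⟩ := h1' v hσ
      exact ⟨[t], ⟨ht, rfl⟩, rfl, g, hg, by simp [hgv]⟩)
    (by
      rintro σ ⟨hσ, hl⟩ τ ⟨hτ, hl'⟩ -
      obtain ⟨v, rfl⟩ := List.length_eq_one_iff.mp hl
      obtain ⟨u, rfl⟩ := List.length_eq_one_iff.mp hl'
      obtain ⟨g, hg, hgv⟩ := h1 v hσ
      obtain ⟨k, hk, hku⟩ := h1 u hτ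
      refine ⟨g * k⁻¹, K.mul_mem hg (K.inv_mem hk), ?_⟩
      simp [mul_smul, ← hku, hgv]) N w hw hcw
  refine ⟨∑ τ ∈ s, ω τ, Submodule.sum_mem _ (fun τ h => (hs1 τ h).2.2.1), ?_, ?_⟩
  · rw [map_sum]
    refine Submodule.sum_mem _ (fun τ h => ?_)
    obtain ⟨-, e, -, h3⟩ := hs1 τ h
    exact R0_mono (fun k hk => e ▸ hk) (fun k hk => e ▸ hk) h3
  · have e1 : cD2 (∑ τ ∈ s, In1 τ (ω τ)) = In1 [] (∑ τ ∈ s, ω τ) := by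
      rw [map_sum, map_sum]
      refine Finset.sum_congr rfl (fun τ h => ?_)
      rw [(hs1 τ h).2.1, In1_nil]
    have e2 := cD2_RR hs2
    rw [map_sub, e1] at e2
    have e3 := Submodule.add_mem _ hxw e2
    have e4 : In1 ([] : List Ω) w0 - cD2 w + (cD2 w - In1 [] (∑ τ ∈ s, ω τ)) = In1 [] (w0 - ∑ τ ∈ s, ω τ) := by
      rw [map_sub]; abel
    rw [e4, In1_apply] at e3
    have e5 := fg_NN e3.1
    have e6 := fg_NN e3.2
    rw [fg_in1] at e5 e6
    exact ⟨e5, e6⟩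

end gen

section kill
variable {F : Type} [Field F]

variable (F) in
def BV (q : ℕ) : Prop := ∀ (A B : Finset ℕ) (a : ℕ), Disjoint A B → a ∉ A → a ∉ B → q ≤ A.card → RV (Ga F (insert a A) B) (Ga F A B) q
variable (F) in
def NS (q : ℕ) : Prop := ∀ (A B : Finset ℕ) (a b : ℕ), Disjoint A B → a ∉ A → a ∉ B → b ∉ A → b ∉ B → a ≠ b → q ≤ A.card + 1 →
  RS (Ga F (insert a A) (insert b B)) (Ga F A (insert b B)) (Ga F (insert a A) B) (Ga F A B) q

lemma sub_aux (is' : List ℕ) (hnd : is'.Nodup) (l' : List ℕ) (h : l'.length + 1 = is'.length) : ∃ j ∈ is', j ∉ l' := by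
  by_contra hcon
  push Not at hcon
  have := (hnd.subperm hcon).length_le
  omega

lemma Kill {A1 B1 : Finset ℕ} {a i1 : ℕ} {is' : List ℕ} {x : F} {c δ : EE F} {K' K : Subgroup (GG F)} {Y' Y : Set (List (EE F))} {q : ℕ}
    (hBV : BV F q) (hNS : NS F q) (hq : q ≤ A1.card + 1) (hd : Disjoint A1 B1) (haA : a ∉ A1) (haB : a ∉ B1) (hx : x ≠ 0)
    (hnd : (i1 :: is').Nodup) (hi1 : i1 ∈ B1) (his : ∀ j ∈ is', j ∈ B1) (hKK : K ≤ K')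
    (hK'0 : Ga F (insert a A1) B1 ≤ K') (hK0 : Ga F A1 B1 ≤ K) (hT : Ga F {i1} ∅ ≤ K)
    (hK' : ∀ j ∈ is', Ga F (insert a (insert j A1)) (B1.erase j) ≤ K') (hK : ∀ j ∈ is', Ga F (insert j A1) (B1.erase j) ≤ K)
    (hfix : ∀ g, (g ∈ Ga F {i1} ∅ ∨ g ∈ Ga F (insert a A1) B1 ∨ ∃ j ∈ is', g ∈ Ga F (insert a (insert j A1)) (B1.erase j)) → g • c = c ∧ g • δ = δ)
    (hY' : ∀ l, (∀ y ∈ l, y = c ∨ (∃ t : F, y = c + t • e i1) ∨ ∃ j ∈ is', y = δ + e j) → l.length = 2 + is'.length → l ∈ Y')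
    (hY : ∀ l, (∀ y ∈ l, y = c ∨ (∃ t : F, y = c + t • e i1) ∨ ∃ j ∈ is', y = δ + e j) → l.length = 2 + is'.length → l ∈ Y)
    (ω : MC (GG F)) (hω : ω ∈ dg0 q) (hc : cd ω ∈ R0 (Ga F (insert a A1) B1) (Ga F A1 B1)) :
    In1 ((c + x • e i1) :: (c + e i1) :: is'.map (fun j => δ + e j)) ω ∈ Zs K' K q Y' Y := by
  have hBA : ∀ j ∈ B1, j ∉ A1 := fun j hj => Finset.disjoint_right.mp hd hj
  have hBa : ∀ j ∈ B1, j ≠ a := by rintro j hj rfl; exact haB hj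
  have hi1' : i1 ∉ is' := (List.nodup_cons.mp hnd).1
  have hone : (c + e i1 : EE F) = c + (1 : F) • e i1 := by rw [one_smul]
  have hG : ∀ (A B : Finset ℕ), Ga F A B ≤ Ga F (insert a A) B := fun A B => Ga_mono (Finset.subset_insert _ _) Finset.subset_union_right
  -- fixing everything
  have hfA : ∀ g ∈ Ga F (insert a A1) B1, ∀ y, (y = c ∨ (∃ t : F, y = c + t • e i1) ∨ ∃ j ∈ is', y = δ + e j) → g • y = y := by
    intro g hg y hy
    obtain ⟨h1, h2⟩ := hfix g (Or.inr (Or.inl hg))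
    have h3 : ∀ j ∈ B1, g • (e j : EE F) = e j := fun j hj => hg.1 j (by
      rw [Finset.mem_insert]; exact fun h => h.elim (hBa j hj) (hBA j hj))
    rcases hy with rfl | ⟨t, rfl⟩ | ⟨j, hj, rfl⟩
    · exact h1
    · rw [g_add, g_smul, h1, h3 i1 hi1]
    · rw [g_add, h2, h3 j (his j hj)]
  have hmem : ∀ y ∈ is'.map (fun j => δ + (e j : EE F)), y = c ∨ (∃ t : F, y = c + t • e i1) ∨ ∃ j ∈ is', y = δ + e j := by
    intro y hy
    obtain ⟨j, hj, rfl⟩ := List.mem_map.mp hy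
    exact Or.inr (Or.inr ⟨j, hj, rfl⟩)
  have hm0 : ∀ y ∈ (c + x • e i1) :: c :: is'.map (fun j => δ + (e j : EE F)), y = c ∨ (∃ t : F, y = c + t • e i1) ∨ ∃ j ∈ is', y = δ + e j := by
    intro y hy
    rcases List.mem_cons.mp hy with rfl | hy
    · exact Or.inr (Or.inl ⟨x, rfl⟩)
    rcases List.mem_cons.mp hy with rfl | hy
    · exact Or.inl rfl
    exact hmem y hy
  have hm1 : ∀ y ∈ (c + e i1) :: c :: is'.map (fun j => δ + (e j : EE F)), y = c ∨ (∃ t : F, y = c + t • e i1) ∨ ∃ j ∈ is', y = δ + e j := by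
    intro y hy
    rcases List.mem_cons.mp hy with rfl | hy
    · exact Or.inr (Or.inl ⟨1, hone⟩)
    rcases List.mem_cons.mp hy with rfl | hy
    · exact Or.inl rfl
    exact hmem y hy
  apply Z_face _ _ c
  · obtain ⟨g, hg, hge, hgf⟩ := torus_exists (F := F) i1 x hx
    obtain ⟨hgc, hgδ⟩ := hfix g (Or.inl hg)
    have hB1 : insert i1 (B1.erase i1) = B1 := Finset.insert_erase hi1
    have hS := hNS A1 (B1.erase i1) a i1 (Finset.disjoint_of_subset_right (Finset.erase_subset _ _) hd) haA (fun h => haB (Finset.mem_of_mem_erase h))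
      (hBA i1 hi1) (Finset.notMem_erase _ _) (hBa i1 hi1).symm hq
    rw [hB1] at hS
    refine Z_mid (K1' := Ga F (insert a A1) B1) (K1 := Ga F A1 B1) (K2' := Ga F (insert a A1) (B1.erase i1)) (K2 := Ga F A1 (B1.erase i1))
      hKK (g := g) _ _ (hT hg) ?_ ?_ ?_ ?_ ?_ ?_ ?_ ?_ ?_ ?_ ?_ (hG _ _) ?_ hS hω hc
    · show g • (c + e i1) :: g • c :: gw g _ = _
      rw [g_add, hgc, hge, gw_fix]
      intro y hy
      obtain ⟨j, hj, rfl⟩ := List.mem_map.mp hy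
      rw [g_add, hgδ, hg.1 j]
      simp; rintro rfl; exact hi1' hj
    · exact fun k hk => ⟨hK'0 hk, gw_fix fun y hy => hfA k hk y (hm0 y hy)⟩
    · exact fun k hk => ⟨hK0 hk, gw_fix fun y hy => hfA k (hG _ _ hk) y (hm0 y hy)⟩
    · exact fun k hk => ⟨hK'0 hk, gw_fix fun y hy => hfA k hk y (hm1 y hy)⟩
    · exact fun k hk => ⟨hK0 hk, gw_fix fun y hy => hfA k (hG _ _ hk) y (hm1 y hy)⟩
    · exact hY' _ hm0 (by simp; omega)
    · exact hY _ hm0 (by simp; omega)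
    · exact hY' _ hm1 (by simp; omega)
    · exact hY _ hm1 (by simp; omega)
    · exact Ga_mono (by rfl) (fun y hy => Finset.mem_union_right _ (Finset.mem_of_mem_erase hy))
    · exact Ga_mono (by rfl) (fun y hy => Finset.mem_union_right _ (Finset.mem_of_mem_erase hy))
    · intro k hk
      have h5 : i1 ∉ insert a A1 := by rw [Finset.mem_insert]; exact fun h => h.elim (hBa i1 hi1) (hBA i1 hi1)
      refine comm_Ga hg ?_ ?_
      · intro j hj; rw [Finset.mem_singleton.mp hj]; exact hk.1 _ h5
      · intro j hj; rw [Finset.mem_singleton.mp hj]; exact hk.2 _ h5 (Finset.notMem_erase _ _)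
  · intro ws' hsub hlen
    obtain ⟨l', hl', rfl⟩ := List.sublist_map_iff.mp hsub
    rw [List.length_map, List.length_map] at hlen
    obtain ⟨j, hj, hjl⟩ := sub_aux is' (List.nodup_cons.mp hnd).2 l' hlen
    have hjB := his j hj
    have hV := hBV (insert j A1) (B1.erase j) a (by
        rw [Finset.disjoint_left]; intro y hy hy'
        rcases Finset.mem_insert.mp hy with rfl | hy
        · exact Finset.notMem_erase _ _ hy'
        · exact hBA y (Finset.mem_of_mem_erase hy') hy)
      (by rw [Finset.mem_insert]; exact fun h => h.elim (fun h => hBa j hjB h.symm) haA) (fun h => haB (Finset.mem_of_mem_erase h))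
      (by rw [Finset.card_insert_of_notMem (hBA j hjB)]; exact hq)
    have hmm : ∀ y ∈ (c + x • e i1) :: (c + e i1) :: c :: l'.map (fun j => δ + (e j : EE F)), y = c ∨ (∃ t : F, y = c + t • e i1) ∨ ∃ j ∈ l', y = δ + e j := by
      intro y hy
      rcases List.mem_cons.mp hy with rfl | hy
      · exact Or.inr (Or.inl ⟨x, rfl⟩)
      rcases List.mem_cons.mp hy with rfl | hy
      · exact Or.inr (Or.inl ⟨1, hone⟩)
      rcases List.mem_cons.mp hy with rfl | hy
      · exact Or.inl rfl
      obtain ⟨j, hj, rfl⟩ := List.mem_map.mp hy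
      exact Or.inr (Or.inr ⟨j, hj, rfl⟩)
    have hmm' : ∀ y ∈ (c + x • e i1) :: (c + e i1) :: c :: l'.map (fun j => δ + (e j : EE F)), y = c ∨ (∃ t : F, y = c + t • e i1) ∨ ∃ j ∈ is', y = δ + e j := by
      intro y hy
      rcases hmm y hy with h | h | ⟨j, hj, h⟩
      · exact Or.inl h
      · exact Or.inr (Or.inl h)
      · exact Or.inr (Or.inr ⟨j, hl'.subset hj, h⟩)
    have hfA3 : ∀ g ∈ Ga F (insert a (insert j A1)) (B1.erase j), ∀ y, (y = c ∨ (∃ t : F, y = c + t • e i1) ∨ ∃ j ∈ l', y = δ + e j) → g • y = y := by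
      intro g hg y hy
      obtain ⟨h1, h2⟩ := hfix g (Or.inr (Or.inr ⟨j, hj, hg⟩))
      have h3 : ∀ k ∈ B1, k ≠ j → g • (e k : EE F) = e k := fun k hk hkj => hg.1 k (by
        rw [Finset.mem_insert, Finset.mem_insert]; exact fun h => h.elim (hBa k hk) (fun h => h.elim hkj (hBA k hk)))
      rcases hy with rfl | ⟨t, rfl⟩ | ⟨k, hk, rfl⟩
      · exact h1
      · rw [g_add, g_smul, h1, h3 i1 hi1 (by rintro rfl; exact hi1' hj)]
      · rw [g_add, h2, h3 k (his k (hl'.subset hk)) (by rintro rfl; exact hjl hk)]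
    have hle : ∀ A : Finset ℕ, Ga F A B1 ≤ Ga F (insert j A) (B1.erase j) := fun A => Ga_mono (Finset.subset_insert _ _) (by
        intro y hy
        by_cases h : y = j
        · subst h; exact Finset.mem_union_left _ (Finset.mem_insert_self _ _)
        · exact Finset.mem_union_right _ (Finset.mem_erase.mpr ⟨h, hy⟩))
    refine Z_of_RV (K1' := Ga F (insert a (insert j A1)) (B1.erase j)) (K1 := Ga F (insert j A1) (B1.erase j)) ?_ ?_ ?_ ?_ hV hω ?_
    · exact fun k hk => ⟨hK' j hj hk, gw_fix fun y hy => hfA3 k hk y (hmm y hy)⟩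
    · exact fun k hk => ⟨hK j hj hk, gw_fix fun y hy => hfA3 k (hG _ _ hk) y (hmm y hy)⟩
    · exact hY' _ hmm' (by simp; omega)
    · exact hY _ hmm' (by simp; omega)
    · refine R0_mono ?_ (hle A1) hc
      have := hle (insert a A1)
      rwa [Finset.insert_comm] at this
end kill
end HS

set_option linter.all false
namespace HS
open Finsupp
section nstep
variable {F : Type} [Field F]

variable (F) in
/-- vertices of the N-complex -/
def PN (A B : Finset ℕ) (b : ℕ) (z : EE F) : Prop := z ∈ Va F (insert b A) B ∧ (z b).2 = 1

variable (F) in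
def XN (A B : Finset ℕ) (b : ℕ) : Set (List (EE F)) := IL (qF F) (PN F A B b)

noncomputable def tauN (b : ℕ) (x : F) (u : EE F) (vs : List (EE F)) : List (EE F) :=
  (f b + x • u) :: (f b + u) :: vs.map (fun v => f b + v)

lemma tauN_gw {b : ℕ} {x : F} {u : EE F} {vs : List (EE F)} {g : GG F} (hg : g • (f b : EE F) = f b) :
    gw g (tauN b x u vs) = tauN b x (g • u) (gw g vs) := by
  simp only [tauN, gw, List.map_cons, g_add, g_smul, hg, List.map_map]
  congr 2
  refine List.map_congr_left fun v _ => ?_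
  simp [g_add, hg]

lemma Va_b {A B : Finset ℕ} {b : ℕ} {v : EE F} (hv : v ∈ Va F (insert b A) B) (h1 : (v b).1 = 0) (h2 : (v b).2 = 0) : v ∈ Va F A B := by
  refine ⟨fun j hj => ?_, fun j hj hj' => ?_⟩
  · by_cases h : j = b
    · rw [h]; exact h2
    · exact hv.1 j (by simp [h, hj])
  · by_cases h : j = b
    · rw [h]; exact h1
    · exact hv.2 j (by simp [h, hj]) hj'

lemma Va_b0 {A B : Finset ℕ} {b : ℕ} (hA : b ∉ A) (hB : b ∉ B) {v : EE F} (hv : v ∈ Va F A B) : (v b).1 = 0 ∧ (v b).2 = 0 :=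
  ⟨hv.2 b hA hB, hv.1 b hA⟩

lemma PN_f (A B : Finset ℕ) (b : ℕ) : PN F A B b (f b) := ⟨f_Va (by simp), by rw [f_self]⟩

lemma PN_fv {A B : Finset ℕ} {b : ℕ} (hA : b ∉ A) (hB : b ∉ B) {v : EE F} (hv : v ∈ Va F A B) (t : F) : PN F A B b (f b + t • v) := by
  refine ⟨Submodule.add_mem _ (f_Va (by simp)) (Submodule.smul_mem _ _ (Va_mono (Finset.subset_insert _ _) Finset.subset_union_right hv)), ?_⟩
  simp [f_self, (Va_b0 hA hB hv).2]

/-- a list all of whose entries are `f b + t • v`, with v in an isotropic set -/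
lemma XN_list {A B : Finset ℕ} {b : ℕ} (hA : b ∉ A) (hB : b ∉ B) {L : List (EE F)} (hL : L ∈ IL (qF F) (fun x => x ∈ Va F A B))
    {l : List (EE F)} (hl : ∀ y ∈ l, ∃ v ∈ L, ∃ t : F, y = f b + t • v) : l ∈ XN F A B b := by
  have hbf : ∀ v ∈ L, be (qF F) v (f b) = 0 := fun v hv => by rw [be_f]; exact (Va_b0 hA hB (hL.1 v hv).1).1
  have h0 : be (qF F) (f b) (f b) = 0 := be_self0 _ (Q_f b)
  refine ⟨fun y hy => ?_, fun y hy y' hy' => ?_⟩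
  · obtain ⟨v, hv, t, rfl⟩ := hl y hy
    refine ⟨PN_fv hA hB (hL.1 v hv).1 t, ?_⟩
    rw [Q_add, Q_smul, Q_f, (hL.1 v hv).2, be_comm, map_smul, LinearMap.smul_apply, hbf v hv]
    simp
  · obtain ⟨v, hv, t, rfl⟩ := hl y hy
    obtain ⟨v', hv', t', rfl⟩ := hl y' hy'
    simp only [map_add, map_smul, LinearMap.add_apply, LinearMap.smul_apply, hbf v hv, hL.2 v hv v' hv', h0]
    rw [be_comm _ (f b) v', hbf v' hv']; simp

lemma tauN_mem {A B : Finset ℕ} {b : ℕ} (hA : b ∉ A) (hB : b ∉ B) {x : F} {u : EE F} {vs : List (EE F)}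
    (hL : u :: vs ∈ IL (qF F) (fun x => x ∈ Va F A B)) : tauN b x u vs ∈ XN F A B b := by
  refine XN_list hA hB hL ?_
  intro y hy
  simp only [tauN, List.mem_cons, List.mem_map] at hy
  rcases hy with rfl | rfl | ⟨v, hv, rfl⟩
  · exact ⟨u, by simp, x, rfl⟩
  · exact ⟨u, by simp, 1, by simp⟩
  · exact ⟨v, by simp [hv], 1, by simp⟩

lemma PN_g {A B : Finset ℕ} {b : ℕ} (hA : b ∉ A) {g : GG F} (hg : g ∈ Ga F A (insert b B)) {z : EE F} (hz : PN F A B b z) : PN F A B b (g • z) := by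
  refine ⟨Va_inv (fun j hj => hg.1 j (fun h => hj (by simp [h]))) (fun j hj hj' => hg.2 j (fun h => hj (by simp [h])) ?_) hz.1, ?_⟩
  · intro h; rcases Finset.mem_insert.mp h with rfl | h
    · exact hj (by simp)
    · exact hj' h
  · rw [← be_e, ← hg.1 b hA, g_be, be_e]; exact hz.2

lemma eichN {A B : Finset ℕ} {b : ℕ} (hA : b ∉ A) (hB : b ∉ B) (hAB : Disjoint A B) {z : EE F} (hz : PN F A B b z) (hQ : qF F z = 0) :
    ∃ g ∈ Ga F A (insert b B), g • (f b : EE F) = z := by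
  set u : EE F := z - f b - (z b).1 • e b with hu
  have hub1 : (u b).1 = 0 := by simp [hu, e_self, f_self]
  have hub2 : (u b).2 = 0 := by simp [hu, e_self, f_self, hz.2]
  have huV' : u ∈ Va F (insert b A) B := Submodule.sub_mem _ (Submodule.sub_mem _ hz.1 (f_Va (by simp))) (Submodule.smul_mem _ _ (e_Va (by simp)))
  have huV := Va_b huV' hub1 hub2
  have hzu : z = f b + u + (z b).1 • e b := by rw [hu]; abel
  have hQu : qF F u = - (z b).1 := by
    have h1 : qF F u + (z b).1 = 0 := by
      rw [← hQ]
      conv_rhs => rw [hzu]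
      rw [Q_add, Q_add, Q_f, Q_smul, Q_e, map_smul, map_add, LinearMap.add_apply, be_e, be_e, be_comm, be_f, hub1, hub2, f_self]
      simp
    exact eq_neg_of_add_eq_zero_left h1
  obtain ⟨g, hg⟩ := eich_exists (e b) u (Q_e b) (by rw [be_comm, be_e, hub2])
  refine ⟨g, ⟨fun j hj => ?_, fun j hj hj' => ?_⟩, ?_⟩
  · rw [hg, be_e, e_snd, be_comm, be_e, huV.1 j hj]; simp
  · have hjb : j ≠ b := fun h => hj' (by simp [h])
    rw [hg, be_e, f_snd_ne hjb.symm, be_comm, be_f, huV.2 j hj (fun h => hj' (by simp [h]))]; simp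
  · rw [hg, be_e, f_self, be_comm, be_f, hub1, hQu]
    conv_rhs => rw [hzu]
    simp

lemma diffN {A B : Finset ℕ} {b : ℕ} {zs : List (EE F)} {g : GG F} (hA : b ∉ A) (hg : g ∈ Ga F A (insert b B))
    (hz : (g • (f b : EE F)) :: zs ∈ XN F A B b) : zs.map (fun z => g⁻¹ • z - f b) ∈ IL (qF F) (fun x => x ∈ Va F A B) := by
  have hz1 : (f b : EE F) :: gw g⁻¹ zs ∈ XN F A B b := by
    have := gw_IL (g := g⁻¹) (P := PN F A B b) (fun x hx => PN_g hA (Subgroup.inv_mem _ hg) hx) hz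
    simpa [gw, XN] using this
  have hf : ∀ z ∈ gw g⁻¹ zs, (z b).1 = 0 := fun z hz => by rw [← be_f]; exact hz1.2 z (by simp [hz]) _ (by simp)
  have h0 : be (qF F) (f b) (f b) = 0 := be_self0 _ (Q_f b)
  have key : (gw g⁻¹ zs).map (fun z => z - f b) ∈ IL (qF F) (fun x => x ∈ Va F A B) := by
    refine ⟨?_, ?_⟩
    · intro y hy
      obtain ⟨z, hz, rfl⟩ := List.mem_map.mp hy
      obtain ⟨h1, h2⟩ := hz1.1 z (by simp [hz])
      refine ⟨Va_b (Submodule.sub_mem _ h1.1 (f_Va (by simp))) ?_ ?_, ?_⟩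
      · simp [hf z hz, f_self]
      · simp [h1.2, f_self]
      · rw [Q_sub, h2, Q_f, be_f, hf z hz]; simp
    · intro y hy y' hy'
      obtain ⟨z, hz, rfl⟩ := List.mem_map.mp hy
      obtain ⟨z', hz', rfl⟩ := List.mem_map.mp hy'
      simp only [map_sub, LinearMap.sub_apply, h0, be_f, hf z hz]
      rw [be_comm _ (f b), be_f, hf z' hz', hz1.2 z (by simp [hz]) z' (by simp [hz'])]
      simp
  rw [List.map_map] at key
  exact key

lemma normN {A B : Finset ℕ} {b : ℕ} (hA : b ∉ A) (hB : b ∉ B) (hAB : Disjoint A B) {x : F} (hx1 : x ≠ 1) {z0 z1 : EE F} {zs : List (EE F)}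
    (hz : z0 :: z1 :: zs ∈ XN F A B b) : ∃ g ∈ Ga F A (insert b B), ∃ u vs, u :: vs ∈ IL (qF F) (fun x => x ∈ Va F A B) ∧ vs.length = zs.length ∧
      gw g (tauN b x u vs) = z0 :: z1 :: zs := by
  have hx : x - 1 ≠ 0 := sub_ne_zero.mpr hx1
  set zt : EE F := z1 - (x - 1)⁻¹ • (z0 - z1) with hzt
  obtain ⟨p0, q0⟩ := hz.1 z0 (by simp)
  obtain ⟨p1, q1⟩ := hz.1 z1 (by simp)
  have b01 := hz.2 z0 (by simp) z1 (by simp)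
  have hbe : ∀ y ∈ z0 :: z1 :: zs, be (qF F) zt y = 0 := by
    intro y hy
    simp only [hzt, map_sub, map_smul, LinearMap.sub_apply, LinearMap.smul_apply, hz.2 z0 (by simp) y hy, hz.2 z1 (by simp) y hy]
    simp
  have hP : PN F A B b zt := by
    refine ⟨Submodule.sub_mem _ p1.1 (Submodule.smul_mem _ _ (Submodule.sub_mem _ p0.1 p1.1)), ?_⟩
    simp [hzt, p0.2, p1.2]
  have hQt : qF F zt = 0 := by
    rw [hzt, Q_sub, Q_smul, Q_sub, q0, q1, b01, map_smul, map_sub, hz.2 z1 (by simp) z0 (by simp), be_self0 _ q1]; simp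
  have hall : zt :: z0 :: z1 :: zs ∈ XN F A B b := IL_cons _ hP hQt hz hbe
  obtain ⟨g, hg, hgz⟩ := eichN hA hB hAB hP hQt
  rw [← hgz] at hall
  have hd := diffN hA hg hall
  rw [List.map_cons, List.map_cons] at hd
  refine ⟨g, hg, g⁻¹ • z1 - f b, zs.map (fun z => g⁻¹ • z - f b), (IL_FC _ _) _ hd _ (List.sublist_cons_self _ _), by simp, ?_⟩
  have e1 : z1 - zt = (x - 1)⁻¹ • (z0 - z1) := by rw [hzt]; abel
  have e2 : zt + x • (z1 - zt) = z0 := by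
    rw [e1, hzt]
    have : x • (x - 1)⁻¹ • (z0 - z1) = (x - 1)⁻¹ • (z0 - z1) + (z0 - z1) := by
      have h : x * (x - 1)⁻¹ = (x - 1)⁻¹ + 1 := by field_simp; ring
      rw [smul_smul, h, add_smul, one_smul]
    rw [this]; abel
  simp only [tauN, gw, List.map_cons, g_add, g_smul, g_sub, smul_inv_smul, hgz, List.map_map]
  rw [e2]
  congr 2
  · abel
  · conv_rhs => rw [← List.map_id zs]
    refine List.map_congr_left fun v _ => ?_
    simp [g_add, g_sub, hgz]

/-- stabilizers -/
lemma StN_le {A B S : Finset ℕ} {b : ℕ} {x : F} (hx1 : x ≠ 1) {u : EE F} {vs : List (EE F)} (hAB : Disjoint A B)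
    (hSB : ∀ j ∈ S, (e j : EE F) ∈ SB B (u :: vs)) : St (Ga F A (insert b B)) (tauN b x u vs) ≤ Ga F (A \ S) (B ∪ S) := by
  rintro g ⟨hg, hs⟩
  have hfix := gw_fix' hs
  have hx : x - 1 ≠ 0 := sub_ne_zero.mpr hx1
  have h0 := hfix (f b + x • u) (by simp [tauN])
  have h1 := hfix (f b + u) (by simp [tauN])
  have hu : g • u = u := by
    have h2 : (x - 1) • (g • u) = (x - 1) • u := by
      have e : ∀ w : EE F, (x - 1) • w = (f b + x • w) - (f b + w) := fun w => by rw [sub_smul, one_smul]; abel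
      rw [← g_smul, e u, g_sub, h0, h1]
    exact smul_right_injective _ hx h2
  have hfb : g • (f b : EE F) = f b := by
    rw [g_add, hu] at h1; exact add_right_cancel h1
  have hv : ∀ v ∈ u :: vs, g • v = v := by
    intro v hv
    rcases List.mem_cons.mp hv with rfl | hv
    · exact hu
    · have := hfix (f b + v) (by simp [tauN, hv])
      rw [g_add, hfb] at this; exact add_left_cancel this
  have hS : ∀ j ∈ S, g • (e j : EE F) = e j := fun j hj =>
    SB_fix (fun i hi => hg.1 i (Finset.disjoint_right.mp hAB hi)) hv (hSB j hj)
  refine ⟨fun j hj => ?_, fun j hj hj' => ?_⟩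
  · by_cases h : j ∈ S
    · exact hS j h
    · exact hg.1 j (fun h' => hj (Finset.mem_sdiff.mpr ⟨h', h⟩))
  · have h : j ∉ S := fun h => hj' (Finset.mem_union_right _ h)
    by_cases hb : j = b
    · rw [hb]; exact hfb
    · refine hg.2 j (fun h' => hj (Finset.mem_sdiff.mpr ⟨h', h⟩)) (fun h' => ?_)
      rcases Finset.mem_insert.mp h' with h' | h'
      · exact hb h'
      · exact hj' (Finset.mem_union_left _ h')

lemma StN_ge {A B S : Finset ℕ} {b : ℕ} {x : F} {u : EE F} {vs : List (EE F)} (hAB : Disjoint A B) (hA : b ∉ A) (hB : b ∉ B) (hSA : b ∉ S)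
    (hS : S ⊆ A) (hV : ∀ v ∈ u :: vs, v ∈ Va F ∅ (B ∪ S)) : Ga F (A \ S) (B ∪ S) ≤ St (Ga F A (insert b B)) (tauN b x u vs) := by
  intro g hg
  have hfb : g • (f b : EE F) = f b := hg.2 b (fun h => hA (Finset.mem_sdiff.mp h).1) (by simp [hB, hSA])
  have hv : ∀ v ∈ u :: vs, g • v = v := fun v hv =>
    fixV (fun j hj => hg.1 j (Finset.disjoint_right.mp (dj_sdiff hAB) hj)) (hV v hv)
  refine ⟨Ga_mono (by rfl) (fun i hi => by simp [hi]) (Ga_sdiff hS hg), ?_⟩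
  rw [tauN_gw hfb, hv u (by simp), gw_fix (fun v h => hv v (by simp [h]))]

end nstep
end HS

set_option linter.all false
namespace HS
open Finsupp
section nstep
variable {F : Type} [Field F]

lemma redN' {A B : Finset ℕ} {b : ℕ} (hA : b ∉ A) (hB : b ∉ B) (hAB : Disjoint A B) (a : ℕ) (x : F) {u : EE F} {vs : List (EE F)}
    (hL : u :: vs ∈ IL (qF F) (fun x => x ∈ Va F A B)) :
    ∃ S ⊆ A, S.card ≤ vs.length + 1 ∧ ∃ u' vs', vs'.length = vs.length ∧ u' :: vs' ∈ IL (qF F) (fun x => x ∈ Va F A B) ∧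
      (∃ g ∈ Ga F A (insert b B), gw g (tauN b x u' vs') = tauN b x u vs) ∧ (∀ v ∈ u' :: vs', v ∈ Va F ∅ (B ∪ S)) ∧
      (∀ j ∈ S, (e j : EE F) ∈ SB B (u' :: vs')) ∧ ((0 : EE F) ∈ vs → S.card ≤ vs.length) ∧
      (S.card = vs.length + 1 → ∃ is : List ℕ, is.Nodup ∧ is.toFinset = S ∧ u' :: vs' = is.map e) ∧ (a ∈ S → S = A) := by
  obtain ⟨h, hh, S, hS, hc, h1, h2, h3, h4⟩ := NF hAB a (u :: vs) hL
  rw [List.length_cons] at hc h3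
  have hgw : gw h (u :: vs) = h • u :: gw h vs := rfl
  rw [hgw] at h1 h2 h3
  have hfb : h • (f b : EE F) = f b := hh.2 b hA hB
  refine ⟨S, hS, hc, h • u, gw h vs, by simp [gw], gw_IL (fun x hx => Ga_Va hh hx) hL, ⟨h⁻¹, ?_, ?_⟩, h1, h2, ?_, h3, h4⟩
  · exact Ga_mono (by rfl) (fun i hi => by simp [hi]) (Subgroup.inv_mem _ hh)
  · exact gw_inv (tauN_gw hfb)
  · intro h0
    by_contra hcon
    obtain ⟨is, -, -, h5⟩ := h3 (by omega)
    have : (0 : EE F) ∈ is.map e := by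
      rw [← h5]; exact List.mem_cons_of_mem _ (List.mem_map.mpr ⟨0, h0, g_zero h⟩)
    obtain ⟨i, -, hi⟩ := List.mem_map.mp this
    exact e_ne_zero i hi

lemma redN {A B : Finset ℕ} {b : ℕ} (hA : b ∉ A) (hB : b ∉ B) (hAB : Disjoint A B) (a : ℕ) {x : F} (hx1 : x ≠ 1) {σ : List (EE F)} {k : ℕ}
    (hσ : σ ∈ lev (XN F A B b) (k+2)) :
    ∃ S ⊆ A, S.card ≤ k + 1 ∧ ∃ u' vs', vs'.length = k ∧ u' :: vs' ∈ IL (qF F) (fun x => x ∈ Va F A B) ∧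
      (∃ g ∈ Ga F A (insert b B), gw g (tauN b x u' vs') = σ) ∧ (∀ v ∈ u' :: vs', v ∈ Va F ∅ (B ∪ S)) ∧
      (∀ j ∈ S, (e j : EE F) ∈ SB B (u' :: vs')) ∧
      (S.card = k + 1 → ∃ is : List ℕ, is.Nodup ∧ is.toFinset = S ∧ u' :: vs' = is.map e) ∧ (a ∈ S → S = A) := by
  obtain ⟨hσ, hl⟩ := hσ
  match σ, hl, hσ with
  | z0 :: z1 :: zs, hl, hσ =>
    obtain ⟨g, hg, u, vs, hL, hlen, hgt⟩ := normN hA hB hAB hx1 hσ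
    have hl' : vs.length = k := by rw [hlen]; simpa using hl
    obtain ⟨S, hS, hc, u', vs', h1, h2, ⟨g', hg', h3⟩, h4, h5, -, h6, h7⟩ := redN' hA hB hAB a x hL
    rw [hl'] at h1 h6 hc
    exact ⟨S, hS, hc, u', vs', h1, h2, ⟨g * g', Subgroup.mul_mem _ hg hg', by rw [gw_mul, h3, hgt]⟩, h4, h5, h6, h7⟩

lemma tauN_len {b : ℕ} {x : F} {u : EE F} {vs : List (EE F)} {k : ℕ} (h : vs.length = k) : (tauN b x u vs).length = k + 2 := by
  simp [tauN, h]

lemma orbN {A B : Finset ℕ} {b : ℕ} (hA : b ∉ A) (hB : b ∉ B) (hAB : Disjoint A B) {σ τ : List (EE F)} {k : ℕ}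
    (hσ : σ ∈ lev (XN F A B b) (k+1)) (hτ : τ ∈ lev (XN F A B b) (k+1)) {g : GG F} (hgB : ∀ j ∈ B, g • (e j : EE F) = e j) (hg : gw g τ = σ) :
    ∃ g ∈ Ga F A (insert b B), gw g τ = σ := by
  obtain ⟨hσ, hl⟩ := hσ
  obtain ⟨hτ, hl'⟩ := hτ
  match σ, hl, hσ, τ, hl', hτ with
  | s0 :: ss, hl, hσ, t0 :: ts, hl', hτ =>
    obtain ⟨g1, hg1, h1⟩ := eichN hA hB hAB (hτ.1 t0 (by simp)).1 (hτ.1 t0 (by simp)).2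
    obtain ⟨g2, hg2, h2⟩ := eichN hA hB hAB (hσ.1 s0 (by simp)).1 (hσ.1 s0 (by simp)).2
    rw [gw, List.map_cons, List.cons.injEq] at hg
    obtain ⟨hg0, hgs⟩ := hg
    have d1 := diffN (g := g1) hA hg1 (by rw [h1]; exact hτ)
    have d2 := diffN (g := g2) hA hg2 (by rw [h2]; exact hσ)
    have hfix : ∀ j ∈ B, ∀ h ∈ Ga F A (insert b B), h • (e j : EE F) = e j := fun j hj h hh => hh.1 j (Finset.disjoint_right.mp hAB hj)
    have hp : (g2⁻¹ * g * g1) • (f b : EE F) = f b := by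
      rw [mul_smul, mul_smul, h1, hg0, ← h2, inv_smul_smul]
    have hgw : gw (g2⁻¹ * g * g1) (ts.map (fun z => g1⁻¹ • z - f b)) = ss.map (fun z => g2⁻¹ • z - f b) := by
      rw [← hgs, gw, List.map_map, List.map_map]
      refine List.map_congr_left fun z _ => ?_
      simp only [Function.comp_apply]
      rw [g_sub, hp, mul_smul, mul_smul, smul_inv_smul]
    obtain ⟨h, hh, h3⟩ := ORB hAB _ (g2⁻¹ * g * g1) (by
      intro j hj
      rw [mul_smul, mul_smul, hfix j hj g1 hg1, hgB j hj, hfix j hj _ (Subgroup.inv_mem _ hg2)]) d1 (by rw [hgw]; exact d2)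
    have hh' : h ∈ Ga F A (insert b B) := Ga_mono (by rfl) (fun i hi => by simp [hi]) hh
    have hfb : h • (f b : EE F) = f b := hh.2 b hA hB
    refine ⟨g2 * h * g1⁻¹, Subgroup.mul_mem _ (Subgroup.mul_mem _ hg2 hh') (Subgroup.inv_mem _ hg1), ?_⟩
    rw [hgw] at h3
    rw [gw, List.map_cons]
    congr 1
    · rw [mul_smul, mul_smul, ← h1, inv_smul_smul, hfb, h2]
    · have h4 : (ss.map (fun z => g2⁻¹ • z - f b)).map (fun z => g2 • (z + f b)) = ss := by
        rw [List.map_map]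
        conv_rhs => rw [← List.map_id ss]
        refine List.map_congr_left fun z _ => by simp [g_sub]
      rw [← h4, ← h3, gw, List.map_map, List.map_map]
      refine List.map_congr_left fun z _ => ?_
      simp only [Function.comp_apply]
      rw [g_sub, hfb, sub_add_cancel, mul_smul, mul_smul]

lemma ilA {A B S : Finset ℕ} (hS : S ⊆ A) {A' B' : Finset ℕ} {L : List (EE F)} (hL : L ∈ IL (qF F) (fun x => x ∈ Va F A' B'))
    (h : ∀ v ∈ L, v ∈ Va F ∅ (B ∪ S)) : L ∈ IL (qF F) (fun x => x ∈ Va F A B) :=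
  ⟨fun v hv => ⟨Va_mono (by simp) (fun i hi => by
    rcases Finset.mem_union.mp hi with h | h
    · simp [h]
    · simp [hS h]) (h v hv), (hL.1 v hv).2⟩, hL.2⟩

lemma sdiff_ins {a : ℕ} {A S : Finset ℕ} (h : a ∉ S) : insert a A \ S = insert a (A \ S) := Finset.insert_sdiff_of_notMem _ h

set_option maxHeartbeats 1000000 in
/-- degree zero, N-step -/
lemma N0case {A B : Finset ℕ} {a b : ℕ} (hAB : Disjoint A B) (haA : a ∉ A) (haB : a ∉ B) (hbA : b ∉ A) (hbB : b ∉ B) (hab : a ≠ b)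
    {x : F} (hx0 : x ≠ 0) (hx1 : x ≠ 1) {k : ℕ} (hk : k + 1 ≤ A.card + 1) {σ : List (EE F)} (hσ : σ ∈ lev (XN F (insert a A) B b) (k+2)) (γ : GG F) :
    In1 σ (sg [γ], 0) ∈ Zs (Ga F (insert a A) (insert b B)) (Ga F A (insert b B)) 0 (lev (XN F (insert a A) B b) (k+2)) (lev (XN F A B b) (k+2)) := by
  have hbA' : b ∉ insert a A := by simp [hbA, hab.symm]
  have hAB' : Disjoint (insert a A) B := Finset.disjoint_insert_left.mpr ⟨haB, hAB⟩
  have hYY : lev (XN F A B b) (k+2) ⊆ lev (XN F (insert a A) B b) (k+2) := by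
    refine lev_mono (IL_mono _ fun z hz => ⟨Va_mono ?_ Finset.subset_union_right hz.1, hz.2⟩) _
    exact Finset.insert_subset_insert _ (Finset.subset_insert _ _)
  have hin : ∀ (S : Finset ℕ) (u : EE F) (vs : List (EE F)), S ⊆ insert a A → a ∉ S → vs.length = k →
      u :: vs ∈ IL (qF F) (fun x => x ∈ Va F (insert a A) B) → (∀ v ∈ u :: vs, v ∈ Va F ∅ (B ∪ S)) → tauN b x u vs ∈ lev (XN F A B b) (k+2) := by
    intro S u vs hS haS hl hL hv
    refine ⟨tauN_mem hbA hbB (ilA ?_ hL hv), tauN_len hl⟩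
    intro i hi
    rcases Finset.mem_insert.mp (hS hi) with rfl | h
    · exact absurd hi haS
    · exact h
  obtain ⟨S, hS, hc, u, vs, h1, h2, ⟨g, hg, h3⟩, h4, h5, h6, h7⟩ := redN hbA' hbB hAB' a hx1 hσ
  by_cases haS : a ∈ S
  swap
  · exact Z0_inX hYY (hin S u vs hS haS h1 h2 h4) hg h3 γ
  have hSA := h7 haS
  have hcS : S.card = A.card + 1 := by rw [hSA, Finset.card_insert_of_notMem haA]
  have hτ' : tauN b x u vs ∈ lev (XN F (insert a A) B b) (k+2) := ⟨tauN_mem hbA' hbB h2, tauN_len h1⟩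
  obtain ⟨is, hnd, hisS, his⟩ := h6 (by omega)
  have hmv := Z0_mid (K := Ga F A (insert b B)) (Y := lev (XN F A B b) (k+2)) σ (tauN b x u vs) hg h3 hσ γ
  suffices hs : In1 (tauN b x u vs) (sg [γ], 0) ∈ Zs (Ga F (insert a A) (insert b B)) (Ga F A (insert b B)) 0 (lev (XN F (insert a A) B b) (k+2)) (lev (XN F A B b) (k+2)) by
    have := Submodule.sub_mem _ hs hmv
    convert this using 1
    abel
  clear hmv
  match is, his, hisS, hnd with
  | i1 :: is', his, hisS, hnd =>
    rw [List.map_cons, List.cons.injEq] at his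
    obtain ⟨rfl, rfl⟩ := his
    have hlen : is'.length = k := by simpa using h1
    have hi1S : i1 ∈ insert a A := by rw [← hSA, ← hisS]; simp
    have hi1b : i1 ≠ b := by rintro rfl; exact hbA' hi1S
    obtain ⟨hni, hnd'⟩ := List.nodup_cons.mp hnd
    apply Z_face _ _ (f b)
    · obtain ⟨t, ht, hte, htf⟩ := torus_exists (F := F) i1 x hx0
      have htfb : t • (f b : EE F) = f b := ht.2 b (by simp [hi1b.symm]) (by simp)
      refine Z0_mid _ _ (g := t) (Ga_mono (by simpa using hi1S) (by simp) ht) ?_ ?_ γ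
      · show t • (f b + e i1) :: t • f b :: gw t _ = _
        rw [g_add, htfb, hte, gw_fix]
        intro y hy
        simp only [List.mem_map] at hy
        obtain ⟨_, ⟨j, hj, rfl⟩, rfl⟩ := hy
        rw [g_add, htfb, ht.1 j]
        simp; rintro rfl; exact hni hj
      · refine ⟨XN_list hbA' hbB h2 ?_, by simp [hlen]⟩
        intro y hy
        simp only [List.mem_cons, List.mem_map] at hy
        rcases hy with rfl | rfl | ⟨_, ⟨j, hj, rfl⟩, rfl⟩
        · exact ⟨e i1, by simp, x, rfl⟩
        · exact ⟨e i1, by simp, 0, by simp⟩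
        · exact ⟨e j, List.mem_cons_of_mem _ (List.mem_map_of_mem hj), 1, by simp⟩
    · intro ws' hsub hws
      obtain ⟨l', hl', rfl⟩ := List.sublist_map_iff.mp hsub
      rw [List.length_map, List.length_map, List.length_map, hlen] at hws
      have he : (f b + x • e i1) :: (f b + e i1) :: f b :: l'.map (fun v => f b + v) = tauN b x (e i1) ((0 : EE F) :: l') := by simp [tauN]
      rw [he]
      have hL : e i1 :: (0 : EE F) :: l' ∈ IL (qF F) (fun x => x ∈ Va F (insert a A) B) := by
        have h8 := (IL_FC _ _) _ h2 (e i1 :: l') (hl'.cons_cons _)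
        have h9 : (0 : EE F) :: e i1 :: l' ∈ IL (qF F) (fun x => x ∈ Va F (insert a A) B) :=
          IL_cons _ (Submodule.zero_mem _) (map_zero _) h8 (fun y _ => by simp)
        refine ⟨fun y hy => h9.1 y ?_, fun y hy y' hy' => h9.2 y ?_ y' ?_⟩ <;> simp only [List.mem_cons] at * <;> tauto
      have hlen2 : ((0 : EE F) :: l').length = k := by simpa using hws
      obtain ⟨S2, hS2, hc2, u2, vs2, j1, j2, ⟨g2, hg2, j3⟩, j4, j5, j6, j7, j8⟩ := redN' hbA' hbB hAB' a x hL
      have j6' := j6 (by simp)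
      rw [hlen2] at j6' j1
      have ha2 : a ∉ S2 := by
        intro h
        have := j8 h
        have h10 : S2.card = A.card + 1 := by rw [this, Finset.card_insert_of_notMem haA]
        omega
      exact Z0_inX hYY (hin S2 u2 vs2 hS2 ha2 j1 j2 j4) hg2 j3 γ

set_option maxHeartbeats 1000000 in
/-- positive degree -/
lemma Nqcase {A B : Finset ℕ} {a b : ℕ} (hAB : Disjoint A B) (haA : a ∉ A) (haB : a ∉ B) (hbA : b ∉ A) (hbB : b ∉ B) (hab : a ≠ b)
    {x : F} (hx0 : x ≠ 0) (hx1 : x ≠ 1) {q k : ℕ} (hq : 1 ≤ q) (hk : q + (k + 1) ≤ A.card + 1) (hBV : BV F q) (hNS : NS F q) 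
    (w : MP (GG F) (EE F)) (hw : w ∈ dg q (lev (XN F (insert a A) B b) (k+2)) (lev (XN F A B b) (k+2))) 
    (hcw : cD1 w ∈ RR (EE F) (Ga F (insert a A) (insert b B)) (Ga F A (insert b B))) :
    w ∈ Zs (Ga F (insert a A) (insert b B)) (Ga F A (insert b B)) q (lev (XN F (insert a A) B b) (k+2)) (lev (XN F A B b) (k+2)) := by
  have hbA' : b ∉ insert a A := by simp [hbA, hab.symm]
  have hAB' : Disjoint (insert a A) B := Finset.disjoint_insert_left.mpr ⟨haB, hAB⟩
  have hKK : Ga F A (insert b B) ≤ Ga F (insert a A) (insert b B) := Ga_mono (Finset.subset_insert _ _) Finset.subset_union_right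
  have hYY : lev (XN F A B b) (k+2) ⊆ lev (XN F (insert a A) B b) (k+2) := by
    refine lev_mono (IL_mono _ fun z hz => ⟨Va_mono ?_ Finset.subset_union_right hz.1, hz.2⟩) _
    exact Finset.insert_subset_insert _ (Finset.subset_insert _ _)
  obtain ⟨s, ω, hs1, hs2⟩ := orbit_lemma hKK hYY (fun g hg σ hσ => ⟨gw_IL (fun z hz => PN_g hbA hg hz) hσ.1, by simpa [gw] using hσ.2⟩)
    (fun g hg σ hσ => ⟨gw_IL (fun z hz => PN_g hbA' hg hz) hσ.1, by simpa [gw] using hσ.2⟩)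
    (fun τ => ∀ ω ∈ dg0 q, cd ω ∈ R0 (St (Ga F (insert a A) (insert b B)) τ) (St (Ga F A (insert b B)) τ) → 
      In1 τ ω ∈ Zs (Ga F (insert a A) (insert b B)) (Ga F A (insert b B)) q (lev (XN F (insert a A) B b) (k+2)) (lev (XN F A B b) (k+2)))
    (by
      intro σ hσ
      obtain ⟨S, hS, hc, u, vs, h1, h2, ⟨g, hg, h3⟩, h4, h5, h6, h7⟩ := redN hbA' hbB hAB' a hx1 hσ
      have haS : a ∉ S := by
        intro h
        have := h7 h
        have h10 : S.card = A.card + 1 := by rw [this, Finset.card_insert_of_notMem haA]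
        omega
      have hSA : S ⊆ A := by
        intro i hi
        rcases Finset.mem_insert.mp (hS hi) with rfl | h
        · exact absurd hi haS
        · exact h
      have hbS : b ∉ S := fun h => hbA (hSA h)
      have hL := ilA hSA h2 h4
      have hY : tauN b x u vs ∈ lev (XN F A B b) (k+2) := ⟨tauN_mem hbA hbB hL, tauN_len h1⟩
      refine ⟨tauN b x u vs, hY, ?_, g, hg, h3⟩
      intro ω hω hcω
      have hl1 := StN_le (b := b) hx1 hAB h5
      have hl2 := StN_le (b := b) hx1 hAB' h5
      have hg1 := StN_ge (x := x) hAB hbA hbB hbS hSA h4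
      have hg2 := StN_ge (x := x) hAB' hbA' hbB hbS hS h4
      rw [sdiff_ins haS] at hl2 hg2
      have hcω' := R0_mono hl2 hl1 hcω
      have hdj : Disjoint (A \ S) (B ∪ S) := dj_sdiff hAB
      have haA1 : a ∉ A \ S := fun h => haA (Finset.mem_sdiff.mp h).1
      have haB1 : a ∉ B ∪ S := by simp [haB, haS]
      have hcard : (A \ S).card = A.card - S.card := Finset.card_sdiff_of_subset hSA
      have hcle := Finset.card_le_card hSA
      by_cases hqA : q ≤ (A \ S).card
      · exact Z_of_RV hg2 hg1 (hYY hY) hY (hBV _ _ a hdj haA1 haB1 hqA) hω hcω'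
      obtain ⟨is, hnd, hisS, his⟩ := h6 (by omega)
      match is, his, hisS, hnd with
      | i1 :: is', his, hisS, hnd =>
        rw [List.map_cons, List.cons.injEq] at his
        obtain ⟨rfl, rfl⟩ := his
        have hlen : is'.length = k := by simpa using h1
        have hi1S : i1 ∈ S := by rw [← hisS]; simp
        have hisS' : ∀ j ∈ is', j ∈ S := fun j hj => by rw [← hisS]; simp [hj]
        have het : tauN b x (e i1) (is'.map e) = (f b + x • e i1) :: (f b + e i1) :: is'.map (fun j => f b + e j) := by
          simp [tauN, Function.comp_def]
        rw [het]
        have hYl : ∀ (l : List (EE F)), (∀ y ∈ l, y = f b ∨ (∃ t : F, y = f b + t • e i1) ∨ ∃ j ∈ is', y = f b + e j) → l.length = 2 + is'.length → l ∈ lev (XN F A B b) (k+2) := by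
          intro l hl hll
          refine ⟨XN_list hbA hbB hL ?_, by omega⟩
          intro y hy
          rcases hl y hy with rfl | ⟨t, rfl⟩ | ⟨j, hj, rfl⟩
          · exact ⟨e i1, by simp, 0, by simp⟩
          · exact ⟨e i1, by simp, t, rfl⟩
          · exact ⟨e j, List.mem_cons_of_mem _ (List.mem_map_of_mem hj), 1, by simp⟩
        have hbs : ∀ j ∈ S, b ≠ j := by rintro j hj rfl; exact hbS hj
        have hsub : ∀ j ∈ is', insert j (A \ S) ⊆ A := fun j hj => Finset.insert_subset (hSA (hisS' j hj)) Finset.sdiff_subset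
        have hsubB : ∀ (j : ℕ) (A2 : Finset ℕ), A ⊆ A2 → (B ∪ S).erase j ⊆ A2 ∪ insert b B := by
          intro j A2 hA2 i hi
          rcases Finset.mem_union.mp (Finset.mem_of_mem_erase hi) with h | h
          · simp [h]
          · simp [hA2 (hSA h)]
        refine Kill (A1 := A \ S) (B1 := B ∪ S) (a := a) hBV hNS (by omega) hdj haA1 haB1 hx0 hnd (by simp [hi1S]) (fun j hj => by simp [hisS' j hj]) hKK
          (fun g hg => (hg2 hg).1) (fun g hg => (hg1 hg).1) ?_ ?_ ?_ ?_ (fun l h h' => hYY (hYl l h h')) hYl ω hω hcω'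
        · exact Ga_mono (by simpa using hSA hi1S) (by simp)
        · intro j hj
          exact Ga_mono (Finset.insert_subset_insert _ (hsub j hj)) (hsubB j _ (Finset.subset_insert _ _))
        · intro j hj
          exact Ga_mono (hsub j hj) (hsubB j _ (by rfl))
        · intro g hg
          have : g • (f b : EE F) = f b := by
            rcases hg with hg | hg | ⟨j, hj, hg⟩
            · exact hg.2 b (by simp [hbs i1 hi1S]) (by simp)
            · exact hg.2 b (by simp [hbA, hab.symm]) (by simp [hbB, hbS])
            · exact hg.2 b (by simp [hbA, hab.symm, hbs j (hisS' j hj)]) (by simp [hbB, hbS])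
          exact ⟨this, this⟩)
    (by
      rintro σ hσ τ hτ ⟨g, hg, hgt⟩
      exact orbN hbA hbB hAB hσ hτ (fun j hj => hg.1 j (Finset.disjoint_right.mp hAB' hj)) hgt)
    q w hw hcw
  have h1 : ∑ τ ∈ s, In1 τ (ω τ) ∈ Zs (Ga F (insert a A) (insert b B)) (Ga F A (insert b B)) q (lev (XN F (insert a A) B b) (k+2)) (lev (XN F A B b) (k+2)) :=
    Submodule.sum_mem _ (fun τ hτ => (hs1 τ hτ).2.1 _ (hs1 τ hτ).2.2.1 (hs1 τ hτ).2.2.2)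
  have := Submodule.add_mem _ (RR_Zs hs2) h1
  simpa using this

lemma exN (A B : Finset ℕ) (b : ℕ) (hbA : b ∉ A) (hbB : b ∉ B) (hAB : Disjoint A B) (k : ℕ) (hk : k < A.card + 1) : Ex (XN F A B b) k := by
  have := ThmA (qF F) (A.card + 1) (Va F (insert b A) B) ((be (qF F)).flip (e b)) (by
    have := hyp_Va (F := F) (insert b A) B (Finset.disjoint_insert_left.mpr ⟨hbB, hAB⟩)
    rwa [Finset.card_insert_of_notMem hbA] at this) (radz_Va _ _) ⟨f b, f_Va (by simp), by
      rw [LinearMap.flip_apply, be_e, f_self]; exact one_ne_zero⟩ k hk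
  have e : IL (qF F) (fun x => x ∈ Va F (insert b A) B ∧ (be (qF F)).flip (e b) x = 1) = XN F A B b :=
    IL_congr _ fun z => by rw [LinearMap.flip_apply, be_e, PN]
  rwa [e] at this

lemma StN1 {A B : Finset ℕ} {b : ℕ} : St (Ga F A (insert b B)) [(f b : EE F)] ≤ Ga F A B := by
  rintro g ⟨hg, hs⟩
  have hfb : g • (f b : EE F) = f b := gw_fix' hs _ (by simp)
  refine ⟨hg.1, fun j hj hj' => ?_⟩
  by_cases h : j = b
  · rw [h]; exact hfb
  · exact hg.2 j hj (by simp [h, hj'])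

theorem Nstep {x : F} (hx0 : x ≠ 0) (hx1 : x ≠ 1) (D : ℕ) (hB : ∀ q < D, BV F q) (hN : ∀ q < D, NS F q) : NS F D := by
  intro A B a b hAB haA haB hbA hbB hab hD
  have hKK : Ga F A (insert b B) ≤ Ga F (insert a A) (insert b B) := Ga_mono (Finset.subset_insert _ _) Finset.subset_union_right
  rcases Nat.eq_zero_or_pos D with rfl | hpos
  · exact RS_zero hKK
  have hbA' : b ∉ insert a A := by simp [hbA, hab.symm]
  have hAB' : Disjoint (insert a A) B := Finset.disjoint_insert_left.mpr ⟨haB, hAB⟩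
  have hXX : XN F A B b ⊆ XN F (insert a A) B b := by
    refine IL_mono _ fun z hz => ⟨Va_mono ?_ Finset.subset_union_right hz.1, hz.2⟩
    exact Finset.insert_subset_insert _ (Finset.subset_insert _ _)
  have hcA : (insert a A).card = A.card + 1 := Finset.card_insert_of_notMem haA
  intro w0 hw0 hc0
  obtain ⟨ω, hω, h1, h2⟩ := D1gen hKK hXX (IL_FC _ _) (IL_FC _ _) (fun g hg σ hσ => gw_IL (fun z hz => PN_g hbA' hg hz) hσ)
    (fun g hg σ hσ => gw_IL (fun z hz => PN_g hbA hg hz) hσ) D hpos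
    (fun k hk => exN _ _ _ hbA' hbB hAB' k (by omega)) (fun k hk => exN _ _ _ hbA hbB hAB k (by omega))
    (by
      intro q k hqk w hw hc
      rcases Nat.eq_zero_or_pos q with rfl | hq
      · exact Z0_all (fun σ hσ γ => N0case hAB haA haB hbA hbB hab hx0 hx1 (by omega) hσ γ) w hw
      · exact Nqcase hAB haA haB hbA hbB hab hx0 hx1 hq (by omega) (hB q (by omega)) (hN q (by omega)) w hw hc)
    (f b) ⟨fun z hz => by rw [List.mem_singleton.mp hz]; exact ⟨PN_f _ _ _, Q_f b⟩, fun z hz z' hz' => by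
      rw [List.mem_singleton.mp hz, List.mem_singleton.mp hz']; exact be_self0 _ (Q_f b)⟩
    (fun v hv => eichN hbA' hbB hAB' (hv.1 v (by simp)).1 (hv.1 v (by simp)).2)
    (fun v hv => eichN hbA hbB hAB (hv.1 v (by simp)).1 (hv.1 v (by simp)).2) w0 hw0 hc0
  exact ⟨ω, hω, R0_mono StN1 StN1 h1, 0, Submodule.zero_mem _, by rw [map_zero, sub_zero]; exact h2⟩

end nstep
end HS

set_option linter.all false
namespace HS
open Finsupp
section bstep
variable {F : Type} [Field F]

variable (F) in
def PB (A : Finset ℕ) (z : EE F) : Prop := z ∈ Va F A ∅ ∧ z ≠ 0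
variable (F) in
def XB (A : Finset ℕ) : Set (List (EE F)) := IL (qF F) (PB F A)

noncomputable def tauB (x : F) (c u : EE F) (vs : List (EE F)) : List (EE F) := (c + x • u) :: (c + u) :: vs

lemma tauB_gw {x : F} {c u : EE F} {vs : List (EE F)} {g : GG F} : gw g (tauB x c u vs) = tauB x (g • c) (g • u) (gw g vs) := by
  simp only [tauB, gw, List.map_cons, g_add, g_smul]
lemma tauB_len {x : F} {c u : EE F} {vs : List (EE F)} {k : ℕ} (h : vs.length = k) : (tauB x c u vs).length = k + 2 := by
  simp [tauB, h]

lemma PB_g {A : Finset ℕ} {g : GG F} (hg : g ∈ Ga F A ∅) {z : EE F} (hz : PB F A z) : PB F A (g • z) :=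
  ⟨Ga_Va hg hz.1, fun h => hz.2 (by rwa [← g_zero g, smul_left_cancel_iff] at h)⟩

lemma dje (A : Finset ℕ) : Disjoint A (∅ : Finset ℕ) := Finset.disjoint_empty_right _

lemma redB' {A : Finset ℕ} (a : ℕ) (x : F) {c u : EE F} {vs : List (EE F)} 
    (hL : c :: u :: vs ∈ IL (qF F) (fun x => x ∈ Va F A ∅)) :
    ∃ S ⊆ A, S.card ≤ vs.length + 2 ∧ ∃ c' u' vs', vs'.length = vs.length ∧ c' :: u' :: vs' ∈ IL (qF F) (fun x => x ∈ Va F A ∅) ∧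
      (∃ g ∈ Ga F A ∅, gw g (tauB x c' u' vs') = tauB x c u vs) ∧ (∀ v ∈ c' :: u' :: vs', v ∈ Va F ∅ (∅ ∪ S)) ∧
      (∀ j ∈ S, (e j : EE F) ∈ SB ∅ (c' :: u' :: vs')) ∧ (c ∈ vs → S.card ≤ vs.length + 1) ∧
      (S.card = vs.length + 2 → ∃ is : List ℕ, is.Nodup ∧ is.toFinset = S ∧ c' :: u' :: vs' = is.map e) ∧ (a ∈ S → S = A) := by
  obtain ⟨h, hh, S, hS, hc, h1, h2, h3, h4⟩ := NF (dje A) a (c :: u :: vs) hL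
  rw [List.length_cons, List.length_cons] at hc h3
  have hgw : gw h (c :: u :: vs) = h • c :: h • u :: gw h vs := rfl
  rw [hgw] at h1 h2 h3
  refine ⟨S, hS, hc, h • c, h • u, gw h vs, by simp [gw], gw_IL (fun x hx => Ga_Va hh hx) hL, ⟨h⁻¹, Subgroup.inv_mem _ hh, gw_inv tauB_gw⟩, h1, h2, ?_, h3, h4⟩
  intro h0
  by_contra hcon
  obtain ⟨is, hnd, -, h5⟩ := h3 (by omega)
  have hinj : Function.Injective (e : ℕ → EE F) := by
    intro i j hij
    by_contra hne
    have := congrArg (fun v : EE F => (v i).1) hij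
    simp [e_self, e_ne hne] at this
  have : (is.map (e : ℕ → EE F)).Nodup := hnd.map hinj
  rw [← h5] at this
  exact (List.nodup_cons.mp this).1 (List.mem_cons_of_mem _ (gw_mem h0))

lemma redB {A : Finset ℕ} (a : ℕ) {x : F} (hx1 : x ≠ 1) {σ : List (EE F)} {k : ℕ} (hσ : σ ∈ lev (XB F A) (k+2)) :
    ∃ S ⊆ A, S.card ≤ k + 2 ∧ ∃ c' u' vs', vs'.length = k ∧ c' :: u' :: vs' ∈ IL (qF F) (fun x => x ∈ Va F A ∅) ∧
      (∃ g ∈ Ga F A ∅, gw g (tauB x c' u' vs') = σ) ∧ (∀ v ∈ c' :: u' :: vs', v ∈ Va F ∅ (∅ ∪ S)) ∧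
      (∀ j ∈ S, (e j : EE F) ∈ SB ∅ (c' :: u' :: vs')) ∧
      (S.card = k + 2 → ∃ is : List ℕ, is.Nodup ∧ is.toFinset = S ∧ c' :: u' :: vs' = is.map e) ∧ (a ∈ S → S = A) := by
  obtain ⟨hσ, hl⟩ := hσ
  match σ, hl, hσ with
  | z0 :: z1 :: zs, hl, hz =>
    have hl' : zs.length = k := by simpa using hl
    have hx : x - 1 ≠ 0 := sub_ne_zero.mpr hx1
    set u : EE F := (x - 1)⁻¹ • (z0 - z1) with hu
    set c : EE F := z1 - u with hc
    have hbe : ∀ y ∈ z0 :: z1 :: zs, be (qF F) u y = 0 := by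
      intro y hy
      simp only [hu, map_sub, map_smul, LinearMap.sub_apply, LinearMap.smul_apply, hz.2 z0 (by simp) y hy, hz.2 z1 (by simp) y hy]
      simp
    have hbec : ∀ y ∈ z0 :: z1 :: zs, be (qF F) c y = 0 := by
      intro y hy
      simp only [hc, map_sub, LinearMap.sub_apply, hbe y hy, hz.2 z1 (by simp) y hy]
      simp
    have hQu : qF F u = 0 := by
      rw [hu, Q_smul, Q_sub, (hz.1 z0 (by simp)).2, (hz.1 z1 (by simp)).2, hz.2 z0 (by simp) z1 (by simp)]; simp
    have hQc : qF F c = 0 := by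
      rw [hc, Q_sub, hQu, (hz.1 z1 (by simp)).2, be_comm, hbe z1 (by simp)]; simp
    have hcu : be (qF F) c u = 0 := by
      rw [hu, map_smul, map_sub, hbec z0 (by simp), hbec z1 (by simp)]; simp
    have huV : u ∈ Va F A ∅ := Submodule.smul_mem _ _ (Submodule.sub_mem _ (hz.1 z0 (by simp)).1.1 (hz.1 z1 (by simp)).1.1)
    have hcV : c ∈ Va F A ∅ := Submodule.sub_mem _ (hz.1 z1 (by simp)).1.1 huV
    have hL : c :: u :: zs ∈ IL (qF F) (fun x => x ∈ Va F A ∅) := by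
      refine IL_cons _ hcV hQc (IL_cons _ huV hQu ?_ ?_) ?_
      · exact IL_mono _ (fun x hx => hx.1) ((IL_FC _ _) _ hz zs ((List.sublist_cons_self _ _).trans (List.sublist_cons_self _ _)))
      · exact fun y hy => hbe y (by simp [hy])
      · intro y hy
        rcases List.mem_cons.mp hy with rfl | hy
        · exact hcu
        · exact hbec y (by simp [hy])
    have ht : tauB x c u zs = z0 :: z1 :: zs := by
      have e1 : c + u = z1 := by rw [hc]; abel
      have e2 : c + x • u = z0 := by
        have h3 : (x - 1) • u = z0 - z1 := by rw [hu, smul_smul, mul_inv_cancel₀ hx, one_smul]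
        have h4 : c + x • u = z1 + (x - 1) • u := by rw [hc, sub_smul, one_smul]; abel
        rw [h4, h3]; abel
      rw [tauB, e1, e2]
    obtain ⟨S, hS, hc, c', u', vs', h1, h2, ⟨g', hg', h3⟩, h4, h5, -, h6, h7⟩ := redB' a x hL
    rw [hl'] at h1 h6 hc
    exact ⟨S, hS, hc, c', u', vs', h1, h2, ⟨g', hg', by rw [h3, ht]⟩, h4, h5, h6, h7⟩

/-- stabilizers -/
lemma StB_le {A S : Finset ℕ} {x : F} (hx1 : x ≠ 1) {c u : EE F} {vs : List (EE F)} 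
    (hSB : ∀ j ∈ S, (e j : EE F) ∈ SB ∅ (c :: u :: vs)) : St (Ga F A ∅) (tauB x c u vs) ≤ Ga F (A \ S) (∅ ∪ S) := by
  rintro g ⟨hg, hs⟩
  have hfix := gw_fix' hs
  have hx : x - 1 ≠ 0 := sub_ne_zero.mpr hx1
  have h0 := hfix (c + x • u) (by simp [tauB])
  have h1 := hfix (c + u) (by simp [tauB])
  have hu : g • u = u := by
    have h2 : (x - 1) • (g • u) = (x - 1) • u := by
      have e : ∀ w : EE F, (x - 1) • w = (c + x • w) - (c + w) := fun w => by rw [sub_smul, one_smul]; abel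
      rw [← g_smul, e u, g_sub, h0, h1]
    exact smul_right_injective _ hx h2
  have hfb : g • c = c := by
    rw [g_add, hu] at h1; exact add_right_cancel h1
  have hv : ∀ v ∈ c :: u :: vs, g • v = v := by
    intro v hv
    rcases List.mem_cons.mp hv with rfl | hv
    · exact hfb
    rcases List.mem_cons.mp hv with rfl | hv
    · exact hu
    · exact hfix v (by simp [tauB, hv])
  have hS : ∀ j ∈ S, g • (e j : EE F) = e j := fun j hj => SB_fix (by simp) hv (hSB j hj)
  refine ⟨fun j hj => ?_, fun j hj hj' => ?_⟩
  · by_cases h : j ∈ S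
    · exact hS j h
    · exact hg.1 j (fun h' => hj (Finset.mem_sdiff.mpr ⟨h', h⟩))
  · have h : j ∉ S := fun h => hj' (Finset.mem_union_right _ h)
    exact hg.2 j (fun h' => hj (Finset.mem_sdiff.mpr ⟨h', h⟩)) (by simp)

lemma StB_ge {A S : Finset ℕ} {x : F} {c u : EE F} {vs : List (EE F)} 
    (hS : S ⊆ A) (hV : ∀ v ∈ c :: u :: vs, v ∈ Va F ∅ (∅ ∪ S)) : Ga F (A \ S) (∅ ∪ S) ≤ St (Ga F A ∅) (tauB x c u vs) := by
  intro g hg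
  have hv : ∀ v ∈ c :: u :: vs, g • v = v := fun v hv =>
    fixV (fun j hj => hg.1 j (Finset.disjoint_right.mp (dj_sdiff (dje A)) hj)) (hV v hv)
  refine ⟨Ga_sdiff hS hg, ?_⟩
  rw [tauB_gw, hv c (by simp), hv u (by simp), gw_fix (fun v h => hv v (by simp [h]))]

lemma XB_list {A : Finset ℕ} {L : List (EE F)} (hL : L ∈ IL (qF F) (fun x => x ∈ Va F A ∅))
    {l : List (EE F)} (hl : ∀ y ∈ l, y ≠ 0 ∧ ((∃ v ∈ L, ∃ v' ∈ L, ∃ t : F, y = v + t • v') ∨ y ∈ L)) : l ∈ XB F A := by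
  have key : ∀ y, ((∃ v ∈ L, ∃ v' ∈ L, ∃ t : F, y = v + t • v') ∨ y ∈ L) → (y ∈ Va F A ∅ ∧ qF F y = 0) ∧ ∀ z ∈ L, be (qF F) y z = 0 := by
    rintro y (⟨v, hv, v', hv', t, rfl⟩ | hy)
    · refine ⟨⟨Submodule.add_mem _ (hL.1 v hv).1 (Submodule.smul_mem _ _ (hL.1 v' hv').1), ?_⟩, fun z hz => ?_⟩
      · rw [Q_add, Q_smul, (hL.1 v hv).2, (hL.1 v' hv').2, map_smul, hL.2 v hv v' hv']; simp
      · simp [hL.2 v hv z hz, hL.2 v' hv' z hz]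
    · exact ⟨⟨(hL.1 y hy).1, (hL.1 y hy).2⟩, fun z hz => hL.2 y hy z hz⟩
  refine ⟨fun y hy => ⟨⟨(key y (hl y hy).2).1.1, (hl y hy).1⟩, (key y (hl y hy).2).1.2⟩, fun y hy y' hy' => ?_⟩
  have h1 := (key y (hl y hy).2).2
  rcases (hl y' hy').2 with ⟨v, hv, v', hv', t, rfl⟩ | h
  · simp [h1 v hv, h1 v' hv']
  · exact h1 y' h

lemma ei_ne {i0 i1 : ℕ} (h : i0 ≠ i1) (t : F) : (e i0 + t • e i1 : EE F) ≠ 0 := by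
  intro h0
  have := congrArg (fun v : EE F => (v i0).1) h0
  simp [e_self, e_ne h] at this

/-- entries of tau are nonzero if it is in the orbit of a simplex -/
lemma XB_of_gw {A A' : Finset ℕ} {c u : EE F} {vs σ : List (EE F)} {x : F} {g : GG F} (hL : c :: u :: vs ∈ IL (qF F) (fun x => x ∈ Va F A ∅))
    (h : gw g (tauB x c u vs) = σ) (hσ : ∀ z ∈ σ, z ≠ 0) : tauB x c u vs ∈ XB F A := by
  refine XB_list hL (fun y hy => ⟨fun h0 => hσ (g • y) (by rw [← h]; exact gw_mem hy) (by rw [h0, g_zero]), ?_⟩)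
  simp only [tauB, List.mem_cons] at hy
  rcases hy with rfl | rfl | hy
  · exact Or.inl ⟨c, by simp, u, by simp, x, rfl⟩
  · exact Or.inl ⟨c, by simp, u, by simp, 1, by simp⟩
  · exact Or.inr (by simp [hy])

set_option maxHeartbeats 1000000 in
lemma B0case {A : Finset ℕ} {a : ℕ} (haA : a ∉ A) 
    {x : F} (hx0 : x ≠ 0) (hx1 : x ≠ 1) {k : ℕ} (hk : k + 1 ≤ A.card) {σ : List (EE F)} (hσ : σ ∈ lev (XB F (insert a A)) (k+2)) (γ : GG F) :
    In1 σ (sg [γ], 0) ∈ Zs (Ga F (insert a A) ∅) (Ga F A ∅) 0 (lev (XB F (insert a A)) (k+2)) (lev (XB F A) (k+2)) := by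
  have hYY : lev (XB F A) (k+2) ⊆ lev (XB F (insert a A)) (k+2) := by
    refine lev_mono (IL_mono _ fun z hz => ⟨Va_mono (Finset.subset_insert _ _) Finset.subset_union_right hz.1, hz.2⟩) _
  have hin : ∀ (S : Finset ℕ) (c u : EE F) (vs σ : List (EE F)) (g : GG F), S ⊆ insert a A → a ∉ S → vs.length = k → (∀ z ∈ σ, z ≠ 0) →
      gw g (tauB x c u vs) = σ →
      c :: u :: vs ∈ IL (qF F) (fun x => x ∈ Va F (insert a A) ∅) → (∀ v ∈ c :: u :: vs, v ∈ Va F ∅ (∅ ∪ S)) → tauB x c u vs ∈ lev (XB F A) (k+2) := by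
    intro S c u vs σ g hS haS hl hσ hg hL hv
    refine ⟨XB_of_gw (A' := A) (ilA ?_ hL hv) hg hσ, tauB_len hl⟩
    intro i hi
    rcases Finset.mem_insert.mp (hS hi) with rfl | h
    · exact absurd hi haS
    · exact h
  obtain ⟨S, hS, hc, c, u, vs, h1, h2, ⟨g, hg, h3⟩, h4, h5, h6, h7⟩ := redB a hx1 hσ
  have hσ0 : ∀ z ∈ σ, z ≠ 0 := fun z hz => (hσ.1.1 z hz).1.2
  by_cases haS : a ∈ S
  swap
  · exact Z0_inX hYY (hin S c u vs σ g hS haS h1 hσ0 h3 h2 h4) hg h3 γ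
  have hSA := h7 haS
  have hcS : S.card = A.card + 1 := by rw [hSA, Finset.card_insert_of_notMem haA]
  obtain ⟨is, hnd, hisS, his⟩ := h6 (by omega)
  have hmv := Z0_mid (K := Ga F A ∅) (Y := lev (XB F A) (k+2)) σ (tauB x c u vs) hg h3 hσ γ
  suffices hs : In1 (tauB x c u vs) (sg [γ], 0) ∈ Zs (Ga F (insert a A) ∅) (Ga F A ∅) 0 (lev (XB F (insert a A)) (k+2)) (lev (XB F A) (k+2)) by
    have := Submodule.sub_mem _ hs hmv
    convert this using 1
    abel
  clear hmv
  match is, his, hisS, hnd with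
  | i0 :: i1 :: is', his, hisS, hnd =>
    rw [List.map_cons, List.map_cons, List.cons.injEq, List.cons.injEq] at his
    obtain ⟨rfl, rfl, rfl⟩ := his
    have hlen : is'.length = k := by simpa using h1
    have hi1S : i1 ∈ insert a A := by rw [← hSA, ← hisS]; simp
    have hi0S : i0 ∈ insert a A := by rw [← hSA, ← hisS]; simp
    obtain ⟨hni0, hnd'⟩ := List.nodup_cons.mp hnd
    obtain ⟨hni, hnd''⟩ := List.nodup_cons.mp hnd'
    have h01 : i0 ≠ i1 := by rintro rfl; simp at hni0
    rw [tauB]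
    apply Z_face _ _ (e i0)
    · obtain ⟨t, ht, hte, htf⟩ := torus_exists (F := F) i1 x hx0
      have htfb : t • (e i0 : EE F) = e i0 := ht.1 i0 (by simp [h01])
      refine Z0_mid _ _ (g := t) (Ga_mono (by simpa using hi1S) (by simp) ht) ?_ ?_ γ
      · show t • (e i0 + e i1) :: t • e i0 :: gw t _ = _
        rw [g_add, htfb, hte, gw_fix]
        intro y hy
        simp only [List.mem_map] at hy
        obtain ⟨j, hj, rfl⟩ := hy
        rw [ht.1 j]
        simp; rintro rfl; exact hni hj
      · refine ⟨XB_list h2 ?_, by simp [hlen]⟩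
        intro y hy
        simp only [List.mem_cons, List.mem_map] at hy
        rcases hy with rfl | rfl | ⟨j, hj, rfl⟩
        · exact ⟨ei_ne h01 x, Or.inl ⟨e i0, by simp, e i1, by simp, x, rfl⟩⟩
        · exact ⟨e_ne_zero i0, Or.inr (by simp)⟩
        · exact ⟨e_ne_zero j, Or.inr (List.mem_cons_of_mem _ (List.mem_cons_of_mem _ (List.mem_map_of_mem hj)))⟩
    · intro l' hl' hws
      rw [List.length_map, hlen] at hws
      have he : (e i0 + x • e i1) :: (e i0 + e i1) :: e i0 :: l' = tauB x (e i0) (e i1) ((e i0 : EE F) :: l') := rfl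
      rw [he]
      have hL : e i0 :: e i1 :: (e i0 : EE F) :: l' ∈ IL (qF F) (fun x => x ∈ Va F (insert a A) ∅) := by
        have h8 := (IL_FC _ _) _ h2 (e i0 :: e i1 :: l') ((hl'.cons_cons _).cons_cons _)
        refine ⟨fun y hy => h8.1 y ?_, fun y hy y' hy' => h8.2 y ?_ y' ?_⟩ <;> simp only [List.mem_cons] at * <;> tauto
      have hlen2 : ((e i0 : EE F) :: l').length = k := by simpa using hws
      obtain ⟨S2, hS2, hc2, c2, u2, vs2, j1, j2, ⟨g2, hg2, j3⟩, j4, j5, j6, j7, j8⟩ := redB' a x hL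
      have j6' := j6 (by simp)
      rw [hlen2] at j6' j1
      have ha2 : a ∉ S2 := by
        intro h
        have := j8 h
        have h10 : S2.card = A.card + 1 := by rw [this, Finset.card_insert_of_notMem haA]
        omega
      refine Z0_inX hYY (hin S2 c2 u2 vs2 _ g2 hS2 ha2 j1 ?_ j3 j2 j4) hg2 j3 γ
      intro z hz
      simp only [tauB, List.mem_cons] at hz
      rcases hz with rfl | rfl | rfl | hz
      · exact ei_ne h01 x
      · have := ei_ne (F := F) h01 1
        rwa [one_smul] at this
      · exact e_ne_zero i0
      · obtain ⟨j, -, rfl⟩ := List.mem_map.mp (hl'.subset hz)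
        exact e_ne_zero j

set_option maxHeartbeats 1000000 in
lemma Bqcase {A : Finset ℕ} {a : ℕ} (haA : a ∉ A) 
    {x : F} (hx0 : x ≠ 0) (hx1 : x ≠ 1) {q k : ℕ} (hq : 1 ≤ q) (hk : q + (k + 1) ≤ A.card) (hBV : BV F q) (hNS : NS F q) 
    (w : MP (GG F) (EE F)) (hw : w ∈ dg q (lev (XB F (insert a A)) (k+2)) (lev (XB F A) (k+2))) 
    (hcw : cD1 w ∈ RR (EE F) (Ga F (insert a A) ∅) (Ga F A ∅)) :
    w ∈ Zs (Ga F (insert a A) ∅) (Ga F A ∅) q (lev (XB F (insert a A)) (k+2)) (lev (XB F A) (k+2)) := by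
  have hKK : Ga F A ∅ ≤ Ga F (insert a A) ∅ := Ga_mono (Finset.subset_insert _ _) Finset.subset_union_right
  have hYY : lev (XB F A) (k+2) ⊆ lev (XB F (insert a A)) (k+2) := by
    refine lev_mono (IL_mono _ fun z hz => ⟨Va_mono (Finset.subset_insert _ _) Finset.subset_union_right hz.1, hz.2⟩) _
  obtain ⟨s, ω, hs1, hs2⟩ := orbit_lemma hKK hYY (fun g hg σ hσ => ⟨gw_IL (fun z hz => PB_g hg hz) hσ.1, by simpa [gw] using hσ.2⟩)
    (fun g hg σ hσ => ⟨gw_IL (fun z hz => PB_g hg hz) hσ.1, by simpa [gw] using hσ.2⟩)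
    (fun τ => ∀ ω ∈ dg0 q, cd ω ∈ R0 (St (Ga F (insert a A) ∅) τ) (St (Ga F A ∅) τ) → 
      In1 τ ω ∈ Zs (Ga F (insert a A) ∅) (Ga F A ∅) q (lev (XB F (insert a A)) (k+2)) (lev (XB F A) (k+2)))
    (by
      intro σ hσ
      obtain ⟨S, hS, hc, c, u, vs, h1, h2, ⟨g, hg, h3⟩, h4, h5, h6, h7⟩ := redB a hx1 hσ
      have hσ0 : ∀ z ∈ σ, z ≠ 0 := fun z hz => (hσ.1.1 z hz).1.2
      have haS : a ∉ S := by
        intro h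
        have := h7 h
        have h10 : S.card = A.card + 1 := by rw [this, Finset.card_insert_of_notMem haA]
        omega
      have hSA : S ⊆ A := by
        intro i hi
        rcases Finset.mem_insert.mp (hS hi) with rfl | h
        · exact absurd hi haS
        · exact h
      have hL := ilA hSA h2 h4
      have hY : tauB x c u vs ∈ lev (XB F A) (k+2) := ⟨XB_of_gw (A' := A) hL h3 hσ0, tauB_len h1⟩
      refine ⟨tauB x c u vs, hY, ?_, g, hg, h3⟩
      intro ω hω hcω
      have hl1 := StB_le (A := A) hx1 h5
      have hl2 := StB_le (A := insert a A) hx1 h5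
      have hg1 := StB_ge (x := x) hSA h4
      have hg2 := StB_ge (x := x) hS h4
      rw [sdiff_ins haS] at hl2 hg2
      have hcω' := R0_mono hl2 hl1 hcω
      have hdj : Disjoint (A \ S) (∅ ∪ S) := dj_sdiff (dje A)
      have haA1 : a ∉ A \ S := fun h => haA (Finset.mem_sdiff.mp h).1
      have haB1 : a ∉ ∅ ∪ S := by simp [haS]
      have hcard : (A \ S).card = A.card - S.card := Finset.card_sdiff_of_subset hSA
      have hcle := Finset.card_le_card hSA
      by_cases hqA : q ≤ (A \ S).card
      · exact Z_of_RV hg2 hg1 (hYY hY) hY (hBV _ _ a hdj haA1 haB1 hqA) hω hcω'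
      obtain ⟨is, hnd, hisS, his⟩ := h6 (by omega)
      match is, his, hisS, hnd with
      | i0 :: i1 :: is', his, hisS, hnd =>
        rw [List.map_cons, List.map_cons, List.cons.injEq, List.cons.injEq] at his
        obtain ⟨rfl, rfl, rfl⟩ := his
        have hlen : is'.length = k := by simpa using h1
        have hi1S : i1 ∈ S := by rw [← hisS]; simp
        have hi0S : i0 ∈ S := by rw [← hisS]; simp
        have hisS' : ∀ j ∈ is', j ∈ S := fun j hj => by rw [← hisS]; simp [hj]
        obtain ⟨hni0, hnd'⟩ := List.nodup_cons.mp hnd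
        have h01 : i0 ≠ i1 := by rintro rfl; simp at hni0
        have h0j : ∀ j ∈ is', i0 ≠ j := by rintro j hj rfl; simp [hj] at hni0
        have h0a : i0 ≠ a := by rintro rfl; exact haS hi0S
        have het : tauB x (e i0) (e i1) (is'.map e) = (e i0 + x • e i1) :: (e i0 + e i1) :: is'.map (fun j => (0 : EE F) + e j) := by
          simp [tauB]
        rw [het]
        have hYl : ∀ (l : List (EE F)), (∀ y ∈ l, y = e i0 ∨ (∃ t : F, y = e i0 + t • e i1) ∨ ∃ j ∈ is', y = 0 + e j) → l.length = 2 + is'.length → l ∈ lev (XB F A) (k+2) := by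
          intro l hl hll
          refine ⟨XB_list hL ?_, by omega⟩
          intro y hy
          rcases hl y hy with rfl | ⟨t, rfl⟩ | ⟨j, hj, rfl⟩
          · exact ⟨e_ne_zero i0, Or.inr (by simp)⟩
          · exact ⟨ei_ne h01 t, Or.inl ⟨e i0, by simp, e i1, by simp, t, rfl⟩⟩
          · rw [zero_add]
            exact ⟨e_ne_zero j, Or.inr (List.mem_cons_of_mem _ (List.mem_cons_of_mem _ (List.mem_map_of_mem hj)))⟩
        have hsub : ∀ j ∈ is', insert j (A \ S) ⊆ A := fun j hj => Finset.insert_subset (hSA (hisS' j hj)) Finset.sdiff_subset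
        have hsubB : ∀ (j : ℕ) (A2 : Finset ℕ), A ⊆ A2 → (∅ ∪ S).erase j ⊆ A2 ∪ ∅ := by
          intro j A2 hA2 i hi
          rcases Finset.mem_union.mp (Finset.mem_of_mem_erase hi) with h | h
          · simp at h
          · simp [hA2 (hSA h)]
        refine Kill (A1 := A \ S) (B1 := ∅ ∪ S) (a := a) hBV hNS (by omega) hdj haA1 haB1 hx0 hnd' (by simp [hi1S]) (fun j hj => by simp [hisS' j hj]) hKK
          (fun g hg => (hg2 hg).1) (fun g hg => (hg1 hg).1) ?_ ?_ ?_ ?_ (fun l h h' => hYY (hYl l h h')) hYl ω hω hcω'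
        · exact Ga_mono (by simpa using hSA hi1S) (by simp)
        · intro j hj
          exact Ga_mono (Finset.insert_subset_insert _ (hsub j hj)) (hsubB j _ (Finset.subset_insert _ _))
        · intro j hj
          exact Ga_mono (hsub j hj) (hsubB j _ (by rfl))
        · intro g hg
          have : g • (e i0 : EE F) = e i0 := by
            rcases hg with hg | hg | ⟨j, hj, hg⟩
            · exact hg.1 i0 (by simp [h01])
            · exact hg.1 i0 (by simp [h0a, hi0S])
            · exact hg.1 i0 (by simp [h0a, hi0S, h0j j hj])
          exact ⟨this, g_zero g⟩)
    (by
      rintro σ hσ τ hτ ⟨g, hg, hgt⟩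
      have h1 := ORB (dje A) τ g (by simp) (IL_mono _ (fun z hz => hz.1) hτ.1) (by rw [hgt]; exact IL_mono _ (fun z hz => hz.1) hσ.1)
      rwa [hgt] at h1)
    q w hw hcw
  have h1 : ∑ τ ∈ s, In1 τ (ω τ) ∈ Zs (Ga F (insert a A) ∅) (Ga F A ∅) q (lev (XB F (insert a A)) (k+2)) (lev (XB F A) (k+2)) :=
    Submodule.sum_mem _ (fun τ hτ => (hs1 τ hτ).2.1 _ (hs1 τ hτ).2.2.1 (hs1 τ hτ).2.2.2)
  have := Submodule.add_mem _ (RR_Zs hs2) h1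
  simpa using this

lemma StB1 {A : Finset ℕ} {i : ℕ} : St (Ga F A ∅) [(e i : EE F)] ≤ Ga F (A.erase i) {i} := by
  rintro g ⟨hg, hs⟩
  have hfb : g • (e i : EE F) = e i := gw_fix' hs _ (by simp)
  refine ⟨fun j hj => ?_, fun j hj hj' => ?_⟩
  · by_cases h : j = i
    · rw [h]; exact hfb
    · exact hg.1 j (by simpa [h] using hj)
  · have h : j ≠ i := by simpa using hj'
    exact hg.2 j (by simpa [h] using hj) (by simp)

lemma trB {A : Finset ℕ} {i : ℕ} (hi : i ∈ A) (v : EE F) (hv : [v] ∈ XB F A) : ∃ g ∈ Ga F A ∅, g • (e i : EE F) = v := by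
  obtain ⟨⟨h1, h2⟩, h3⟩ := hv.1 v (by simp)
  obtain ⟨g, hg, hgv⟩ := move (dje A) h1 h3 (by
    by_contra hcon
    push Not at hcon
    apply h2
    ext j : 1
    by_cases hj : j ∈ A
    · exact hcon j hj
    · exact Prod.ext (h1.2 j hj (by simp)) (h1.1 j hj)) hi
  exact ⟨g⁻¹, Subgroup.inv_mem _ hg, by rw [← hgv, inv_smul_smul]⟩

/-- reduction to the cone of the smaller pair -/
lemma Bred {x : F} (hx0 : x ≠ 0) (hx1 : x ≠ 1) (D : ℕ) (hD : 1 ≤ D) (hB : ∀ q < D, BV F q) (hN : ∀ q ≤ D, NS F q) (A : Finset ℕ) (a i : ℕ)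
    (haA : a ∉ A) (hi : i ∈ A) (hDA : D ≤ A.card) :
    RS (Ga F (insert a A) ∅) (Ga F A ∅) (Ga F (insert a (A.erase i)) ∅) (Ga F (A.erase i) ∅) D := by
  have hKK : Ga F A ∅ ≤ Ga F (insert a A) ∅ := Ga_mono (Finset.subset_insert _ _) Finset.subset_union_right
  have hXX : XB F A ⊆ XB F (insert a A) :=
    IL_mono _ fun z hz => ⟨Va_mono (Finset.subset_insert _ _) Finset.subset_union_right hz.1, hz.2⟩
  have hcA : (insert a A).card = A.card + 1 := Finset.card_insert_of_notMem haA
  have hai : a ≠ i := by rintro rfl; exact haA hi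
  intro w0 hw0 hc0
  obtain ⟨ω, hω, h1, h2⟩ := D1gen hKK hXX (IL_FC _ _) (IL_FC _ _) (fun g hg σ hσ => gw_IL (fun z hz => PB_g hg hz) hσ)
    (fun g hg σ hσ => gw_IL (fun z hz => PB_g hg hz) hσ) D hD
    (fun k hk => ThmK (qF F) _ _ (hyp_Va _ _ (dje _)) k (by omega)) (fun k hk => ThmK (qF F) _ _ (hyp_Va _ _ (dje _)) k (by omega))
    (by
      intro q k hqk w hw hc
      rcases Nat.eq_zero_or_pos q with rfl | hq
      · exact Z0_all (fun σ hσ γ => B0case haA hx0 hx1 (by omega) hσ γ) w hw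
      · exact Bqcase haA hx0 hx1 hq (by omega) (hB q (by omega)) (hN q (by omega)) w hw hc)
    (e i) ⟨fun z hz => by rw [List.mem_singleton.mp hz]; exact ⟨⟨e_Va (Or.inl hi), e_ne_zero i⟩, Q_e i⟩, fun z hz z' hz' => by
      rw [List.mem_singleton.mp hz, List.mem_singleton.mp hz']; exact be_self0 _ (Q_e i)⟩
    (fun v hv => trB (by simp [hi]) v hv) (fun v hv => trB hi v hv) w0 hw0 hc0
  have h3 := R0_mono StB1 StB1 h1
  rw [Finset.erase_insert_of_ne hai] at h3
  have hS := hN D le_rfl (A.erase i) ∅ a i (dje _) (by simp [haA]) (by simp) (by simp) (by simp) hai (by rw [Finset.card_erase_of_mem hi]; omega)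
  obtain ⟨ω1, hω1, hc1, y, hy, h4⟩ := hS ω hω h3
  refine ⟨ω1, hω1, hc1, y, hy, ?_⟩
  have h5 := Submodule.add_mem _ h2 (R0_mono (L' := Ga F (insert a A) ∅) (L := Ga F A ∅) (Ga_mono (Finset.insert_subset_insert _ (Finset.erase_subset _ _)) (by simp [hi]))
    (Ga_mono (Finset.erase_subset _ _) (by simp [hi])) h4)
  convert h5 using 1
  abel

end bstep
end HS

set_option linter.all false
namespace HS
open Finsupp

section swap
variable {G : Type} [Group G]

lemma gl_N0 {K K' : Subgroup G} {g : G} (hg : ∀ k ∈ K, g * k * g⁻¹ ∈ K') {x : LC G} (hx : x ∈ N0 K) : mp (gl g) x ∈ N0 K' := by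
  refine N0_le (mp (gl g)) _ ?_ ?_ x hx
  · intro k hk l
    rw [lx_sg, lx_sg]
    have e : gl g (gl k l) = gl (g * k * g⁻¹) (gl g l) := by
      rw [← gl_mul, ← gl_mul]; congr 1; group
    rw [e]; exact N0_gen (hg k hk) _
  · rw [lx_sg]; exact N0_nil

lemma gl_len (g : G) {q : ℕ} {x : LC G} (hx : x ∈ sp {l : List G | l.length = q}) : mp (gl g) x ∈ sp {l : List G | l.length = q} := by
  refine sp_le (mp (gl g)) _ ?_ x hx
  intro l hl
  rw [lx_sg]
  exact sg_mem_sp (s := {l : List G | l.length = q}) (by simpa [gl] using hl)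

lemma mp_gl_mul (g h : G) (x : LC G) : mp (gl (g * h)) x = mp (gl g) (mp (gl h) x) := by
  refine lhom_congr (α := List G) (M := LC G) (f := mp (gl (g * h))) (g := LinearMap.comp (mp (gl g)) (mp (gl h))) ?_ x
  intro l
  rw [LinearMap.comp_apply, lx_sg, lx_sg, lx_sg, gl_mul]

noncomputable def Wsub (K' K : Subgroup G) (D : ℕ) : Submodule ℤ (LC G) :=
  (N0 K' ⊔ (sp {l : List G | l.length = D + 2}).map bd) ⊔ (sp {l : List G | l.length = D + 1} ⊓ (N0 K).comap bd)

lemma theta_mul {K' K K1 C : Subgroup G} (hK1 : K1 ≤ K) (hC : C ≤ K') (hcen : ∀ g ∈ C, ∀ k ∈ K1, g * k = k * g) {D : ℕ} {x : LC G}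
    (hx : x ∈ sp {l : List G | l.length = D}) (hbx : bd x ∈ N0 K1) {g h : G} (hg : g ∈ C) (hh : h ∈ C) :
    pr (fun y => (g * h) * y) x - pr (fun y => g * y) x - pr (fun y => h * y) x ∈ Wsub K' K D := by
  have e : pr (fun y => (g * h) * y) x - pr (fun y => g * y) x - pr (fun y => h * y) x
    = (mp (gl g) (pr (fun y => h * y) x) - pr (fun y => h * y) x) +
      (pr (fun y => (g * h) * y) x - pr (fun y => g * y) x - mp (gl g) (pr (fun y => h * y) x)) := by abel
  rw [e]
  refine Submodule.add_mem _ (Submodule.mem_sup_left (Submodule.mem_sup_left (N0_tr (hC hg) _))) (Submodule.mem_sup_right ⟨?_, ?_⟩)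
  · exact Submodule.sub_mem _ (Submodule.sub_mem _ (pr_len _ hx) (pr_len _ hx)) (gl_len _ (pr_len _ hx))
  · show bd _ ∈ N0 K
    have h1 := prism (fun y => (g * h) * y) x
    have h2 := prism (fun y => g * y) x
    have h3 := prism (fun y => h * y) x
    have h4 := bd_map (fun y => g * y) (pr (fun y => h * y) x)
    have h5 : mp (gl (g * h)) x = mp (gl g) (mp (gl h) x) := mp_gl_mul g h x
    have p1 : pr (fun y => (g * h) * y) (bd x) ∈ N0 K :=
      N0_mono hK1 (pr_N0 (hcen _ (C.mul_mem hg hh)) hbx)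
    have p2 : pr (fun y => g * y) (bd x) ∈ N0 K :=
      N0_mono hK1 (pr_N0 (hcen _ hg) hbx)
    have p3 : mp (gl g) (pr (fun y => h * y) (bd x)) ∈ N0 K :=
      gl_N0 (fun k hk => by rw [hcen g hg k hk, mul_assoc, mul_inv_cancel, mul_one]; exact hK1 hk) (pr_N0 (hcen _ hh) hbx)
    have p := Submodule.sub_mem _ (Submodule.add_mem _ p2 p3) p1
    convert p using 1
    rw [map_sub, map_sub, h4, eq_sub_iff_add_eq.mpr h1, eq_sub_iff_add_eq.mpr h2, eq_sub_iff_add_eq.mpr h3]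
    have h5' : mp (List.map fun y => (g * h) * y) x = mp (gl g) (mp (gl h) x) := h5
    rw [h5', map_sub, map_sub]
    abel

lemma theta_comm {K' K K1 C : Subgroup G} (hK1 : K1 ≤ K) (hC : C ≤ K') (hcen : ∀ g ∈ C, ∀ k ∈ K1, g * k = k * g) {D : ℕ} {x : LC G}
    (hx : x ∈ sp {l : List G | l.length = D}) (hbx : bd x ∈ N0 K1) {t : G} (ht : t ∈ ⁅C, C⁆) :
    pr (fun y => t * y) x ∈ Wsub K' K D := by
  let θ : G → LC G := fun g => pr (fun y => g * y) x
  have H : ∀ g ∈ C, ∀ h ∈ C, θ (g * h) - θ g - θ h ∈ Wsub K' K D := fun g hg h hh => theta_mul hK1 hC hcen hx hbx hg hh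
  have H1 : θ 1 ∈ Wsub K' K D := by
    have := Submodule.neg_mem _ (H 1 C.one_mem 1 C.one_mem)
    simpa using this
  have Hinv : ∀ g ∈ C, θ g⁻¹ + θ g ∈ Wsub K' K D := by
    intro g hg
    have := Submodule.sub_mem _ H1 (H g hg g⁻¹ (C.inv_mem hg))
    rw [mul_inv_cancel] at this
    convert this using 1; abel
  let T : Subgroup G :=
    { carrier := {g | g ∈ C ∧ θ g ∈ Wsub K' K D}
      one_mem' := ⟨C.one_mem, H1⟩
      mul_mem' := fun {a b} ha hb => ⟨C.mul_mem ha.1 hb.1, by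
        have := Submodule.add_mem _ (Submodule.add_mem _ (H a ha.1 b hb.1) ha.2) hb.2
        convert this using 1; abel⟩
      inv_mem' := fun {a} ha => ⟨C.inv_mem ha.1, by
        have := Submodule.sub_mem _ (Hinv a ha.1) ha.2
        convert this using 1; abel⟩ }
  have hT : ⁅C, C⁆ ≤ T := by
    rw [Subgroup.commutator_le]
    intro g hg h hh
    refine ⟨?_, ?_⟩
    · rw [commutatorElement_def]
      exact C.mul_mem (C.mul_mem (C.mul_mem hg hh) (C.inv_mem hg)) (C.inv_mem hh)
    · rw [commutatorElement_def]
      have a1 := H (g * h * g⁻¹) (C.mul_mem (C.mul_mem hg hh) (C.inv_mem hg)) h⁻¹ (C.inv_mem hh)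
      have a2 := H (g * h) (C.mul_mem hg hh) g⁻¹ (C.inv_mem hg)
      have a3 := H g hg h hh
      have := Submodule.add_mem _ (Submodule.add_mem _ (Submodule.add_mem _ (Submodule.add_mem _ a1 a2) a3) (Hinv g hg)) (Hinv h hh)
      convert this using 1; abel
  exact (hT ht).2

lemma swap_abs {K' K K1' K1 C : Subgroup G} (hK1 : K1 ≤ K) (hC : C ≤ K') (hcen : ∀ g ∈ C, ∀ k ∈ K1, g * k = k * g)
    {t : G} (ht : t ∈ ⁅C, C⁆) (htC : t ∈ C) (htK : ∀ k ∈ K1', t * k * t⁻¹ ∈ K) {D : ℕ} (w : MC G) (hw : w ∈ dg0 D) (hc : cd w ∈ R0 K1' K1) :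
    ∃ y ∈ dg0 (D+1), w - cd y ∈ R0 K' K := by
  obtain ⟨x', x⟩ := w
  obtain ⟨hx', hx⟩ := hw
  obtain ⟨hc1, hc2⟩ := hc
  replace hc1 : bd x' + x ∈ N0 K1' := hc1
  replace hc2 : bd x ∈ N0 K1 := by
    have : - bd x ∈ N0 K1 := hc2
    simpa using this
  obtain ⟨u, hu, z, ⟨hz1, hz2⟩, huz⟩ := Submodule.mem_sup.mp (theta_comm (K := K) hK1 hC hcen hx hc2 ht)
  obtain ⟨n, hn, v, ⟨y', hy', rfl⟩, hnv⟩ := Submodule.mem_sup.mp hu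
  have hP := prism (fun y => t * y) x
  have hb := bd_map (fun y => t * y) x'
  refine ⟨(- y', mp (gl t) x' + pr (fun y => t * y) x - z), ⟨Submodule.neg_mem _ hy', ?_⟩, ?_⟩
  · exact Submodule.sub_mem _ (Submodule.add_mem _ (gl_len t hx') (pr_len _ hx)) hz1
  · rw [cd_apply]
    refine ⟨?_, ?_⟩
    · show x' - (bd (- y') + (mp (gl t) x' + pr (fun y => t * y) x - z)) ∈ N0 K'
      have := Submodule.neg_mem _ (Submodule.add_mem _ (N0_tr (hC htC) x') hn)
      convert this using 1
      rw [← huz, ← hnv, map_neg]; abel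
    · show x - (- bd (mp (gl t) x' + pr (fun y => t * y) x - z)) ∈ N0 K
      have h1 := gl_N0 htK hc1
      have h2 := N0_mono hK1 (pr_N0 (hcen t htC) hc2)
      have := Submodule.sub_mem _ (Submodule.sub_mem _ h1 h2) hz2
      convert this using 1
      rw [map_sub, map_add, map_add]
      have hb' : bd (mp (gl t) x') = mp (gl t) (bd x') := hb
      rw [hb', eq_sub_iff_add_eq.mpr hP]
      show _ = mp (gl t) (bd x') + mp (gl t) x - _ - _
      abel
end swap

section geo
variable {F : Type} [Field F]

lemma E_exists {p q : ℕ} (hpq : p ≠ q) (s : F) : ∃ g ∈ Ga F {p, q} ∅, g • (e p : EE F) = e p ∧ g • (f q : EE F) = f q ∧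
    g • (f p : EE F) = f p + s • f q ∧ g • (e q : EE F) = e q - s • e p := by
  obtain ⟨g, hg⟩ := eich_exists (e p) (s • f q : EE F) (Q_e p) (by rw [map_smul, be_f, e_fst_ne hpq.symm, smul_zero])
  have hQ : qF F (s • f q : EE F) = 0 := by
    rw [QuadraticMap.map_smul, Q_f, smul_zero]
  have H : ∀ x : EE F, g • x = x + (x p).2 • (s • f q) - (s * (x q).1) • e p := by
    intro x
    rw [hg, hQ, map_smul, be_e, be_f, zero_mul, add_zero, smul_eq_mul]
  refine ⟨g, mem_Ga.mpr ⟨?_, ?_⟩, ?_, ?_, ?_, ?_⟩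
  · intro j hj
    have hj2 : q ≠ j := by rintro rfl; simp at hj
    rw [H, e_snd, e_fst_ne hj2]; simp
  · intro j hj _
    have hj2 : p ≠ j := by rintro rfl; simp at hj
    rw [H, f_fst, f_snd_ne hj2]; simp
  · rw [H, e_snd, e_fst_ne hpq.symm]; simp
  · rw [H, f_fst, f_snd_ne hpq]; simp
  · rw [H, f_fst, f_self]; simp
  · rw [H, e_snd, e_self]; simp

lemma E_comm {x : F} (hx0 : x ≠ 0) (hx1 : x ≠ 1) {p q : ℕ} (hpq : p ≠ q) (s : F) : ∃ g ∈ Ga F {p, q} ∅, g ∈ ⁅Ga F {p, q} ∅, Ga F {p, q} ∅⁆ ∧ g • (e p : EE F) = e p ∧ g • (f q : EE F) = f q ∧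
    g • (f p : EE F) = f p + s • f q ∧ g • (e q : EE F) = e q - s • e p := by
  obtain ⟨U, hU, u1, u2, u3, u4⟩ := E_exists hpq s
  have hxi : x⁻¹ - 1 ≠ 0 := by
    intro h
    apply hx1
    rw [sub_eq_zero, inv_eq_one] at h
    exact h
  set t : F := s / (x⁻¹ - 1) with ht
  have hts : t * x⁻¹ = s + t := by
    have : t * (x⁻¹ - 1) = s := div_mul_cancel₀ _ hxi
    rw [← this]; ring
  have hts2 : x * (s + t) = t := by rw [← hts]; field_simp
  obtain ⟨V, hV, v1, v2, v3, v4⟩ := E_exists hpq t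
  obtain ⟨h, hh, h1, h2⟩ := torus_exists q x hx0
  have hhp : p ∉ ({q} : Finset ℕ) := by simpa using hpq
  have hC : h ∈ Ga F {p, q} ∅ := Ga_mono (by simp) (by simp) hh
  have he : h • (e p : EE F) = e p := hh.1 p hhp
  have hf : h • (f p : EE F) = f p := hh.2 p hhp (by simp)
  refine ⟨U, hU, ?_, u1, u2, u3, u4⟩
  have key : U * V * h = h * V := by
    apply g_ext_basis
    · intro j
      by_cases hjp : j = p
      · subst hjp
        simp only [mul_smul, he, v1, u1]
      · by_cases hjq : j = q
        · subst hjq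
          simp only [mul_smul, h1, v4, g_smul, g_sub, u4, u1, he]
          have : (x : F) • (e j - s • e p - t • e p : EE F) = x • e j - (x * (s + t)) • e p := by
            rw [sub_sub, ← add_smul, smul_sub, smul_smul]
          rw [this, hts2]
        · have hj : j ∉ ({p, q} : Finset ℕ) := by simp [hjp, hjq]
          simp only [mul_smul, hC.1 j hj, hV.1 j hj, hU.1 j hj]
    · intro j
      by_cases hjp : j = p
      · subst hjp
        simp only [mul_smul, hf, v3, g_smul, g_add, u3, u2, h2]
        have : (t : F) • (x⁻¹ • f q : EE F) = s • f q + t • f q := by rw [← add_smul, ← hts, mul_smul]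
        rw [this]; abel
      · by_cases hjq : j = q
        · subst hjq
          simp only [mul_smul, h2, v2, g_smul, u2]
        · have hj : j ∉ ({p, q} : Finset ℕ) := by simp [hjp, hjq]
          simp only [mul_smul, hC.2 j hj (by simp), hV.2 j hj (by simp), hU.2 j hj (by simp)]
  have hUc : U = h * V * h⁻¹ * V⁻¹ := by
    rw [← key]; group
  rw [hUc]
  exact Subgroup.commutator_mem_commutator hC hV

lemma tau_exists {x : F} (hx0 : x ≠ 0) (hx1 : x ≠ 1) {a i : ℕ} (h : a ≠ i) : ∃ t ∈ Ga F {a, i} ∅, t ∈ ⁅Ga F {a, i} ∅, Ga F {a, i} ∅⁆ ∧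
    t • (e i : EE F) = - e a ∧ t • (f i : EE F) = - f a := by
  obtain ⟨U, hU, hUc, u1, u2, u3, u4⟩ := E_comm hx0 hx1 h 1
  obtain ⟨L, hL, hLc, l1, l2, l3, l4⟩ := E_comm hx0 hx1 h.symm (-1)
  rw [Finset.pair_comm] at hL hLc
  refine ⟨U * L * U, mul_mem (mul_mem hU hL) hU, mul_mem (mul_mem hUc hLc) hUc, ?_, ?_⟩
  · simp only [mul_smul, u4, g_sub, l1, g_smul, l4, one_smul, u1, g_add, sub_neg_eq_add, neg_smul]; abel
  · simp only [mul_smul, u2, g_sub, l3, u3, g_add, g_smul, neg_smul, one_smul]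
    rw [← neg_one_smul F (f a : EE F), g_smul, u3]; simp

lemma Bstep0 {x : F} (hx0 : x ≠ 0) (hx1 : x ≠ 1) (D : ℕ) (hD : 1 ≤ D) (hB : ∀ q < D, BV F q) (hN : ∀ q ≤ D, NS F q) (A : Finset ℕ) (a : ℕ)
    (haA : a ∉ A) (hDA : D ≤ A.card) : RV (Ga F (insert a A) ∅) (Ga F A ∅) D := by
  obtain ⟨i, hi⟩ : A.Nonempty := Finset.card_pos.mp (by omega)
  have hai : a ≠ i := by rintro rfl; exact haA hi
  obtain ⟨t, htC, htc, t1, t2⟩ := tau_exists hx0 hx1 hai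
  intro w hw hc
  obtain ⟨w1, hw1, hc1, y, hy, h1⟩ := Bred hx0 hx1 D hD hB hN A a i haA hi hDA w hw hc
  have ti1 : t⁻¹ • (e a : EE F) = - e i := by
    rw [inv_smul_eq_iff, ← neg_one_smul F (e i : EE F), g_smul, t1]; simp
  have ti2 : t⁻¹ • (f a : EE F) = - f i := by
    rw [inv_smul_eq_iff, ← neg_one_smul F (f i : EE F), g_smul, t2]; simp
  have htC' := (Ga F {a, i} ∅).inv_mem htC
  obtain ⟨y1, hy1, h2⟩ := swap_abs (K' := Ga F (insert a A) ∅) (K := Ga F A ∅) (K1' := Ga F (insert a (A.erase i)) ∅) (K1 := Ga F (A.erase i) ∅)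
    (C := Ga F {a, i} ∅) (Ga_mono (Finset.erase_subset _ _) (by simp))
    (Ga_mono (by intro j hj; simp at hj; rcases hj with rfl | rfl <;> simp [hi]) (by simp))
    (fun g hg k hk => comm_Ga hg
      (fun j hj => hk.1 j (by simp at hj; rcases hj with rfl | rfl <;> simp [haA]))
      (fun j hj => hk.2 j (by simp at hj; rcases hj with rfl | rfl <;> simp [haA]) (by simp)))
    htc htC (by
      intro k hk
      have hia : i ∉ insert a (A.erase i) := by simp [hai.symm]
      refine mem_Ga.mpr ⟨?_, ?_⟩
      · intro j hj
        by_cases hja : j = a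
        · subst hja
          rw [mul_smul, mul_smul, ti1, ← neg_one_smul F (e i : EE F), g_smul, hk.1 i hia, g_smul, t1]; simp
        · have hji : j ≠ i := by rintro rfl; exact hj hi
          have hj1 : j ∉ ({a, i} : Finset ℕ) := by simp [hja, hji]
          rw [mul_smul, mul_smul, htC'.1 j hj1, hk.1 j (by simp [hja, hj]), htC.1 j hj1]
      · intro j hj _
        by_cases hja : j = a
        · subst hja
          rw [mul_smul, mul_smul, ti2, ← neg_one_smul F (f i : EE F), g_smul, hk.2 i hia (by simp), g_smul, t2]; simp
        · have hji : j ≠ i := by rintro rfl; exact hj hi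
          have hj1 : j ∉ ({a, i} : Finset ℕ) := by simp [hja, hji]
          rw [mul_smul, mul_smul, htC'.2 j hj1 (by simp), hk.2 j (by simp [hja, hj]) (by simp), htC.2 j hj1 (by simp)])
    w1 hw1 hc1
  refine ⟨y + y1, Submodule.add_mem _ hy hy1, ?_⟩
  have := Submodule.add_mem _ h1 h2
  convert this using 1
  rw [map_add]; abel

lemma Bstep {x : F} (hx0 : x ≠ 0) (hx1 : x ≠ 1) (D : ℕ) (hB : ∀ q < D, BV F q) (hN : ∀ q ≤ D, NS F q) : BV F D := by
  intro A B a hAB haA haB hDA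
  rcases Nat.eq_zero_or_pos D with rfl | hD
  · exact RV_zero (Ga_mono (Finset.subset_insert _ _) Finset.subset_union_right)
  induction B using Finset.induction_on with
  | empty => exact Bstep0 hx0 hx1 D hD hB hN A a haA hDA
  | insert b B hb ih =>
    rw [Finset.disjoint_insert_right] at hAB
    have hab : a ≠ b := by rintro rfl; simp at haB
    have haB' : a ∉ B := fun h => haB (Finset.mem_insert_of_mem h)
    intro w hw hc
    obtain ⟨w1, hw1, hc1, y, hy, h1⟩ := hN D le_rfl A B a b hAB.2 haA haB' hAB.1 hb hab (by omega) w hw hc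
    obtain ⟨y1, hy1, h2⟩ := ih hAB.2 haB' w1 hw1 hc1
    refine ⟨y + y1, Submodule.add_mem _ hy hy1, ?_⟩
    have h2' := R0_mono (L' := Ga F (insert a A) (insert b B)) (L := Ga F A (insert b B))
      (Ga_mono (subset_refl _) ((Finset.subset_insert _ _).trans Finset.subset_union_right))
      (Ga_mono (subset_refl _) ((Finset.subset_insert _ _).trans Finset.subset_union_right)) h2
    have := Submodule.add_mem _ h1 h2'
    convert this using 1
    rw [map_add]; abel

theorem BV_all {x : F} (hx0 : x ≠ 0) (hx1 : x ≠ 1) (D : ℕ) : BV F D := by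
  suffices h : ∀ D, BV F D ∧ NS F D from (h D).1
  intro D
  induction D using Nat.strong_induction_on with
  | _ D ih =>
    have hNS : NS F D := Nstep hx0 hx1 D (fun q hq => (ih q hq).1) (fun q hq => (ih q hq).2)
    refine ⟨Bstep hx0 hx1 D (fun q hq => (ih q hq).1) ?_, hNS⟩
    intro q hq
    rcases Nat.lt_or_eq_of_le hq with h | rfl
    · exact (ih q h).2
    · exact hNS

end geo

end HS

set_option linter.all false
namespace HS
open Finsupp GroupHomologyBar

section bar
variable {Γ : Type} [Group Γ]

/-- alternating sum of contractions -/
noncomputable def cL : List Γ → LC Γ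
  | [] => 0
  | [g] => - sg []
  | g :: h :: l => - sg (g * h :: l) - cn g (cL (h :: l))

noncomputable def dL : List Γ → LC Γ
  | [] => 0
  | g :: l => sg l + cL (g :: l)

noncomputable abbrev io (q : ℕ) : chains Γ ℤ q →ₗ[ℤ] LC Γ := mp (fun v : Fin q → Γ => List.ofFn v)

lemma cL_ofFn (n : ℕ) : ∀ g : Fin (n+1) → Γ,
    ∑ j : Fin (n+1), ((-1 : ℤ) ^ ((j : ℕ) + 1)) • (sg (List.ofFn (Fin.contractNth j (· * ·) g)) : LC Γ) = cL (List.ofFn g) := by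
  induction n with
  | zero =>
    intro g
    simp [cL]
  | succ n ih =>
    intro g
    have e : List.ofFn g = g 0 :: List.ofFn (Fin.tail g) := List.ofFn_succ
    have e2 : List.ofFn (Fin.tail g) = g 1 :: List.ofFn (Fin.tail (Fin.tail g)) := List.ofFn_succ
    have h1 := ih (Fin.tail g)
    rw [e, e2, cL, ← e2, ← h1, Fin.sum_univ_succ, sub_eq_add_neg]
    congr 1
    · have : List.ofFn (Fin.contractNth 0 (· * ·) g) = g 0 * g 1 :: List.ofFn (Fin.tail (Fin.tail g)) := by
        rw [List.ofFn_succ]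
        congr 1
      rw [this]; simp
    · rw [map_sum, ← Finset.sum_neg_distrib]
      refine Finset.sum_congr rfl (fun j _ => ?_)
      have : List.ofFn (Fin.contractNth j.succ (· * ·) g) = g 0 :: List.ofFn (Fin.contractNth j (· * ·) (Fin.tail g)) := by
        rw [List.ofFn_succ]
        congr 1
        congr 1
        funext k
        simp only [Fin.contractNth, Fin.tail, Fin.val_succ, Nat.succ_lt_succ_iff, add_lt_add_iff_right, add_left_inj]
        rfl
      rw [this, map_smul, lx_sg, Fin.val_succ, pow_succ]
      simp

lemma io_d (n : ℕ) (c : chains Γ ℤ (n+1)) : io n (d Γ ℤ n c) = lx dL (io (n+1) c) := by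
  refine lhom_congr (α := Fin (n+1) → Γ) (M := LC Γ) (f := LinearMap.comp (io n) (d Γ ℤ n)) (g := LinearMap.comp (lx dL) (io (n+1))) ?_ c
  intro g
  rw [LinearMap.comp_apply, LinearMap.comp_apply, lx_sg, lx_sg, d_single, map_add, map_sum, lx_sg]
  have e : List.ofFn g = g 0 :: List.ofFn (Fin.tail g) := List.ofFn_succ
  show _ = dL (List.ofFn g)
  rw [e, dL, ← e, ← cL_ofFn]
  congr 1
  refine Finset.sum_congr rfl (fun j _ => ?_)
  rw [map_smul, lx_sg]

noncomputable def rho (q : ℕ) : LC Γ →ₗ[ℤ] chains Γ ℤ q :=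
  lx (fun l => if h : l.length = q then sg (fun i => l.get (i.cast h.symm)) else 0)

lemma rho_ofFn (q : ℕ) (v : Fin q → Γ) : rho q (sg (List.ofFn v)) = sg v := by
  rw [rho, lx_sg, dif_pos (List.length_ofFn)]
  congr 1
  funext i
  simp

lemma rho_io (q : ℕ) (c : chains Γ ℤ q) : rho q (io q c) = c := by
  refine lhom_congr (α := Fin q → Γ) (M := chains Γ ℤ q) (f := LinearMap.comp (rho q) (io q)) (g := LinearMap.id) ?_ c
  intro v
  rw [LinearMap.comp_apply, lx_sg, rho_ofFn]; rfl

lemma io_rho {q : ℕ} {x : LC Γ} (hx : x ∈ sp {l : List Γ | l.length = q}) : io q (rho q x) = x := by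
  refine sp_congr (f := LinearMap.comp (io q) (rho q)) (g := LinearMap.id) ?_ x hx
  intro l hl
  obtain rfl : l.length = q := hl
  have := rho_ofFn l.length l.get
  rw [List.ofFn_get] at this
  rw [LinearMap.comp_apply, this, lx_sg]
  show sg (List.ofFn l.get) = sg l
  rw [List.ofFn_get]

lemma d_rho {q : ℕ} {x : LC Γ} (hx : x ∈ sp {l : List Γ | l.length = q + 1}) : d Γ ℤ q (rho (q+1) x) = rho q (lx dL x) := by
  rw [← rho_io q (d Γ ℤ q _), io_d, io_rho hx]

lemma io_len (q : ℕ) (c : chains Γ ℤ q) : io q c ∈ sp {l : List Γ | l.length = q} := by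
  refine sp_le (s := Set.univ) (io q) _ ?_ c (by simp [sp])
  intro v _
  rw [lx_sg]
  exact sg_mem_sp (s := {l : List Γ | l.length = q}) (List.length_ofFn)

lemma rho_map {Γ' : Type} [Group Γ'] (φ : Γ →* Γ') (q : ℕ) (x : LC Γ) : rho q (mp (List.map φ) x) = chainsMap ℤ φ q (rho q x) := by
  refine lhom_congr (α := List Γ) (M := chains Γ' ℤ q) (f := LinearMap.comp (rho q) (mp (List.map φ))) (g := LinearMap.comp (chainsMap ℤ φ q) (rho q)) ?_ x
  intro l
  rw [LinearMap.comp_apply, LinearMap.comp_apply, lx_sg, rho, rho, lx_sg, lx_sg]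
  by_cases h : l.length = q
  · rw [dif_pos h, dif_pos (by simpa using h), chainsMap_single]
    congr 1
    funext i; simp
  · rw [dif_neg h, dif_neg (by simpa using h), map_zero]

lemma io_map {Γ' : Type} [Group Γ'] (φ : Γ →* Γ') (q : ℕ) (x : chains Γ ℤ q) : io q (chainsMap ℤ φ q x) = mp (List.map φ) (io q x) := by
  refine lhom_congr (α := Fin q → Γ) (M := LC Γ') (f := LinearMap.comp (io q) (chainsMap ℤ φ q)) (g := LinearMap.comp (mp (List.map φ)) (io q)) ?_ x
  intro v
  rw [LinearMap.comp_apply, LinearMap.comp_apply, chainsMap_single, lx_sg, lx_sg, lx_sg]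
  rw [List.map_ofFn]

variable {G : Type} [Group G]

/-- partial products -/
def pl (j : Γ →* G) : G → List Γ → List G
  | x, [] => [x]
  | x, g :: l => x :: pl j (x * j g) l

lemma pl_length (j : Γ →* G) (x : G) (l : List Γ) : (pl j x l).length = l.length + 1 := by
  induction l generalizing x with
  | nil => rfl
  | cons g l ih => simp [pl, ih]
lemma pl_gl (j : Γ →* G) (y x : G) (l : List Γ) : pl j (y * x) l = gl y (pl j x l) := by
  induction l generalizing x with
  | nil => simp [pl]
  | cons g l ih => simp only [pl, mul_assoc, ih]; rfl

lemma pl_cL (j : Γ →* G) (x : G) (g : Γ) (l : List Γ) : cn x (bdL (pl j (x * j g) l)) = - mp (pl j x) (cL (g :: l)) := by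
  induction l generalizing x g with
  | nil => simp [pl, cL, bdL]
  | cons h l ih =>
    have h2 : ∀ u : LC Γ, mp (pl j x) (cn g u) = cn x (mp (pl j (x * j g)) u) := by
      intro u
      refine lhom_congr (α := List Γ) (M := LC G) (f := LinearMap.comp (mp (pl j x)) (cn g)) (g := LinearMap.comp (cn x) (mp (pl j (x * j g)))) ?_ u
      intro l
      rw [LinearMap.comp_apply, LinearMap.comp_apply, lx_sg, lx_sg, lx_sg, lx_sg, pl]
    rw [pl, bdL, cL, ih, map_sub, map_sub, map_neg, h2, map_neg, lx_sg, lx_sg, pl, map_mul, mul_assoc]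
    abel

lemma bd_pl {K : Subgroup G} (j : Γ →* G) (hj : ∀ g, j g ∈ K) (l : List Γ) (hl : l ≠ []) : bd (sg (pl j 1 l)) - mp (pl j 1) (dL l) ∈ N0 K := by
  cases l with
  | nil => exact absurd rfl hl
  | cons g l =>
    rw [lx_sg, pl, bdL, pl_cL, dL, map_add, lx_sg, one_mul]
    have h1 := N0_gen (hj g) (pl j 1 l)
    rw [← pl_gl, mul_one] at h1
    convert h1 using 1
    abel

/-- consecutive differences -/
def df (ji : G → Γ) (κ : G → G) : List G → List Γ
  | [] => []
  | [x] => []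
  | x :: y :: l => ji ((κ x)⁻¹ * κ y) :: df ji κ (y :: l)

lemma df_length (ji : G → Γ) (κ : G → G) (x : G) (l : List G) : (df ji κ (x :: l)).length = l.length := by
  induction l generalizing x with
  | nil => rfl
  | cons g l ih => simp [df, ih]

lemma df_cL {ji : G → Γ} {κ : G → G} (hm : ∀ x y z, ji ((κ x)⁻¹ * κ z) = ji ((κ x)⁻¹ * κ y) * ji ((κ y)⁻¹ * κ z)) (x y : G) (l : List G) :
    mp (df ji κ) (cn x (bdL (y :: l))) = - cL (df ji κ (x :: y :: l)) := by
  induction l generalizing x y with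
  | nil => simp [df, cL, bdL]
  | cons z l ih =>
    have h2 : ∀ u : LC G, mp (df ji κ) (cn x (cn y u)) = cn (ji ((κ x)⁻¹ * κ y)) (mp (df ji κ) (cn y u)) := by
      intro u
      refine lhom_congr (α := List G) (M := LC Γ) (f := LinearMap.comp (mp (df ji κ)) (LinearMap.comp (cn x) (cn y))) (g := LinearMap.comp (cn (ji ((κ x)⁻¹ * κ y))) (LinearMap.comp (mp (df ji κ)) (cn y))) ?_ u
      intro l
      simp only [LinearMap.comp_apply, lx_sg, df]
    have h3 := ih y z
    rw [bdL, map_sub, map_sub, h2, h3, lx_sg, lx_sg]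
    simp only [df]
    rw [cL, hm x y z, map_neg]
    abel

lemma df_bd {ji : G → Γ} {κ : G → G} (hm : ∀ x y z, ji ((κ x)⁻¹ * κ z) = ji ((κ x)⁻¹ * κ y) * ji ((κ y)⁻¹ * κ z)) {q : ℕ} {u : LC G}
    (hu : u ∈ sp {l : List G | l.length = q + 2}) : mp (df ji κ) (bd u) = lx dL (mp (df ji κ) u) := by
  refine sp_congr (f := LinearMap.comp (mp (df ji κ)) bd) (g := LinearMap.comp (lx dL) (mp (df ji κ))) ?_ u hu
  intro l hl
  replace hl : l.length = q + 2 := hl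
  match l, hl with
  | x :: y :: l, hl =>
    rw [LinearMap.comp_apply, LinearMap.comp_apply, lx_sg, lx_sg, lx_sg, bdL, map_sub, df_cL hm, lx_sg]
    simp only [df, dL]
    abel

lemma df_gl {ji : G → Γ} {κ : G → G} {k : G} (hk : ∀ g, κ (k * g) = k * κ g) (l : List G) : df ji κ (gl k l) = df ji κ l := by
  match l with
  | [] => rfl
  | [x] => rfl
  | x :: y :: l =>
    have := df_gl (ji := ji) hk (y :: l)
    simp only [gl, List.map_cons, df] at this ⊢
    rw [this, hk, hk]; congr 1; congr 1; group

/-- the comparison map from homogeneous chains to bar chains -/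
noncomputable def et (ji : G → Γ) (κ : G → G) (q : ℕ) : LC G →ₗ[ℤ] chains Γ ℤ q :=
  LinearMap.comp (rho q) (lx (fun l => match l with
    | [] => 0
    | a :: l => sg (df ji κ (a :: l))))

lemma et_len (ji : G → Γ) (κ : G → G) {q : ℕ} {m : ℕ} {x : LC G} (hx : x ∈ sp {l : List G | l.length = m + 1}) : et ji κ q x = rho q (mp (df ji κ) x) := by
  refine sp_congr (f := et ji κ q) (g := LinearMap.comp (rho q) (mp (df ji κ))) ?_ x hx
  intro l hl
  replace hl : l.length = m + 1 := hl
  match l, hl with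
  | a :: l, hl => rw [LinearMap.comp_apply, et, LinearMap.comp_apply, lx_sg, lx_sg]

lemma df_len (ji : G → Γ) (κ : G → G) {m : ℕ} {x : LC G} (hx : x ∈ sp {l : List G | l.length = m + 1}) : mp (df ji κ) x ∈ sp {l : List Γ | l.length = m} := by
  refine sp_le (mp (df ji κ)) _ ?_ x hx
  intro l hl
  replace hl : l.length = m + 1 := hl
  match l, hl with
  | a :: l, hl =>
    rw [lx_sg]
    exact sg_mem_sp (s := {l : List Γ | l.length = m}) (by show (df ji κ (a :: l)).length = m; rw [df_length]; simpa using hl)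

lemma et_bd {ji : G → Γ} {κ : G → G} (hm : ∀ x y z, ji ((κ x)⁻¹ * κ z) = ji ((κ x)⁻¹ * κ y) * ji ((κ y)⁻¹ * κ z)) {q : ℕ} {u : LC G}
    (hu : u ∈ sp {l : List G | l.length = q + 2}) : et ji κ q (bd u) = d Γ ℤ q (et ji κ (q+1) u) := by
  rw [et_len ji κ (bd_len hu), et_len ji κ hu, df_bd hm hu, d_rho (df_len ji κ hu)]

lemma et_N0 {K : Subgroup G} {ji : G → Γ} {κ : G → G} (hk : ∀ k ∈ K, ∀ g, κ (k * g) = k * κ g) (q : ℕ) {u : LC G} (hu : u ∈ N0 K) :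
    et ji κ q u = 0 := by
  have := N0_le (et ji κ q) ⊥ ?_ ?_ u hu
  · simpa using this
  · intro k hk' l
    rw [Submodule.mem_bot, et, LinearMap.comp_apply, LinearMap.comp_apply, lx_sg, lx_sg]
    match l with
    | [] => simp
    | a :: l =>
      have := df_gl (ji := ji) (hk k hk') (a :: l)
      simp only [gl, List.map_cons] at this ⊢
      rw [this, sub_self]
  · rw [Submodule.mem_bot, et, LinearMap.comp_apply, lx_sg, map_zero]

/-- the comparison map from bar chains to homogeneous chains -/
noncomputable def th (j : Γ →* G) (q : ℕ) : chains Γ ℤ q →ₗ[ℤ] LC G := LinearMap.comp (mp (pl j 1)) (io q)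

lemma th_len (j : Γ →* G) (q : ℕ) (c : chains Γ ℤ q) : th j q c ∈ sp {l : List G | l.length = q + 1} := by
  refine sp_le (mp (pl j 1)) _ ?_ _ (io_len q c)
  intro l hl
  rw [lx_sg]
  exact sg_mem_sp (s := {l : List G | l.length = q + 1}) (by show (pl j 1 l).length = q + 1; rw [pl_length]; exact congrArg (· + 1) hl)

lemma th_bd {K : Subgroup G} (j : Γ →* G) (hj : ∀ g, j g ∈ K) (q : ℕ) (c : chains Γ ℤ (q+1)) : bd (th j (q+1) c) - th j q (d Γ ℤ q c) ∈ N0 K := by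
  have e : bd (th j (q+1) c) - th j q (d Γ ℤ q c) = (LinearMap.comp bd (mp (pl j 1)) - LinearMap.comp (mp (pl j 1)) (lx dL)) (io (q+1) c) := by
    rw [th, th, LinearMap.comp_apply, LinearMap.comp_apply, io_d]; rfl
  rw [e]
  refine sp_le (LinearMap.comp bd (mp (pl j 1)) - LinearMap.comp (mp (pl j 1)) (lx dL)) _ ?_ _ (io_len (q+1) c)
  intro l hl
  have hl' : l ≠ [] := by
    rintro rfl
    simp at hl
  rw [LinearMap.sub_apply, LinearMap.comp_apply, LinearMap.comp_apply, lx_sg, lx_sg]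
  have := bd_pl j hj l hl'
  rw [lx_sg] at this ⊢
  exact this

lemma df_pl {j : Γ →* G} {ji : G → Γ} {κ : G → G} (hji : ∀ g, ji (j g) = g) (hκ : ∀ g, κ (j g) = j g) (x : Γ) (l : List Γ) :
    df ji κ (pl j (j x) l) = l := by
  induction l generalizing x with
  | nil => rfl
  | cons g l ih =>
    have h1 := ih (x * g)
    rw [map_mul] at h1
    have h2 : ∃ m, pl j (j x * j g) l = (j x * j g) :: m := by
      cases l with
      | nil => exact ⟨[], rfl⟩
      | cons b l => exact ⟨_, rfl⟩
    obtain ⟨m, hm⟩ := h2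
    rw [pl, hm, df, ← hm, h1, ← map_mul, hκ, hκ, ← map_inv, ← map_mul, hji]
    congr 1; group

lemma et_th {j : Γ →* G} {ji : G → Γ} {κ : G → G} (hji : ∀ g, ji (j g) = g) (hκ : ∀ g, κ (j g) = j g) (q : ℕ) (c : chains Γ ℤ q) :
    et ji κ q (th j q c) = c := by
  rw [et_len ji κ (th_len j q c)]
  have : mp (df ji κ) (th j q c) = io q c := by
    refine lhom_congr (α := List Γ) (M := LC Γ) (f := LinearMap.comp (mp (df ji κ)) (mp (pl j 1))) (g := LinearMap.id) ?_ (io q c)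
    intro l
    have := df_pl hji hκ 1 l
    rw [map_one] at this
    rw [LinearMap.comp_apply, lx_sg, lx_sg, this]; rfl
  rw [this, rho_io]

end bar
end HS

set_option linter.all false
namespace HS
open Finsupp GroupHomologyBar

section stab
variable {Γ Γ' G : Type} [Group Γ] [Group Γ'] [Group G]

lemma ji_exists {K : Subgroup G} (j : Γ →* G) (hinj : Function.Injective j) (h1 : ∀ g, j g ∈ K) (h2 : ∀ k ∈ K, ∃ g, j g = k) :
    ∃ ji : G → Γ, (∀ g, ji (j g) = g) ∧ ∃ κ : G → G, (∀ g, κ g ∈ K) ∧ (∀ k ∈ K, ∀ g, κ (k * g) = k * κ g) ∧ (∀ k ∈ K, κ k = k) ∧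
      (∀ x y z, ji ((κ x)⁻¹ * κ z) = ji ((κ x)⁻¹ * κ y) * ji ((κ y)⁻¹ * κ z)) := by
  obtain ⟨κ, k1, k2, k3⟩ := exists_kappa K
  have hl := Function.leftInverse_invFun hinj
  refine ⟨Function.invFun j, hl, κ, k1, k2, k3, ?_⟩
  intro x y z
  obtain ⟨a, ha⟩ := h2 _ (k1 x)
  obtain ⟨b, hb⟩ := h2 _ (k1 y)
  obtain ⟨c, hc⟩ := h2 _ (k1 z)
  rw [← ha, ← hb, ← hc, ← map_inv, ← map_inv, ← map_mul, ← map_mul, ← map_mul, hl, hl, hl]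
  group

lemma kpr_N0 {K : Subgroup G} {κ : G → G} (hk : ∀ k ∈ K, ∀ g, κ (k * g) = k * κ g) {x : LC G} (hx : x ∈ N0 K) : pr κ x ∈ N0 K := by
  refine N0_le (pr κ) _ ?_ ?_ x hx
  · intro k hk' l
    rw [lx_sg, lx_sg]
    have : prL κ (gl k l) = mp (gl k) (prL κ l) := prL_comm _ _ (fun x => hk k hk' x) l
    rw [this]
    exact N0_tr hk' _
  · rw [lx_sg]; exact Submodule.zero_mem _

lemma df_kappa (φ : Γ →* Γ') (ji : G → Γ) (κ : G → G) (ji' : G → Γ') (κ' : G → G)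
    (h : ∀ x y, ji' ((κ' (κ x))⁻¹ * κ' (κ y)) = φ (ji ((κ x)⁻¹ * κ y))) (l : List G) : df ji' κ' (l.map κ) = (df ji κ l).map φ := by
  match l with
  | [] => rfl
  | [x] => rfl
  | x :: y :: l =>
    have := df_kappa φ ji κ ji' κ' h (y :: l)
    simp only [List.map_cons, df] at this ⊢
    rw [this, h]

lemma cyc_of {d : ℕ} {c : chains Γ ℤ d} (hc : c ∈ cycles Γ ℤ d) {K : Subgroup G} (j : Γ →* G) (hj : ∀ g, j g ∈ K) : bd (th j d c) ∈ N0 K := by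
  cases d with
  | zero => exact len0_N0 (bd_len (th_len j 0 c))
  | succ d =>
    have h : GroupHomologyBar.d Γ ℤ d c = 0 := hc
    have := th_bd j hj d c
    rwa [h, map_zero, sub_zero] at this

variable (φ : Γ →* Γ') (j : Γ →* G) (j' : Γ' →* G) {K K' : Subgroup G}

lemma th_phi (hφ : ∀ g, j' (φ g) = j g)
    (q : ℕ) (c : chains Γ ℤ q) : th j' q (chainsMap ℤ φ q c) = th j q c := by
  rw [th, th, LinearMap.comp_apply, LinearMap.comp_apply, io_map]
  refine lhom_congr (α := List Γ) (M := LC G) (f := LinearMap.comp (mp (pl j' 1)) (mp (List.map φ))) (g := mp (pl j 1)) ?_ (io q c)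
  intro l
  rw [LinearMap.comp_apply, lx_sg, lx_sg, lx_sg]
  congr 1
  generalize (1 : G) = x
  induction l generalizing x with
  | nil => rfl
  | cons g l ih => simp only [List.map_cons, pl, hφ, ih]

theorem surj_abs (hj : Function.Injective j) (hj' : Function.Injective j') (hφ : ∀ g, j' (φ g) = j g) (h1 : ∀ g, j g ∈ K) (h2 : ∀ k ∈ K, ∃ g, j g = k) (h1' : ∀ g, j' g ∈ K') (h2' : ∀ k ∈ K', ∃ g, j' g = k)
    (hKK : K ≤ K') (d : ℕ) (hRV : RV K' K d) : Function.Surjective (inducedMap ℤ φ d) := by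
  obtain ⟨ji, hji, κ, k1, k2, k3, hm⟩ := ji_exists j hj h1 h2
  obtain ⟨ji', hji', κ', k1', k2', k3', hm'⟩ := ji_exists j' hj' h1' h2'
  intro X
  obtain ⟨⟨c', hc'⟩, rfl⟩ := Submodule.Quotient.mk_surjective _ X
  obtain ⟨⟨y', y⟩, ⟨hy', hy⟩, hR1, hR2⟩ := hRV (th j' d c', 0) ⟨th_len j' d c', Submodule.zero_mem _⟩
    ⟨by show bd (th j' d c') + 0 ∈ _; rw [add_zero]; exact cyc_of hc' j' h1', by show - bd 0 ∈ _; simp⟩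
  replace hR1 : th j' d c' - (bd y' + y) ∈ N0 K' := hR1
  replace hR2 : bd y ∈ N0 K := by
    have : 0 - (- bd y) ∈ N0 K := hR2
    simpa using this
  replace hy' : y' ∈ sp {l : List G | l.length = d + 2} := hy'
  replace hy : y ∈ sp {l : List G | l.length = d + 1} := hy
  have hcyc : et ji κ d y ∈ cycles Γ ℤ d := by
    cases d with
    | zero => trivial
    | succ d =>
      show GroupHomologyBar.d Γ ℤ d _ = 0
      rw [← et_bd hm hy]; exact et_N0 k2 d hR2
  have e1 := et_N0 (ji := ji') k2' d hR1
  rw [map_sub, et_th hji' (fun g => k3' _ (h1' g)), map_add, et_bd hm' hy'] at e1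
  have hp := prism κ y
  have e2 : et ji' κ' d (mp (List.map κ) y) = chainsMap ℤ φ d (et ji κ d y) := by
    have hlen : mp (List.map κ) y ∈ sp {l : List G | l.length = d + 1} := by
      refine sp_le (mp (List.map κ)) _ ?_ y hy
      intro l hl
      rw [lx_sg]
      exact sg_mem_sp (s := {l : List G | l.length = d + 1}) (by simpa using hl)
    rw [et_len ji κ hy, et_len ji' κ' hlen, ← rho_map]
    congr 1
    refine lhom_congr (α := List G) (M := LC Γ') (f := LinearMap.comp (mp (df ji' κ')) (mp (List.map κ))) (g := LinearMap.comp (mp (List.map φ)) (mp (df ji κ))) ?_ y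
    intro l
    rw [LinearMap.comp_apply, LinearMap.comp_apply, lx_sg, lx_sg, lx_sg, lx_sg]
    congr 1
    apply df_kappa
    intro x y
    rw [k3' _ (hKK (k1 x)), k3' _ (hKK (k1 y))]
    obtain ⟨a, ha⟩ := h2 _ (k1 x)
    obtain ⟨b, hb⟩ := h2 _ (k1 y)
    rw [← ha, ← hb, ← map_inv, ← map_mul, hji, ← hφ, hji']
  have e3 : et ji' κ' d (pr κ (bd y)) = 0 := et_N0 k2' d (N0_mono hKK (kpr_N0 k2 hR2))
  have e4 := congrArg (et ji' κ' d) hp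
  rw [map_add, map_sub, e2, e3, et_bd hm' (pr_len κ hy)] at e4
  refine ⟨Submodule.Quotient.mk ⟨et ji κ d y, hcyc⟩, ?_⟩
  show Submodule.Quotient.mk (cyclesMap ℤ φ d ⟨et ji κ d y, hcyc⟩) = _
  rw [Submodule.Quotient.eq]
  show chainsMap ℤ φ d (et ji κ d y) - c' ∈ LinearMap.range (GroupHomologyBar.d Γ' ℤ d)
  refine ⟨et ji' κ' (d+1) (pr κ y) - et ji' κ' (d+1) y', ?_⟩
  rw [map_sub]
  have e5 : GroupHomologyBar.d Γ' ℤ d (et ji' κ' (d+1) y') = c' - et ji' κ' d y := by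
    rw [sub_eq_zero] at e1; rw [e1]; abel
  rw [e5]
  rw [add_zero] at e4
  rw [e4]; abel

theorem inj_abs (hj : Function.Injective j) (hφ : ∀ g, j' (φ g) = j g) (h1 : ∀ g, j g ∈ K) (h2 : ∀ k ∈ K, ∃ g, j g = k) (h1' : ∀ g, j' g ∈ K')
    (d : ℕ) (hRV : RV K' K (d+1)) : Function.Injective (inducedMap ℤ φ d) := by
  obtain ⟨ji, hji, κ, k1, k2, k3, hm⟩ := ji_exists j hj h1 h2
  rw [injective_iff_map_eq_zero]
  intro X hX
  obtain ⟨⟨c, hc⟩, rfl⟩ := Submodule.Quotient.mk_surjective _ X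
  have hX' : (Submodule.Quotient.mk (cyclesMap ℤ φ d ⟨c, hc⟩) : Homology Γ' ℤ d) = 0 := hX
  rw [Submodule.Quotient.mk_eq_zero] at hX'
  obtain ⟨b, hb⟩ : chainsMap ℤ φ d c ∈ LinearMap.range (GroupHomologyBar.d Γ' ℤ d) := hX'
  have t1 := th_bd j' h1' d b
  rw [hb, th_phi φ j j' hφ] at t1
  obtain ⟨⟨y', y⟩, ⟨hy', hy⟩, hR1, hR2⟩ := hRV (th j' (d+1) b, - th j d c) ⟨th_len j' (d+1) b, Submodule.neg_mem _ (th_len j d c)⟩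
    ⟨by show bd (th j' (d+1) b) + - th j d c ∈ _; rw [← sub_eq_add_neg]; exact t1,
     by show - bd (- th j d c) ∈ _; rw [map_neg, neg_neg]; exact cyc_of hc j h1⟩
  replace hR2 : - th j d c - (- bd y) ∈ N0 K := hR2
  replace hy : y ∈ sp {l : List G | l.length = d + 2} := hy
  have e1 := et_N0 (ji := ji) k2 d hR2
  rw [map_sub, map_neg, map_neg, et_th hji (fun g => k3 _ (h1 g)), et_bd hm hy] at e1
  rw [Submodule.Quotient.mk_eq_zero]
  refine ⟨et ji κ (d+1) y, ?_⟩
  show _ = c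
  rw [← sub_eq_zero, ← e1]; abel
end stab
end HS

set_option linter.all false
namespace HS
open Finsupp

section bridge
variable {F : Type} [Field F]

variable (F) in
def res (n : ℕ) : EE F →ₗ[F] (Fin n → F × F) where
  toFun v i := v i
  map_add' _ _ := rfl
  map_smul' _ _ := rfl

lemma res_apply (n : ℕ) (v : EE F) (i : Fin n) : res F n v i = v i := rfl

variable (F) in
noncomputable def emb (n : ℕ) : (Fin n → F × F) →ₗ[F] EE F :=
  ∑ i : Fin n, (Finsupp.lsingle (i : ℕ)).comp (LinearMap.proj i)

lemma emb_eq (n : ℕ) (u : Fin n → F × F) : emb F n u = ∑ i : Fin n, single (i : ℕ) (u i) := by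
  simp [emb]

lemma emb_lt (n : ℕ) (u : Fin n → F × F) (i : Fin n) : emb F n u i = u i := by
  rw [emb_eq, Finsupp.finsetSum_apply, Finset.sum_eq_single i]
  · simp
  · intro b _ hb
    rw [single_eq_of_ne]
    intro h; exact hb (Fin.ext h.symm)
  · simp

lemma emb_ge (n : ℕ) (u : Fin n → F × F) (k : ℕ) (hk : n ≤ k) : emb F n u k = 0 := by
  rw [emb_eq, Finsupp.finsetSum_apply]
  refine Finset.sum_eq_zero (fun i _ => ?_)
  rw [single_eq_of_ne]
  have := i.2
  omega

lemma res_emb (n : ℕ) (u : Fin n → F × F) : res F n (emb F n u) = u := by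
  funext i; rw [res_apply, emb_lt]

lemma emb_res (n : ℕ) (v : EE F) (hv : ∀ k, n ≤ k → v k = 0) : emb F n (res F n v) = v := by
  refine Finsupp.ext (fun k => ?_)
  by_cases hk : k < n
  · exact emb_lt n (res F n v) ⟨k, hk⟩
  · rw [emb_ge n _ k (by omega), hv k (by omega)]

lemma bF_emb (n : ℕ) (u : Fin n → F × F) (w : EE F) : bF F (emb F n u) w = ∑ i, (u i).1 * (w (i : ℕ)).2 := by
  rw [emb_eq, map_sum, LinearMap.sum_apply]
  exact Finset.sum_congr rfl (fun i _ => bF_single _ _ _)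

lemma bF_emb' (n : ℕ) (u : Fin n → F × F) (w : EE F) : bF F w (emb F n u) = ∑ i : Fin n, (w (i : ℕ)).1 * (u i).2 := by
  rw [emb_eq, map_sum]
  exact Finset.sum_congr rfl (fun i _ => bF_single' _ _ _)

lemma qF_emb (n : ℕ) (u : Fin n → F × F) : qF F (emb F n u) = sumForm F (hypPlaneQuad F) n u := by
  rw [qF_apply, bF_emb]
  exact Finset.sum_congr rfl (fun i _ => by rw [emb_lt]; rfl)

lemma qF_emb_add (n : ℕ) (u : Fin n → F × F) (w : EE F) (hw : res F n w = 0) :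
    qF F (emb F n u + w) = sumForm F (hypPlaneQuad F) n u + qF F w := by
  have h0 : ∀ i : Fin n, w (i : ℕ) = 0 := fun i => congrFun hw i
  rw [← qF_emb, qF_apply, qF_apply, qF_apply, map_add, map_add, LinearMap.add_apply, LinearMap.add_apply,
    bF_emb' n u w, bF_emb n u w]
  simp [h0]

abbrev On (F : Type) [Field F] (n : ℕ) := quadIsoms F (sumForm F (hypPlaneQuad F) n)

noncomputable def jT (n : ℕ) (g : On F n) : EE F →ₗ[F] EE F :=
  LinearMap.id + (emb F n).comp (g.1.toLinearMap.comp (res F n) - res F n)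

lemma jT_apply (n : ℕ) (g : On F n) (v : EE F) : jT n g v = v + emb F n (g.1 (res F n v) - res F n v) := rfl

lemma res_jT (n : ℕ) (g : On F n) (v : EE F) : res F n (jT n g v) = g.1 (res F n v) := by
  rw [jT_apply, map_add, res_emb]; abel

lemma jT_mul (n : ℕ) (g h : On F n) (v : EE F) : jT n (g * h) v = jT n g (jT n h v) := by
  rw [jT_apply n g, res_jT, jT_apply, jT_apply]
  show v + emb F n (g.1 (h.1 (res F n v)) - _) = _
  rw [add_assoc, ← map_add]
  congr 2; abel

lemma jT_one (n : ℕ) (v : EE F) : jT n (1 : On F n) v = v := by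
  rw [jT_apply]
  show v + emb F n (res F n v - res F n v) = v
  simp

lemma jT_Q (n : ℕ) (g : On F n) (v : EE F) : qF F (jT n g v) = qF F v := by
  have hw : res F n (v - emb F n (res F n v)) = 0 := by rw [map_sub, res_emb, sub_self]
  have e1 : jT n g v = emb F n (g.1 (res F n v)) + (v - emb F n (res F n v)) := by
    rw [jT_apply, map_sub]; abel
  have e2 : v = emb F n (res F n v) + (v - emb F n (res F n v)) := by abel
  rw [e1, qF_emb_add n _ _ hw]
  conv_rhs => rw [e2, qF_emb_add n _ _ hw]
  rw [g.2]

noncomputable def jj (n : ℕ) : On F n →* GG F where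
  toFun g := mkG (jT n g) (jT n g⁻¹) (fun v => by rw [← jT_mul, inv_mul_cancel, jT_one])
    (fun v => by rw [← jT_mul, mul_inv_cancel, jT_one]) (jT_Q n g)
  map_one' := g_ext (fun v => by rw [mkG_smul, jT_one, one_smul])
  map_mul' g h := g_ext (fun v => by rw [mul_smul, mkG_smul, mkG_smul, mkG_smul, jT_mul])

lemma jj_smul (n : ℕ) (g : On F n) (v : EE F) : jj n g • v = jT n g v := rfl

lemma jj_inj (n : ℕ) : Function.Injective (jj (F := F) n) := by
  intro g h hgh
  refine Subtype.ext (LinearEquiv.ext (fun u => ?_))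
  have := congrArg (fun k : GG F => res F n (k • emb F n u)) hgh
  simpa only [jj_smul, res_jT, res_emb] using this

lemma jj_fix (n : ℕ) (g : On F n) (v : EE F) (hv : res F n v = 0) : jj n g • v = v := by
  rw [jj_smul, jT_apply, hv]; simp

lemma jj_mem (n : ℕ) (g : On F n) : jj n g ∈ Ga F (Finset.range n) ∅ := by
  refine ⟨fun j hj => jj_fix n g _ ?_, fun j hj _ => jj_fix n g _ ?_⟩
  · funext i
    have hi := i.2
    rw [Finset.mem_range] at hj
    rw [res_apply, e_ne (by omega)]; rfl
  · funext i
    have hi := i.2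
    rw [Finset.mem_range] at hj
    rw [res_apply, f_ne (by omega)]; rfl

lemma emb_Va (n : ℕ) (u : Fin n → F × F) : emb F n u ∈ Va F (Finset.range n) ∅ := by
  refine ⟨fun j hj => ?_, fun j hj _ => ?_⟩ <;>
  · rw [Finset.mem_range, not_lt] at hj
    rw [emb_ge n u j hj]; rfl

lemma Va_emb_res (n : ℕ) {v : EE F} (hv : v ∈ Va F (Finset.range n) ∅) : emb F n (res F n v) = v := by
  refine emb_res n v (fun k hk => ?_)
  have : k ∉ Finset.range n := by rw [Finset.mem_range]; omega
  exact Prod.ext (hv.2 k this (by simp)) (hv.1 k this)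

lemma Ga_emb_res (n : ℕ) {k : GG F} (hk : k ∈ Ga F (Finset.range n) ∅) (u : Fin n → F × F) :
    emb F n (res F n (k • emb F n u)) = k • emb F n u := Va_emb_res n (Ga_Va hk (emb_Va n u))

lemma jj_surj (n : ℕ) (k : GG F) (hk : k ∈ Ga F (Finset.range n) ∅) : ∃ g, jj n g = k := by
  have hk' := Subgroup.inv_mem _ hk
  let T : GG F → (Fin n → F × F) →ₗ[F] (Fin n → F × F) := fun k =>
    (res F n).comp (k.1.toLinearMap.comp (emb F n))
  have hT : ∀ k u, T k u = res F n (k • emb F n u) := fun _ _ => rfl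
  let g : (Fin n → F × F) ≃ₗ[F] (Fin n → F × F) := LinearEquiv.ofLinear (T k) (T k⁻¹)
    (LinearMap.ext fun u => by
      show T k (T k⁻¹ u) = u
      rw [hT, hT, Ga_emb_res n hk', smul_inv_smul, res_emb])
    (LinearMap.ext fun u => by
      show T k⁻¹ (T k u) = u
      rw [hT, hT, Ga_emb_res n hk, inv_smul_smul, res_emb])
  refine ⟨⟨g, fun u => ?_⟩, g_ext fun v => ?_⟩
  · show sumForm F _ n (res F n (k • emb F n u)) = _
    rw [← qF_emb, Ga_emb_res n hk, g_Q, qF_emb]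
  · rw [jj_smul, jT_apply]
    show v + emb F n (res F n (k • emb F n (res F n v)) - res F n v) = _
    rw [map_sub, Ga_emb_res n hk]
    have hfix : k • (v - emb F n (res F n v)) = v - emb F n (res F n v) := by
      have h0 : ∀ j, j < n → (v - emb F n (res F n v)) j = 0 := by
        intro j hj
        rw [Finsupp.sub_apply, emb_lt n (res F n v) ⟨j, hj⟩, res_apply, sub_self]
      refine g_fix k _ (fun j hj => hk.1 j ?_) (fun j hj => hk.2 j ?_ (by simp))
      · intro hjn; rw [h0 j (Finset.mem_range.mp hjn)] at hj; exact hj rfl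
      · intro hjn; rw [h0 j (Finset.mem_range.mp hjn)] at hj; exact hj rfl
    rw [g_sub, sub_eq_iff_eq_add] at hfix
    rw [hfix]; abel

lemma jj_stab (n : ℕ) (g : On F n) : jj (n+1) (quadStab F (hypPlaneQuad F) n g) = jj n g := by
  refine g_ext fun v => ?_
  rw [jj_smul, jj_smul, jT_apply, jT_apply]
  have hs : res F (n+1) v = (lastSplit F n).symm (res F n v, v n) := by
    rw [LinearEquiv.eq_symm_apply]; rfl
  have hg : (quadStab F (hypPlaneQuad F) n g).1 (res F (n+1) v) = (lastSplit F n).symm (g.1 (res F n v), v n) := by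
    rw [hs]; exact stabAut_symm_apply F n g.1 _ _
  have he : ∀ u : Fin n → F × F, emb F (n+1) ((lastSplit F n).symm (u, 0)) = emb F n u := by
    intro u
    rw [emb_eq, emb_eq, Fin.sum_univ_castSucc, lastSplit_symm_apply]
    simp
  rw [hg, hs, ← map_sub, Prod.mk_sub_mk, sub_self, he]

end bridge

open GroupHomologyBar in
theorem final (F : Type) [Field F] (hF : ∃ x : F, x ≠ 0 ∧ x ≠ 1)
    (n : ℕ) (hn : 1 ≤ n) :
    (∀ d : ℕ, d ≤ n - 1 →
      Function.Bijective (inducedMap ℤ (quadStab F (hypPlaneQuad F) n) d)) ∧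
    Function.Surjective (inducedMap ℤ (quadStab F (hypPlaneQuad F) n) n) := by
  obtain ⟨x, hx0, hx1⟩ := hF
  have hRV : ∀ D, D ≤ n → RV (Ga F (Finset.range (n+1)) ∅) (Ga F (Finset.range n) ∅) D := by
    intro D hD
    have := BV_all hx0 hx1 D (Finset.range n) ∅ n (dje _) (by simp) (by simp) (by rwa [Finset.card_range])
    rwa [← Finset.range_add_one] at this
  have hle : Ga F (Finset.range n) ∅ ≤ Ga F (Finset.range (n+1)) ∅ :=
    Ga_mono (Finset.range_subset_range.mpr (Nat.le_succ n)) (by simp)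
  have hs : ∀ D, D ≤ n → Function.Surjective (inducedMap ℤ (quadStab F (hypPlaneQuad F) n) D) := fun D hD =>
    surj_abs _ (jj n) (jj (n+1)) (jj_inj n) (jj_inj (n+1)) (jj_stab n) (jj_mem n) (jj_surj n) (jj_mem (n+1)) (jj_surj (n+1)) hle D (hRV D hD)
  refine ⟨fun d hd => ⟨?_, hs d (by omega)⟩, hs n le_rfl⟩
  exact inj_abs _ (jj n) (jj (n+1)) (jj_inj n) (jj_stab n) (jj_mem n) (jj_surj n) (jj_mem (n+1)) d (hRV (d+1) (by omega))
end HS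

open GroupHomologyBar in
/-- Homological stability for the hyperbolic orthogonal groups over a field other than `𝔽₂`.
Here `O_{n,n}(F)` is realized as the group `quadIsoms F (sumForm F (hypPlaneQuad F) n)` of
linear automorphisms of `F^{2n} = (F²)ⁿ` preserving the hyperbolic quadratic form
`q_H^n(v) = ∑ᵢ vᵢ v_{n+i}`, where the `i`-th copy of `F²` carries the pair of coordinates
`(vᵢ, v_{n+i})`.  The stabilization map `O_{n,n}(F) → O_{n+1,n+1}(F)`, extending an
isometry by the identity on an added hyperbolic plane, induces an isomorphism on integral
group homology `H_d` for `d ≤ n - 1` and a surjection for `d = n`. -/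
theorem O_hyperbolic_homology_stability (F : Type) [Field F] (hF : ∃ x : F, x ≠ 0 ∧ x ≠ 1)
    (n : ℕ) (hn : 1 ≤ n) :
    (∀ d : ℕ, d ≤ n - 1 →
      Function.Bijective (inducedMap ℤ (quadStab F (hypPlaneQuad F) n) d)) ∧
    Function.Surjective (inducedMap ℤ (quadStab F (hypPlaneQuad F) n) n) := by
  exact HS.final F hF n hn
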